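/- Let K=K(c_1,c_2,c_2,c_1) be a symmetric A_4-crystal. For every self-complementary vertex v, the deviation Delta(v) of z(v) in Pi^up[a(v)] has the form (delta,0,-delta) for a unique integer delta=delta(v), and v=(F_2 F_3)^rho (F_3 F_2)^rho (stil(v)) for a unique integer rho=rho(v)>=0, where stil(v) is the source of the middle subcrystal Ktil(v). The map v -> (a_1(v),a_2(v),delta(v),rho(v)) is a bijection from S onto the set of integer quadruples (a_1,a_2,delta,rho) satisfying 0<=a_1<=c_1, 0<=a_2<=c_2, -a_2<=delta<=c_1-a_1, and 0<=rho<=c_2+delta. -/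

import Mathlib

open Classical

noncomputable section

/-- Iterate a partial operator `k` times. -/
def optIter {V : Type} (f : V → Option V) : ℕ → V → Option V
  | 0, v => some v
  | k + 1, v => (f v).bind (optIter f k)

/-- A vertex type together with, for every natural number (color) `i`,
a partial operator whose graph is the set of `i`-edges. -/
structure PreGraph where
  V : Type
  F : ℕ → V → Option V

namespace PreGraph

/-- Partial inverse operator of color `i`. -/
def Finv (K : PreGraph) (i : ℕ) (v : K.V) : Option K.V :=
  if h : ∃ u, K.F i u = some v then some h.choose else none

/-- Number of edges of the maximal `i`-colored path beginning at `v`. -/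
def h (K : PreGraph) (i : ℕ) (v : K.V) : ℕ :=
  sSup {k | (optIter (K.F i) k v).isSome = true}

/-- Number of edges of the maximal `i`-colored path ending at `v`. -/
def t (K : PreGraph) (i : ℕ) (v : K.V) : ℕ :=
  sSup {k | ∃ u, optIter (K.F i) k u = some v}

/-- One (undirected) step along an edge of any color. -/
def Step (K : PreGraph) (u v : K.V) : Prop :=
  ∃ i, K.F i u = some v ∨ K.F i v = some u

/-- Weak connectivity. -/
def Connected (K : PreGraph) : Prop :=
  ∀ u v : K.V, Relation.ReflTransGen K.Step u v

/-- All edges have colors in `C`. -/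
def ColorsIn (K : PreGraph) (C : Set ℕ) : Prop :=
  ∀ i ∉ C, ∀ v, K.F i v = none

end PreGraph

/-- `s` has no incoming edges. -/
def IsSource (K : PreGraph) (s : K.V) : Prop := ∀ i u, K.F i u ≠ some s

/-- `tv` has no outgoing edges. -/
def IsSink (K : PreGraph) (tv : K.V) : Prop := ∀ i, K.F i tv = none

/-- `K` is a (finite) colored graph with colors in `C` satisfying axiom (A1):
every connected monochromatic subgraph is a finite directed path. -/
def IsColored (K : PreGraph) (C : Set ℕ) : Prop :=
  Finite K.V ∧ K.ColorsIn C ∧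
  (∀ (i : ℕ) (u u' v : K.V), K.F i u = some v → K.F i u' = some v → u = u') ∧
  (∀ (i : ℕ) (v : K.V) (k : ℕ), 0 < k → optIter (K.F i) k v ≠ some v)

/-- `|i - j| = 1`. -/
def Neighb (i j : ℕ) : Prop := i + 1 = j ∨ j + 1 = i

/-- `|i - j| ≥ 2`. -/
def Far (i j : ℕ) : Prop := i + 2 ≤ j ∨ j + 2 ≤ i

instance (i j : ℕ) : Decidable (Neighb i j) := by unfold Neighb; infer_instance
instance (i j : ℕ) : Decidable (Far i j) := by unfold Far; infer_instance

/-- Axiom (A2) for the ordered pair of distinct colors `(i, j)`. -/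
def A2at (K : PreGraph) (i j : ℕ) : Prop :=
  (∀ u v, K.F i u = some v →
    K.t j v ≤ K.t j u ∧ K.h j u ≤ K.h j v ∧
    ((K.h j u : ℤ) - (K.t j u : ℤ)) - ((K.h j v : ℤ) - (K.t j v : ℤ)) =
      (if Neighb i j then (-1 : ℤ) else 0)) ∧
  (∀ u v w, K.F i u = some v → K.F i v = some w →
    2 * K.h j v ≤ K.h j u + K.h j w)

/-- Axiom (A3) for neighboring colors `i, j`. -/
def A3at (K : PreGraph) (i j : ℕ) : Prop :=
  (∀ u v v', K.F i u = some v → K.F j u = some v' →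
    K.h j v = K.h j u →
    ((K.h i v' : ℤ) - (K.h i u : ℤ) = 1 ∧ ∃ w, K.F j v = some w ∧ K.F i v' = some w)) ∧
  (∀ u u' v, K.F i u = some v → K.F j u' = some v →
    (K.h j v : ℤ) - (K.h j u : ℤ) = 1 →
    (K.h i v = K.h i u' ∧ ∃ w, K.F j w = some u ∧ K.F i w = some u'))

/-- Axiom (A4) (Verma relations) for neighboring colors `i, j`. -/
def A4at (K : PreGraph) (i j : ℕ) : Prop :=
  (∀ u v v', K.F i u = some v → K.F j u = some v' →
    (K.h j v : ℤ) - (K.h j u : ℤ) = 1 → (K.h i v' : ℤ) - (K.h i u : ℤ) = 1 →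
    ∃ w, (((K.F i u).bind (K.F j)).bind (K.F j)).bind (K.F i) = some w ∧
         (((K.F j u).bind (K.F i)).bind (K.F i)).bind (K.F j) = some w) ∧
  (∀ u u' v, K.F i u = some v → K.F j u' = some v →
    K.h j v = K.h j u → K.h i v = K.h i u' →
    ∃ w, (((K.Finv i v).bind (K.Finv j)).bind (K.Finv j)).bind (K.Finv i) = some w ∧
         (((K.Finv j v).bind (K.Finv i)).bind (K.Finv i)).bind (K.Finv j) = some w)

/-- Axiom (A5) for colors `i, j` at distance at least 2. -/
def A5at (K : PreGraph) (i j : ℕ) : Prop :=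
  ∀ Fi ∈ ({K.F i, K.Finv i} : Set (K.V → Option K.V)),
  ∀ Fj ∈ ({K.F j, K.Finv j} : Set (K.V → Option K.V)),
  ∀ v, (Fi v).isSome → (Fj v).isSome →
    ∃ w, (Fi v).bind Fj = some w ∧ (Fj v).bind Fi = some w

/-- `K` is a regular crystal of type A on the color set `C`
(an `A_{|C|}`-crystal when `C` is an integer interval). -/
def IsCrystalOn (K : PreGraph) (C : Set ℕ) : Prop :=
  IsColored K C ∧ K.Connected ∧
  (∀ i ∈ C, ∀ j ∈ C, i ≠ j → A2at K i j) ∧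
  (∀ i ∈ C, ∀ j ∈ C, Neighb i j → A3at K i j ∧ A4at K i j) ∧
  (∀ i ∈ C, ∀ j ∈ C, Far i j → A5at K i j)

/-- `K` is an `A_n`-crystal (colors `1, …, n`). -/
def IsACrystal (n : ℕ) (K : PreGraph) : Prop := IsCrystalOn K (Set.Icc 1 n)

/-- Apply a list of operators, head first. -/
def applyStr (K : PreGraph) : List ℕ → K.V → Option K.V
  | [], v => some v
  | i :: L, v => (K.F i v).bind (applyStr K L)

/-- The string `w_{m,k,j} = F_{o+j} F_{o+j+1} ⋯ F_{o+j+k-1}` (rightmost applied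
first, i.e. head of the list applied first) for a crystal with colors `o+1, …, o+m`. -/
def wStr (o k j : ℕ) : List ℕ := (List.range k).map (fun m => o + j + k - 1 - m)

/-- The string `S_{m,k} = w_{m,k,m-k+1} ⋯ w_{m,k,2} w_{m,k,1}` for a crystal with
colors `o+1, …, o+m`. -/
def SStr (o m k : ℕ) : List ℕ :=
  (List.range (m - k + 1)).flatMap fun jm => wStr o k (jm + 1)

/-- The string `S_{m,m}^{a_{o+m}} ⋯ S_{m,1}^{a_{o+1}}` for a crystal with colors
`o+1, …, o+m`, defining the principal vertex with coordinates `a`. -/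
def prinStr (o m : ℕ) (a : ℕ → ℕ) : List ℕ :=
  (List.range m).flatMap fun km => (List.replicate (a (o + km + 1)) (SStr o m (km + 1))).flatten

def prinOpt (K : PreGraph) (o m : ℕ) (s : K.V) (a : ℕ → ℕ) : Option K.V :=
  applyStr K (prinStr o m a) s

/-- `p` is the principal vertex with coordinates `a` of the crystal `K` with colors
`o+1, …, o+m` and source `s`. -/
def IsPrin (K : PreGraph) (o m : ℕ) (s : K.V) (a : ℕ → ℕ) (p : K.V) : Prop :=
  prinOpt K o m s a = some p

/-- The principal lattice of an `A_n`-crystal with source `s` and parameter `c`. -/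
def PrinLat (K : PreGraph) (n : ℕ) (s : K.V) (c : ℕ → ℕ) : Set K.V :=
  {p | ∃ a : ℕ → ℕ, (∀ i, 1 ≤ i → i ≤ n → a i ≤ c i) ∧ IsPrin K 0 n s a p}

/-- One undirected step along an edge with color in `I`. -/
def stepOn (K : PreGraph) (I : Set ℕ) (u v : K.V) : Prop :=
  ∃ i ∈ I, K.F i u = some v ∨ K.F i v = some u

/-- `u` lies in the same `I`-colored component as `v`. -/
def inComp (K : PreGraph) (I : Set ℕ) (v u : K.V) : Prop :=
  Relation.ReflTransGen (stepOn K I) v u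

/-- The subcrystal of `K` with color set `I` containing `v` (the maximal connected
subgraph through `v` using only colors in `I`). -/
def PreGraph.sub (K : PreGraph) (I : Set ℕ) (v : K.V) : PreGraph where
  V := {u : K.V // inComp K I v u}
  F := fun i u =>
    if hi : i ∈ I then
      (K.F i u.1).pbind fun w hw =>
        some ⟨w, Relation.ReflTransGen.tail u.2 ⟨i, hi, Or.inl (Option.mem_def.mp hw)⟩⟩
    else none

/-- Directed reachability. -/
def dirReach (K : PreGraph) (u v : K.V) : Prop :=
  Relation.ReflTransGen (fun a b => ∃ i, K.F i a = some b) u v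

/-- The interval of `K` from `p` to `q`: the subgraph formed by all vertices and
edges lying on directed paths from `p` to `q`. -/
def PreGraph.interval (K : PreGraph) (p q : K.V) : PreGraph where
  V := {w : K.V // dirReach K p w ∧ dirReach K w q}
  F := fun i u =>
    (K.F i u.1).pbind fun w _ =>
      if hw : dirReach K p w ∧ dirReach K w q then some ⟨w, hw⟩ else none

/-- The symmetric extract: restriction to self-complementary vertices,
with `ibar`-edges given by `chain i`. -/
def extract (K : PreGraph) (chain : ℕ → K.V → Option K.V) (σ : K.V → K.V) : PreGraph where
  V := {v : K.V // σ v = v}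
  F := fun i u =>
    (chain i u.1).pbind fun w _ => if hw : σ w = w then some ⟨w, hw⟩ else none

/-- The operator chain for the color `ibar` of the symmetric extract of a
symmetric `A_{2n-1}`-crystal. -/
def chainB (K : PreGraph) (n : ℕ) (i : ℕ) (u : K.V) : Option K.V :=
  if 1 ≤ i ∧ i ≤ n then
    (if i = n then K.F n u else (K.F i u).bind (K.F (2 * n - i)))
  else none

/-- The operator chain for the color `ibar` of the symmetric extract of a
symmetric `A_{2n}`-crystal. -/
def chainC (K : PreGraph) (n : ℕ) (i : ℕ) (u : K.V) : Option K.V :=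
  if 1 ≤ i ∧ i ≤ n then
    (if i = n then (((K.F n u).bind (K.F (n + 1))).bind (K.F (n + 1))).bind (K.F n)
     else (K.F i u).bind (K.F (2 * n + 1 - i)))
  else none

/-- Symmetric extract from a symmetric `A_{2n-1}`-crystal. -/
def extractB (K : PreGraph) (n : ℕ) (σ : K.V → K.V) : PreGraph := extract K (chainB K n) σ

/-- Symmetric extract from a symmetric `A_{2n}`-crystal. -/
def extractC (K : PreGraph) (n : ℕ) (σ : K.V → K.V) : PreGraph := extract K (chainC K n) σ

/-- Admissibility of a six-tuple `(x', y, x''; y', x, y'')` in the worm model. -/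
def WormOK (g1 g2 : ℕ) : ℤ × ℤ × ℤ × ℤ × ℤ × ℤ → Prop
  | (x', y, x'', y', x, y'') =>
    (0 ≤ x' ∧ x' ≤ 2 * (g1 : ℤ)) ∧ (0 ≤ x'' ∧ x'' ≤ 2 * (g1 : ℤ)) ∧
    (0 ≤ x ∧ x ≤ 2 * (g1 : ℤ)) ∧
    (0 ≤ y' ∧ y' ≤ (g2 : ℤ)) ∧ (0 ≤ y'' ∧ y'' ≤ (g2 : ℤ)) ∧ (0 ≤ y ∧ y ≤ (g2 : ℤ)) ∧
    (2 ∣ x') ∧ (2 ∣ x'') ∧ (y' ≤ y ∧ y ≤ y'') ∧ (x' ≤ x ∧ x ≤ x'') ∧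
    (y' < y → x' = x) ∧ (y < y'' → x = x'')

/-- The candidate image of a worm under the operator `1tilde`. -/
def worm1 : ℤ × ℤ × ℤ × ℤ × ℤ × ℤ → ℤ × ℤ × ℤ × ℤ × ℤ × ℤ
  | (x', y, x'', y', x, y'') =>
    if 2 * x > x' + x'' then (x' + 2, y, x'', y', x, y'')
    else if x = x' ∧ x' = x'' ∧ y < y'' then (x', y + 1, x'', y', x, y'')
    else (x', y, x'' + 2, y', x, y'')

/-- The candidate image of a worm under the operator `2tilde`. -/
def worm2 : ℤ × ℤ × ℤ × ℤ × ℤ × ℤ → ℤ × ℤ × ℤ × ℤ × ℤ × ℤ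
  | (x', y, x'', y', x, y'') =>
    if 2 * y > y' + y'' then (x', y, x'', y' + 1, x, y'')
    else if y' = y ∧ y = y'' ∧ x < x'' then (x', y, x'', y', x + 1, y'')
    else (x', y, x'', y', x, y'' + 1)

/-- The worm graph `W(g1, g2)`, with colors `1 = 1tilde` and `2 = 2tilde`. -/
def WormGraph (g1 g2 : ℕ) : PreGraph where
  V := {w : ℤ × ℤ × ℤ × ℤ × ℤ × ℤ // WormOK g1 g2 w}
  F := fun i u =>
    if i = 1 then
      (if h1 : WormOK g1 g2 (worm1 u.1) then some ⟨worm1 u.1, h1⟩ else none)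
    else if i = 2 then
      (if h2 : WormOK g1 g2 (worm2 u.1) then some ⟨worm2 u.1, h2⟩ else none)
    else none

/-- Isomorphism of colored graphs, renaming colors via `φ`. -/
def IsoVia (K L : PreGraph) (φ : ℕ → ℕ) : Prop :=
  ∃ e : K.V ≃ L.V, ∀ i u v, K.F i u = some v ↔ L.F (φ i) (e u) = some (e v)

/-- The Cartesian product of an `i`-path of length `p` and a `j`-path of length `q`. -/
def boxGraph (i j p q : ℕ) : PreGraph where
  V := Fin (p + 1) × Fin (q + 1)
  F := fun s u =>
    if s = i then
      (if h : (u.1 : ℕ) < p then some (⟨(u.1 : ℕ) + 1, by omega⟩, u.2) else none)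
    else if s = j then
      (if h : (u.2 : ℕ) < q then some (u.1, ⟨(u.2 : ℕ) + 1, by omega⟩) else none)
    else none

/-- `B_n`-crystal: components with colors `n-1, n` are worm graphs,
with color `n-1` corresponding to `1tilde` and `n` to `2tilde`. -/
def IsBCrystal (n : ℕ) (B : PreGraph) : Prop :=
  IsColored B (Set.Icc 1 n) ∧ B.Connected ∧
  (∀ i ∈ Set.Icc 1 n, ∀ j ∈ Set.Icc 1 n, Far i j → A5at B i j) ∧
  (∀ i j, 1 ≤ i → i < n → 1 ≤ j → j < n → Neighb i j →
    ∀ v : B.V, IsCrystalOn (B.sub {i, j} v) {i, j}) ∧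
  (∀ v : B.V, ∃ g1 g2 : ℕ,
    IsoVia (B.sub ({n - 1, n} : Set ℕ) v) (WormGraph g1 g2)
      (fun x => if x = n - 1 then 1 else if x = n then 2 else 0))

/-- `C_n`-crystal: components with colors `n-1, n` are worm graphs,
with color `n-1` corresponding to `2tilde` and `n` to `1tilde`. -/
def IsCCrystal (n : ℕ) (B : PreGraph) : Prop :=
  IsColored B (Set.Icc 1 n) ∧ B.Connected ∧
  (∀ i ∈ Set.Icc 1 n, ∀ j ∈ Set.Icc 1 n, Far i j → A5at B i j) ∧
  (∀ i j, 1 ≤ i → i < n → 1 ≤ j → j < n → Neighb i j →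
    ∀ v : B.V, IsCrystalOn (B.sub {i, j} v) {i, j}) ∧
  (∀ v : B.V, ∃ g1 g2 : ℕ,
    IsoVia (B.sub ({n - 1, n} : Set ℕ) v) (WormGraph g1 g2)
      (fun x => if x = n - 1 then 2 else if x = n then 1 else 0))

/-! ### The crossing model -/

/-- `(k, i, j)` is a node `v_i^k(j)` of the supporting graph `G` for rank `n`. -/
def isNode (n k i j : ℕ) : Prop :=
  1 ≤ j ∧ j ≤ i ∧ i ≤ n ∧ i - j + 1 ≤ k ∧ k ≤ n - j + 1

instance (n k i j : ℕ) : Decidable (isNode n k i j) := by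
  unfold isNode; infer_instance

/-- Extension of a function on the nodes of `G` to the extended supporting graph:
extra nodes from which `G^k` is reachable get value `c k`, the others get `0`. -/
def fext (n : ℕ) (c : ℕ → ℕ) (f : ℕ × ℕ × ℕ → ℤ) (k i j : ℕ) : ℤ :=
  if isNode n k i j then f (k, i, j)
  else if j ≤ n - k + 1 then (c k : ℤ) else 0

/-- The slack at the node `v_i^k(j)`. -/
def epsN (n : ℕ) (c : ℕ → ℕ) (f : ℕ × ℕ × ℕ → ℤ) (k i j : ℕ) : ℤ :=
  (fext n c f k (i - 1) (j - 1) - fext n c f k i j) -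
    (fext n c f k i (j - 1) - fext n c f k (i + 1) j)

/-- The total slack at the multinode `V_i(j)`. -/
def epsTot (n : ℕ) (c : ℕ → ℕ) (f : ℕ × ℕ × ℕ → ℤ) (i j : ℕ) : ℤ :=
  ∑ k ∈ Finset.Icc (i - j + 1) (n - j + 1), epsN n c f k i j

/-- The reduced slack at the multinode `V_i(j)`. -/
def teps (n : ℕ) (c : ℕ → ℕ) (f : ℕ × ℕ × ℕ → ℤ) (i j : ℕ) : ℤ :=
  if hj : (Finset.Icc 1 j).Nonempty then
    max 0 ((Finset.Icc 1 j).inf' hj fun p => ∑ q ∈ Finset.Icc p j, epsTot n c f i q)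
  else 0

/-- `k0` satisfies the switch condition in the multinode `V_i(j)`. -/
def switchCond (n : ℕ) (f : ℕ × ℕ × ℕ → ℤ) (i j k0 : ℕ) : Prop :=
  i - j + 1 ≤ k0 ∧ k0 ≤ n - j + 1 ∧
  (∀ k, i - j + 1 ≤ k → k < k0 → isNode n k (i + 1) (j + 1) →
    f (k, i, j) = f (k, i + 1, j + 1)) ∧
  (∀ k, k0 < k → k ≤ n - j + 1 → isNode n k (i + 1) j →
    f (k, i + 1, j) = f (k, i, j))

/-- The switch-node (first node with the switch property) of the multinode `V_i(j)`. -/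
def switchNode (n : ℕ) (f : ℕ × ℕ × ℕ → ℤ) (i j : ℕ) : ℕ :=
  sInf {k0 | switchCond n f i j k0}

/-- Feasible functions of the crossing model (normalized to vanish off the nodes). -/
def Feasible (n : ℕ) (c : ℕ → ℕ) (f : ℕ × ℕ × ℕ → ℤ) : Prop :=
  (∀ k i j, ¬ isNode n k i j → f (k, i, j) = 0) ∧
  (∀ k i j, isNode n k i j → isNode n k (i - 1) j → f (k, i - 1, j) ≤ f (k, i, j)) ∧
  (∀ k i j, isNode n k i j → isNode n k (i + 1) (j + 1) → f (k, i + 1, j + 1) ≤ f (k, i, j)) ∧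
  (∀ k i j, isNode n k i j → 0 ≤ f (k, i, j) ∧ f (k, i, j) ≤ (c k : ℤ)) ∧
  (∀ i j, 1 ≤ j → j ≤ i → i ≤ n → ∃ k0, switchCond n f i j k0)

/-- Increase `f` by one at the node `(k, i, j)`. -/
def bump (f : ℕ × ℕ × ℕ → ℤ) (k i j : ℕ) : ℕ × ℕ × ℕ → ℤ :=
  fun x => if x = (k, i, j) then f x + 1 else f x

/-- The crossing-model graph `Kscr(c)`: vertices are the feasible functions, and
the move `φ_i` increases `f` by one at the switch-node of the active multinode. -/
def Kscr (n : ℕ) (c : ℕ → ℕ) : PreGraph where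
  V := {f : ℕ × ℕ × ℕ → ℤ // Feasible n c f}
  F := fun i f =>
    if 1 ≤ i ∧ i ≤ n ∧ ∃ j, 1 ≤ j ∧ j ≤ i ∧ 0 < teps n c f.1 i j then
      (let j := sSup {j | 1 ≤ j ∧ j ≤ i ∧ 0 < teps n c f.1 i j}
       let g := bump f.1 (switchNode n f.1 i j) i j
       if hg : Feasible n c g then some ⟨g, hg⟩ else none)
    else none

/-- The function `f_{a,D}` of the crossing model. -/
def faD (n : ℕ) (a : ℕ → ℕ) (D : ℕ → ℤ) : ℕ × ℕ × ℕ → ℤ := fun x =>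
  if isNode n x.1 x.2.1 x.2.2 then
    (if x.2.1 - x.2.2 + 1 = x.1 then (a x.1 : ℤ) else (a x.1 : ℤ) + min (D (x.1 - 1)) 0) +
    (if x.2.2 ≤ n - x.1 then max (D x.1) 0 else 0)
  else 0

/-! ### Descriptions of self-complementary vertices -/

/-- `(a1, a2, δ, l)` is the description of a self-complementary vertex `v` of a
symmetric `A_3`-crystal `K` with source `s` and parameter `c`. -/
def IsDescB (K : PreGraph) (s : K.V) (c : ℕ → ℕ) (v : K.V) (q : ℕ × ℕ × ℤ × ℕ) : Prop :=
  q.2.2.2 = K.t 2 v ∧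
  ∃ (a : ℕ → ℕ) (pa : K.V),
    a 1 = q.1 ∧ a 2 = q.2.1 ∧ a 3 = ((q.1 : ℤ) + max q.2.2.1 0).toNat ∧
    (∀ i, 1 ≤ i → i ≤ 3 → a i ≤ c i) ∧
    IsPrin K 0 3 s a pa ∧ inComp K (Set.Icc 1 2) pa v ∧
    0 ≤ (q.2.1 : ℤ) + q.2.2.1 ∧ 0 ≤ (a 3 : ℤ) - q.2.2.1 ∧
    ∃ s' : (K.sub (Set.Icc 1 2) pa).V, IsSource (K.sub (Set.Icc 1 2) pa) s' ∧
    ∃ z : (K.sub (Set.Icc 1 2) pa).V,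
      IsPrin (K.sub (Set.Icc 1 2) pa) 0 2 s'
        (fun i => if i = 1 then ((q.2.1 : ℤ) + q.2.2.1).toNat else ((a 3 : ℤ) - q.2.2.1).toNat) z ∧
      inComp K ({2} : Set ℕ) z.1 v

/-- The polytope of descriptions for a symmetric `A_3`-crystal with parameter `(c1, c2, c1)`. -/
def QuadB (c1 c2 : ℕ) : Set (ℕ × ℕ × ℤ × ℕ) :=
  {q | q.1 ≤ c1 ∧ q.2.1 ≤ c2 ∧ -(q.2.1 : ℤ) ≤ q.2.2.1 ∧ (q.2.1 : ℤ) - (c2 : ℤ) ≤ q.2.2.1 ∧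
       q.2.2.1 ≤ (c1 : ℤ) - (q.1 : ℤ) ∧ (q.2.2.2 : ℤ) ≤ (c2 : ℤ) + 2 * q.2.2.1}

/-- The worm associated to the description `(a1, a2, δ, l)`. -/
def wtupleB (a1 a2 : ℕ) (δ : ℤ) (l : ℕ) : ℤ × ℤ × ℤ × ℤ × ℤ × ℤ :=
  let a3 : ℤ := (a1 : ℤ) + max δ 0
  let tr : ℤ × ℤ × ℤ :=
    if 0 ≤ δ then
      if (l : ℤ) ≤ (a2 : ℤ) then ((l : ℤ), 2 * (a1 : ℤ), (a2 : ℤ))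
      else if (l : ℤ) ≤ (a2 : ℤ) + 2 * δ then
        ((a2 : ℤ), 2 * (a1 : ℤ) + (l : ℤ) - (a2 : ℤ), (a2 : ℤ))
      else ((a2 : ℤ), 2 * a3, (l : ℤ) - 2 * δ)
    else
      if (l : ℤ) ≤ (a2 : ℤ) + δ then ((l : ℤ), 2 * (a1 : ℤ), (a2 : ℤ) - δ)
      else ((a2 : ℤ) + δ, 2 * (a1 : ℤ), (l : ℤ) - 2 * δ)
  (2 * (a1 : ℤ), (a2 : ℤ), 2 * a3, tr.1, tr.2.1, tr.2.2)

def wtQ (q : ℕ × ℕ × ℤ × ℕ) : ℤ × ℤ × ℤ × ℤ × ℤ × ℤ :=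
  wtupleB q.1 q.2.1 q.2.2.1 q.2.2.2

/-- The string `(F_2 F_3)^r (F_3 F_2)^r` (rightmost applied first). -/
def diagStr (r : ℕ) : List ℕ :=
  (List.replicate r ([2, 3] : List ℕ)).flatten ++ (List.replicate r ([3, 2] : List ℕ)).flatten

/-- `(a1, a2, δ, ρ)` is the description of a self-complementary vertex `v` of a
symmetric `A_4`-crystal `K` with source `s` and parameter `c`. -/
def IsDescC (K : PreGraph) (s : K.V) (c : ℕ → ℕ) (v : K.V) (q : ℕ × ℕ × ℤ × ℕ) : Prop :=
  ∃ (a : ℕ → ℕ) (pa : K.V),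
    a 1 = q.1 ∧ a 2 = q.2.1 ∧ a 3 = ((q.2.1 : ℤ) + min q.2.2.1 0).toNat ∧
    a 4 = ((q.1 : ℤ) + max q.2.2.1 0).toNat ∧
    (∀ i, 1 ≤ i → i ≤ 4 → a i ≤ c i) ∧
    IsPrin K 0 4 s a pa ∧ inComp K (Set.Icc 1 3) pa v ∧
    0 ≤ (q.2.1 : ℤ) + q.2.2.1 ∧ 0 ≤ (a 4 : ℤ) - q.2.2.1 ∧
    (∃ s' : (K.sub (Set.Icc 1 3) pa).V, IsSource (K.sub (Set.Icc 1 3) pa) s' ∧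
     ∃ z : (K.sub (Set.Icc 1 3) pa).V,
       IsPrin (K.sub (Set.Icc 1 3) pa) 0 3 s'
         (fun i => if i = 1 then ((q.2.1 : ℤ) + q.2.2.1).toNat
                   else if i = 2 then a 3 else ((a 4 : ℤ) - q.2.2.1).toNat) z ∧
       inComp K (Set.Icc 2 3) z.1 v) ∧
    (∃ stil : (K.sub (Set.Icc 2 3) v).V, IsSource (K.sub (Set.Icc 2 3) v) stil ∧
       applyStr (K.sub (Set.Icc 2 3) v) (diagStr q.2.2.2) stil =
         some ⟨v, Relation.ReflTransGen.refl⟩)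

/-- The polytope of descriptions for a symmetric `A_4`-crystal with parameter
`(c1, c2, c2, c1)`. -/
def QuadC (c1 c2 : ℕ) : Set (ℕ × ℕ × ℤ × ℕ) :=
  {q | q.1 ≤ c1 ∧ q.2.1 ≤ c2 ∧ -(q.2.1 : ℤ) ≤ q.2.2.1 ∧
       q.2.2.1 ≤ (c1 : ℤ) - (q.1 : ℤ) ∧ (q.2.2.2 : ℤ) ≤ (c2 : ℤ) + q.2.2.1}

end


/-! ### Abstract crystals -/

/-- A colored graph equipped with raising operators `E` and string lengths `φ`, `ε`. -/
structure Crys extends PreGraph where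
  E : ℕ → V → Option V
  φ : ℕ → V → ℕ
  ε : ℕ → V → ℕ

namespace Crys

/-- The local axioms of a regular crystal of type A for the colors in `C`. -/
structure Ax (X : Crys) (C : Set ℕ) : Prop where
  FE : ∀ i ∈ C, ∀ u v, X.F i u = some v ↔ X.E i v = some u
  F_def : ∀ i ∈ C, ∀ u, 0 < X.φ i u → ∃ v, X.F i u = some v
  E_def : ∀ i ∈ C, ∀ u, 0 < X.ε i u → ∃ v, X.E i u = some v
  φF : ∀ i ∈ C, ∀ u v, X.F i u = some v → X.φ i u = X.φ i v + 1
  εF : ∀ i ∈ C, ∀ u v, X.F i u = some v → X.ε i v = X.ε i u + 1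
  near : ∀ i ∈ C, ∀ j ∈ C, Neighb i j → ∀ u v, X.F i u = some v →
    (X.φ j v = X.φ j u ∧ X.ε j u = X.ε j v + 1) ∨ (X.φ j v = X.φ j u + 1 ∧ X.ε j v = X.ε j u)
  far : ∀ i ∈ C, ∀ j ∈ C, Far i j → ∀ u v, X.F i u = some v →
    X.φ j v = X.φ j u ∧ X.ε j v = X.ε j u
  A3F : ∀ i ∈ C, ∀ j ∈ C, Neighb i j → ∀ u v v', X.F i u = some v → X.F j u = some v' →
    X.φ j v = X.φ j u → X.φ i v' = X.φ i u + 1 ∧ ∃ w, X.F j v = some w ∧ X.F i v' = some w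
  A3E : ∀ i ∈ C, ∀ j ∈ C, Neighb i j → ∀ u v v', X.E i u = some v → X.E j u = some v' →
    X.ε j v = X.ε j u → X.ε i v' = X.ε i u + 1 ∧ ∃ w, X.E j v = some w ∧ X.E i v' = some w
  A4F : ∀ i ∈ C, ∀ j ∈ C, Neighb i j → ∀ u v v', X.F i u = some v → X.F j u = some v' →
    X.φ j v = X.φ j u + 1 → X.φ i v' = X.φ i u + 1 →
    ∃ p q p' q' w, X.F j v = some p ∧ X.F j p = some q ∧ X.F i q = some w ∧
      X.F i v' = some p' ∧ X.F i p' = some q' ∧ X.F j q' = some w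
  A4E : ∀ i ∈ C, ∀ j ∈ C, Neighb i j → ∀ u v v', X.E i u = some v → X.E j u = some v' →
    X.ε j v = X.ε j u + 1 → X.ε i v' = X.ε i u + 1 →
    ∃ p q p' q' w, X.E j v = some p ∧ X.E j p = some q ∧ X.E i q = some w ∧
      X.E i v' = some p' ∧ X.E i p' = some q' ∧ X.E j q' = some w
  A5F : ∀ i ∈ C, ∀ j ∈ C, Far i j → ∀ u v v', X.F i u = some v → X.F j u = some v' →
    ∃ w, X.F j v = some w ∧ X.F i v' = some w
  A5E : ∀ i ∈ C, ∀ j ∈ C, Far i j → ∀ u v v', X.E i u = some v → X.E j u = some v' →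
    ∃ w, X.E j v = some w ∧ X.E i v' = some w

/-- The crystal with all arrows reversed. -/
def dual (X : Crys) : Crys where
  V := X.V
  F := X.E
  E := X.F
  φ := X.ε
  ε := X.φ

theorem Ax.dual {X : Crys} {C : Set ℕ} (h : X.Ax C) : X.dual.Ax C where
  FE i hi u v := (h.FE i hi v u).symm
  F_def := h.E_def
  E_def := h.F_def
  φF i hi u v e := h.εF i hi v u ((h.FE i hi v u).2 e)
  εF i hi u v e := h.φF i hi v u ((h.FE i hi v u).2 e)
  near i hi j hj hn u v e := by
    have := h.near i hi j hj hn v u ((h.FE i hi v u).2 e)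
    simp only [Crys.dual]
    omega
  far i hi j hj hn u v e := by
    have := h.far i hi j hj hn v u ((h.FE i hi v u).2 e)
    simp only [Crys.dual]
    omega
  A3F := h.A3E
  A3E := h.A3F
  A4F := h.A4E
  A4E := h.A4F
  A5F := h.A5E
  A5E := h.A5F

theorem Ax.mono {X : Crys} {C D : Set ℕ} (h : X.Ax C) (hD : D ⊆ C) : X.Ax D where
  FE i hi := h.FE i (hD hi)
  F_def i hi := h.F_def i (hD hi)
  E_def i hi := h.E_def i (hD hi)
  φF i hi := h.φF i (hD hi)
  εF i hi := h.εF i (hD hi)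
  near i hi j hj := h.near i (hD hi) j (hD hj)
  far i hi j hj := h.far i (hD hi) j (hD hj)
  A3F i hi j hj := h.A3F i (hD hi) j (hD hj)
  A3E i hi j hj := h.A3E i (hD hi) j (hD hj)
  A4F i hi j hj := h.A4F i (hD hi) j (hD hj)
  A4E i hi j hj := h.A4E i (hD hi) j (hD hj)
  A5F i hi j hj := h.A5F i (hD hi) j (hD hj)
  A5E i hi j hj := h.A5E i (hD hi) j (hD hj)

theorem Ax.F_inj {X : Crys} {C : Set ℕ} (h : X.Ax C) {i : ℕ} (hi : i ∈ C) {u u' v : X.V}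
    (e : X.F i u = some v) (e' : X.F i u' = some v) : u = u' := by
  rw [h.FE i hi] at e e'
  simpa using e.symm.trans e'

theorem Neighb.symm' {i j : ℕ} (h : Neighb i j) : Neighb j i := Or.symm h

theorem Far.symm' {i j : ℕ} (h : Far i j) : Far j i := Or.symm h

/-- After an `i`-edge with `j`-label `1`, the next `j`-edge has `i`-label `0`. -/
theorem Ax.label_zero {X : Crys} {C : Set ℕ} (h : X.Ax C) {i j : ℕ} (hi : i ∈ C) (hj : j ∈ C)
    (hn : Neighb i j) {u v w : X.V} (e : X.F i u = some v) (e' : X.F j v = some w)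
    (hl : X.φ j v = X.φ j u + 1) : X.φ i w = X.φ i v ∧ X.ε i v = X.ε i w + 1 := by
  rcases h.near j hj i hi (Neighb.symm' hn) v w e' with h1 | ⟨h1, h2⟩
  · exact h1
  exfalso
  have hv := h.εF i hi _ _ e
  obtain ⟨r, hr⟩ := h.E_def i hi w (by omega)
  obtain ⟨h3, x, hx, hx'⟩ :=
    h.A3E j hj i hi (Neighb.symm' hn) w v r ((h.FE j hj _ _).1 e') hr h2.symm
  have hxu : x = u := by
    have := (h.FE i hi _ _).1 e
    rw [this] at hx
    simpa using hx.symm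
  subst hxu
  have e1 := h.φF j hj _ _ ((h.FE j hj _ _).2 hx')
  have e2 := h.φF j hj _ _ e'
  have e3 := h.near i hi j hj hn _ _ e
  have e4 := h.near i hi j hj hn _ _ ((h.FE i hi _ _).2 hr)
  have e5 := h.εF j hj _ _ ((h.FE j hj _ _).2 hx')
  have e6 := h.εF j hj _ _ e'
  omega

/-- Tensor product of crystals. -/
def tensor (X Y : Crys) : Crys where
  V := X.V × Y.V
  F i u := if Y.ε i u.2 < X.φ i u.1 then (X.F i u.1).map fun x => (x, u.2)
    else (Y.F i u.2).map fun y => (u.1, y)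
  E i u := if X.φ i u.1 < Y.ε i u.2 then (Y.E i u.2).map fun y => (u.1, y)
    else (X.E i u.1).map fun x => (x, u.2)
  φ i u := Y.φ i u.2 + (X.φ i u.1 - Y.ε i u.2)
  ε i u := X.ε i u.1 + (Y.ε i u.2 - X.φ i u.1)

theorem tensor_F_iff {X Y : Crys} {i : ℕ} {u v : (tensor X Y).V} :
    (tensor X Y).F i u = some v ↔
      (Y.ε i u.2 < X.φ i u.1 ∧ X.F i u.1 = some v.1 ∧ v.2 = u.2) ∨
      (X.φ i u.1 ≤ Y.ε i u.2 ∧ Y.F i u.2 = some v.2 ∧ v.1 = u.1) := by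
  obtain ⟨x, y⟩ := u
  obtain ⟨x', y'⟩ := v
  simp only [tensor]
  split_ifs with hc
  · simp [hc, eq_comm, and_comm, hc.not_ge]
  · simp [hc, eq_comm, and_comm, not_lt.1 hc]

theorem tensor_E_iff {X Y : Crys} {i : ℕ} {u v : (tensor X Y).V} :
    (tensor X Y).E i u = some v ↔
      (X.φ i u.1 < Y.ε i u.2 ∧ Y.E i u.2 = some v.2 ∧ v.1 = u.1) ∨
      (Y.ε i u.2 ≤ X.φ i u.1 ∧ X.E i u.1 = some v.1 ∧ v.2 = u.2) := by
  obtain ⟨x, y⟩ := u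
  obtain ⟨x', y'⟩ := v
  simp only [tensor]
  split_ifs with hc
  · simp [hc, eq_comm, and_comm, hc.not_ge]
  · simp [hc, eq_comm, and_comm, not_lt.1 hc]

end Crys

namespace Crys

variable {X Y : Crys} {C : Set ℕ}

theorem tensor_A3F (hX : X.Ax C) (hY : Y.Ax C) {i j : ℕ} (hi : i ∈ C) (hj : j ∈ C)
    (hn : Neighb i j) (u v v' : (tensor X Y).V) (e : (tensor X Y).F i u = some v)
    (e' : (tensor X Y).F j u = some v') (hl : (tensor X Y).φ j v = (tensor X Y).φ j u) :
    (tensor X Y).φ i v' = (tensor X Y).φ i u + 1 ∧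
      ∃ w, (tensor X Y).F j v = some w ∧ (tensor X Y).F i v' = some w := by
  obtain ⟨x, y⟩ := u
  obtain ⟨x1, y1⟩ := v
  obtain ⟨x2, y2⟩ := v'
  have hm := Neighb.symm' hn
  replace e := tensor_F_iff.1 e
  replace e' := tensor_F_iff.1 e'
  dsimp only at e e'
  simp only [tensor] at hl
  rcases e with ⟨c1, f1, rfl⟩ | ⟨c1, f1, rfl⟩ <;> rcases e' with ⟨c2, f2, rfl⟩ | ⟨c2, f2, rfl⟩
  · have n1 := hX.near i hi j hj hn _ _ f1
    obtain ⟨h1, w, hw, hw'⟩ := hX.A3F i hi j hj hn _ _ _ f1 f2 (by omega)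
    refine ⟨by simp only [tensor]; omega, (w, y2), ?_, ?_⟩
    · exact tensor_F_iff.2 (Or.inl ⟨by dsimp only; omega, hw, rfl⟩)
    · exact tensor_F_iff.2 (Or.inl ⟨by dsimp only; omega, hw', rfl⟩)
  · have n1 := hX.near i hi j hj hn _ _ f1
    have n2 := hY.near j hj i hi hm _ _ f2
    refine ⟨by simp only [tensor]; omega, (x1, y2), ?_, ?_⟩
    · exact tensor_F_iff.2 (Or.inr ⟨by dsimp only; omega, f2, rfl⟩)
    · exact tensor_F_iff.2 (Or.inl ⟨by dsimp only; omega, f1, rfl⟩)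
  · have n1 := hY.near i hi j hj hn _ _ f1
    omega
  · have n1 := hY.near i hi j hj hn _ _ f1
    obtain ⟨h1, w, hw, hw'⟩ := hY.A3F i hi j hj hn _ _ _ f1 f2 (by omega)
    have n2 := hY.near j hj i hi hm _ _ f2
    refine ⟨by simp only [tensor]; omega, (x2, w), ?_, ?_⟩
    · exact tensor_F_iff.2 (Or.inr ⟨by dsimp only; omega, hw, rfl⟩)
    · exact tensor_F_iff.2 (Or.inr ⟨by dsimp only; omega, hw', rfl⟩)

theorem tensor_A5F (hX : X.Ax C) (hY : Y.Ax C) {i j : ℕ} (hi : i ∈ C) (hj : j ∈ C)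
    (hn : Far i j) (u v v' : (tensor X Y).V) (e : (tensor X Y).F i u = some v)
    (e' : (tensor X Y).F j u = some v') :
    ∃ w, (tensor X Y).F j v = some w ∧ (tensor X Y).F i v' = some w := by
  obtain ⟨x, y⟩ := u
  obtain ⟨x1, y1⟩ := v
  obtain ⟨x2, y2⟩ := v'
  have hm := Far.symm' hn
  replace e := tensor_F_iff.1 e
  replace e' := tensor_F_iff.1 e'
  dsimp only at e e'
  rcases e with ⟨c1, f1, rfl⟩ | ⟨c1, f1, rfl⟩ <;> rcases e' with ⟨c2, f2, rfl⟩ | ⟨c2, f2, rfl⟩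
  · have n1 := hX.far i hi j hj hn _ _ f1
    have n2 := hX.far j hj i hi hm _ _ f2
    obtain ⟨w, hw, hw'⟩ := hX.A5F i hi j hj hn _ _ _ f1 f2
    exact ⟨(w, y2), tensor_F_iff.2 (Or.inl ⟨by dsimp only; omega, hw, rfl⟩),
      tensor_F_iff.2 (Or.inl ⟨by dsimp only; omega, hw', rfl⟩)⟩
  · have n1 := hX.far i hi j hj hn _ _ f1
    have n2 := hY.far j hj i hi hm _ _ f2
    exact ⟨(x1, y2), tensor_F_iff.2 (Or.inr ⟨by dsimp only; omega, f2, rfl⟩),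
      tensor_F_iff.2 (Or.inl ⟨by dsimp only; omega, f1, rfl⟩)⟩
  · have n1 := hY.far i hi j hj hn _ _ f1
    have n2 := hX.far j hj i hi hm _ _ f2
    exact ⟨(x2, y1), tensor_F_iff.2 (Or.inl ⟨by dsimp only; omega, f2, rfl⟩),
      tensor_F_iff.2 (Or.inr ⟨by dsimp only; omega, f1, rfl⟩)⟩
  · have n1 := hY.far i hi j hj hn _ _ f1
    have n2 := hY.far j hj i hi hm _ _ f2
    obtain ⟨w, hw, hw'⟩ := hY.A5F i hi j hj hn _ _ _ f1 f2
    exact ⟨(x2, w), tensor_F_iff.2 (Or.inr ⟨by dsimp only; omega, hw, rfl⟩),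
      tensor_F_iff.2 (Or.inr ⟨by dsimp only; omega, hw', rfl⟩)⟩

/-- The Verma relation when the `i`-arrow acts on the left factor and the `j`-arrow on the right. -/
theorem tensor_verma_mixed (hX : X.Ax C) (hY : Y.Ax C) {i j : ℕ} (hi : i ∈ C) (hj : j ∈ C)
    (hn : Neighb i j) {x x1 : X.V} {y y2 : Y.V} (c1 : Y.ε i y < X.φ i x) (f1 : X.F i x = some x1)
    (c2 : X.φ j x ≤ Y.ε j y) (f2 : Y.F j y = some y2)
    (hl : (tensor X Y).φ j (x1, y) = (tensor X Y).φ j (x, y) + 1) :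
    ∃ p q p' q' w, (tensor X Y).F j (x1, y) = some p ∧ (tensor X Y).F j p = some q ∧
      (tensor X Y).F i q = some w ∧ (tensor X Y).F i (x, y2) = some p' ∧
      (tensor X Y).F i p' = some q' ∧ (tensor X Y).F j q' = some w := by
  have hm := Neighb.symm' hn
  simp only [tensor] at hl
  have n1 := hX.near i hi j hj hn _ _ f1
  have n2 := hY.near j hj i hi hm _ _ f2
  have k1 := hX.φF i hi _ _ f1
  have k2 := hY.εF j hj _ _ f2
  obtain ⟨x3, g3⟩ := hX.F_def j hj x1 (by omega)
  have l3 := hX.label_zero hi hj hn f1 g3 (by omega)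
  have k3 := hX.φF j hj _ _ g3
  by_cases hc : Y.ε i y2 + 1 < X.φ i x
  · obtain ⟨x4, g4⟩ := hX.F_def i hi x1 (by omega)
    obtain ⟨l4, w, hw, hw'⟩ := hX.A3F j hj i hi hm _ _ _ g3 g4 l3.1
    refine ⟨(x3, y), (x3, y2), (x1, y2), (x4, y2), (w, y2),
      tensor_F_iff.2 (Or.inl ⟨?_, g3, rfl⟩), tensor_F_iff.2 (Or.inr ⟨?_, f2, rfl⟩),
      tensor_F_iff.2 (Or.inl ⟨?_, hw, rfl⟩), tensor_F_iff.2 (Or.inl ⟨?_, f1, rfl⟩),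
      tensor_F_iff.2 (Or.inl ⟨?_, g4, rfl⟩), tensor_F_iff.2 (Or.inl ⟨?_, hw', rfl⟩)⟩ <;>
    (dsimp only; omega)
  · obtain ⟨y5, g5⟩ : ∃ y5, Y.F i y2 = some y5 := by
      refine hY.F_def i hi _ ?_
      have := n2
      have hy : 0 < Y.φ i y2 := by omega
      exact hy
    have l5 := hY.label_zero hj hi hm f2 g5 (by omega)
    refine ⟨(x3, y), (x3, y2), (x1, y2), (x1, y5), (x3, y5),
      tensor_F_iff.2 (Or.inl ⟨?_, g3, rfl⟩), tensor_F_iff.2 (Or.inr ⟨?_, f2, rfl⟩),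
      tensor_F_iff.2 (Or.inr ⟨?_, g5, rfl⟩), tensor_F_iff.2 (Or.inl ⟨?_, f1, rfl⟩),
      tensor_F_iff.2 (Or.inr ⟨?_, g5, rfl⟩), tensor_F_iff.2 (Or.inl ⟨?_, g3, rfl⟩)⟩ <;>
    (dsimp only; omega)

/-- The Verma relation when both arrows act on the right factor with labels `1` and `0`. -/
theorem tensor_verma_right (hX : X.Ax C) (hY : Y.Ax C) {i j : ℕ} (hi : i ∈ C) (hj : j ∈ C)
    (hn : Neighb i j) {x : X.V} {y y1 y2 : Y.V} (c1 : X.φ i x ≤ Y.ε i y) (f1 : Y.F i y = some y1)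
    (c2 : X.φ j x ≤ Y.ε j y) (f2 : Y.F j y = some y2)
    (hl : Y.φ i y2 = Y.φ i y) (hl' : (tensor X Y).φ i (x, y2) = (tensor X Y).φ i (x, y) + 1) :
    ∃ p q p' q' w, (tensor X Y).F j (x, y1) = some p ∧ (tensor X Y).F j p = some q ∧
      (tensor X Y).F i q = some w ∧ (tensor X Y).F i (x, y2) = some p' ∧
      (tensor X Y).F i p' = some q' ∧ (tensor X Y).F j q' = some w := by
  have hm := Neighb.symm' hn
  simp only [tensor] at hl'
  have n1 := hY.near i hi j hj hn _ _ f1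
  have n2 := hY.near j hj i hi hm _ _ f2
  have k1 := hY.φF i hi _ _ f1
  have k1' := hY.εF i hi _ _ f1
  have k2 := hY.φF j hj _ _ f2
  have k2' := hY.εF j hj _ _ f2
  obtain ⟨m1, y3, g3, g3'⟩ := hY.A3F j hj i hi hm _ _ _ f2 f1 hl
  have k3 := hY.φF j hj _ _ g3'
  have k3' := hY.εF j hj _ _ g3'
  have n3 := hY.near j hj i hi hm _ _ g3'
  have k4 := hY.φF i hi _ _ g3
  have k4' := hY.εF i hi _ _ g3
  have n4 := hY.near i hi j hj hn _ _ g3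
  obtain ⟨y4, g4⟩ := hY.F_def j hj y3 (by omega)
  have l4 := hY.label_zero hi hj hn g3 g4 (by omega)
  have k5 := hY.εF j hj _ _ g4
  obtain ⟨x1, e1⟩ := hX.F_def i hi x (by omega)
  have n5 := hX.near i hi j hj hn _ _ e1
  have k6 := hX.φF i hi _ _ e1
  refine ⟨(x, y3), (x, y4), (x1, y2), (x1, y3), (x1, y4),
    tensor_F_iff.2 (Or.inr ⟨?_, g3', rfl⟩), tensor_F_iff.2 (Or.inr ⟨?_, g4, rfl⟩),
    tensor_F_iff.2 (Or.inl ⟨?_, e1, rfl⟩), tensor_F_iff.2 (Or.inl ⟨?_, e1, rfl⟩),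
    tensor_F_iff.2 (Or.inr ⟨?_, g3, rfl⟩), tensor_F_iff.2 (Or.inr ⟨?_, g4, rfl⟩)⟩ <;>
  (dsimp only; omega)

theorem tensor_A4F (hX : X.Ax C) (hY : Y.Ax C) {i j : ℕ} (hi : i ∈ C) (hj : j ∈ C)
    (hn : Neighb i j) (u v v' : (tensor X Y).V) (e : (tensor X Y).F i u = some v)
    (e' : (tensor X Y).F j u = some v') (hl : (tensor X Y).φ j v = (tensor X Y).φ j u + 1)
    (hl' : (tensor X Y).φ i v' = (tensor X Y).φ i u + 1) :
    ∃ p q p' q' w, (tensor X Y).F j v = some p ∧ (tensor X Y).F j p = some q ∧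
      (tensor X Y).F i q = some w ∧ (tensor X Y).F i v' = some p' ∧
      (tensor X Y).F i p' = some q' ∧ (tensor X Y).F j q' = some w := by
  obtain ⟨x, y⟩ := u
  obtain ⟨x1, y1⟩ := v
  obtain ⟨x2, y2⟩ := v'
  have hm := Neighb.symm' hn
  replace e := tensor_F_iff.1 e
  replace e' := tensor_F_iff.1 e'
  dsimp only at e e'
  rcases e with ⟨c1, f1, rfl⟩ | ⟨c1, f1, rfl⟩ <;> rcases e' with ⟨c2, f2, rfl⟩ | ⟨c2, f2, rfl⟩
  · simp only [tensor] at hl hl'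
    have n1 := hX.near i hi j hj hn _ _ f1
    have n2 := hX.near j hj i hi hm _ _ f2
    obtain ⟨p, q, p', q', w, h1, h2, h3, h4, h5, h6⟩ :=
      hX.A4F i hi j hj hn _ _ _ f1 f2 (by omega) (by omega)
    have k1 := hX.φF j hj _ _ h1
    have k2 := hX.φF i hi _ _ h3
    have k3 := hX.φF i hi _ _ h4
    have k4 := hX.φF i hi _ _ h5
    have k5 := hX.near j hj i hi hm _ _ h6
    have k1' := hX.φF j hj _ _ h2
    have k2' := hX.φF j hj _ _ h6
    have k5' := hX.near i hi j hj hn _ _ h3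
    refine ⟨(p, y2), (q, y2), (p', y2), (q', y2), (w, y2),
      tensor_F_iff.2 (Or.inl ⟨?_, h1, rfl⟩), tensor_F_iff.2 (Or.inl ⟨?_, h2, rfl⟩),
      tensor_F_iff.2 (Or.inl ⟨?_, h3, rfl⟩), tensor_F_iff.2 (Or.inl ⟨?_, h4, rfl⟩),
      tensor_F_iff.2 (Or.inl ⟨?_, h5, rfl⟩), tensor_F_iff.2 (Or.inl ⟨?_, h6, rfl⟩)⟩ <;>
    (dsimp only; omega)
  · exact tensor_verma_mixed hX hY hi hj hn c1 f1 c2 f2 hl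
  · obtain ⟨p, q, p', q', w, h1, h2, h3, h4, h5, h6⟩ :=
      tensor_verma_mixed hX hY hj hi hm c2 f2 c1 f1 hl'
    exact ⟨p', q', p, q, w, h4, h5, h6, h1, h2, h3⟩
  · have n1 := hY.near i hi j hj hn _ _ f1
    have n2 := hY.near j hj i hi hm _ _ f2
    by_cases s1 : Y.φ j y1 = Y.φ j y
    · obtain ⟨p, q, p', q', w, h1, h2, h3, h4, h5, h6⟩ :=
        tensor_verma_right hX hY hj hi hm c2 f2 c1 f1 s1 hl
      exact ⟨p', q', p, q, w, h4, h5, h6, h1, h2, h3⟩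
    by_cases s2 : Y.φ i y2 = Y.φ i y
    · exact tensor_verma_right hX hY hi hj hn c1 f1 c2 f2 s2 hl'
    obtain ⟨p, q, p', q', w, h1, h2, h3, h4, h5, h6⟩ :=
      hY.A4F i hi j hj hn _ _ _ f1 f2 (by omega) (by omega)
    have k1 := hY.εF j hj _ _ h1
    have k2 := hY.εF i hi _ _ h3
    have k3 := hY.εF i hi _ _ h4
    have k4 := hY.εF i hi _ _ h5
    have k5 := hY.near j hj i hi hm _ _ h6
    have k1' := hY.εF j hj _ _ h2
    have k2' := hY.εF j hj _ _ h6
    have k5' := hY.near i hi j hj hn _ _ h3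
    refine ⟨(x2, p), (x2, q), (x2, p'), (x2, q'), (x2, w),
      tensor_F_iff.2 (Or.inr ⟨?_, h1, rfl⟩), tensor_F_iff.2 (Or.inr ⟨?_, h2, rfl⟩),
      tensor_F_iff.2 (Or.inr ⟨?_, h3, rfl⟩), tensor_F_iff.2 (Or.inr ⟨?_, h4, rfl⟩),
      tensor_F_iff.2 (Or.inr ⟨?_, h5, rfl⟩), tensor_F_iff.2 (Or.inr ⟨?_, h6, rfl⟩)⟩ <;>
    (dsimp only; omega)

theorem tensor_dual_F {i : ℕ} {u v : (tensor X Y).V} :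
    (tensor Y.dual X.dual).F i u.swap = some v.swap ↔ (tensor X Y).E i u = some v :=
  tensor_F_iff.trans tensor_E_iff.symm

theorem Ax.tensor (hX : X.Ax C) (hY : Y.Ax C) : (tensor X Y).Ax C where
  FE i hi u v := by
    obtain ⟨x, y⟩ := u
    obtain ⟨x', y'⟩ := v
    refine tensor_F_iff.trans (Iff.trans ?_ tensor_E_iff.symm)
    dsimp only
    constructor
    · rintro (⟨h1, h2, rfl⟩ | ⟨h1, h2, rfl⟩)
      · have := hX.φF i hi _ _ h2
        exact Or.inr ⟨by omega, (hX.FE i hi _ _).1 h2, rfl⟩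
      · have := hY.εF i hi _ _ h2
        exact Or.inl ⟨by omega, (hY.FE i hi _ _).1 h2, rfl⟩
    · rintro (⟨h1, h2, rfl⟩ | ⟨h1, h2, rfl⟩)
      · rw [← hY.FE i hi] at h2
        have := hY.εF i hi _ _ h2
        exact Or.inr ⟨by omega, h2, rfl⟩
      · rw [← hX.FE i hi] at h2
        have := hX.φF i hi _ _ h2
        exact Or.inl ⟨by omega, h2, rfl⟩
  F_def i hi u hu := by
    simp only [Crys.tensor] at hu
    by_cases hc : Y.ε i u.2 < X.φ i u.1
    · obtain ⟨x, hx⟩ := hX.F_def i hi u.1 (by omega)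
      exact ⟨(x, u.2), tensor_F_iff.2 (Or.inl ⟨hc, hx, rfl⟩)⟩
    · obtain ⟨x, hx⟩ := hY.F_def i hi u.2 (by omega)
      exact ⟨(u.1, x), tensor_F_iff.2 (Or.inr ⟨by omega, hx, rfl⟩)⟩
  E_def i hi u hu := by
    simp only [Crys.tensor] at hu
    by_cases hc : X.φ i u.1 < Y.ε i u.2
    · obtain ⟨x, hx⟩ := hY.E_def i hi u.2 (by omega)
      exact ⟨(u.1, x), tensor_E_iff.2 (Or.inl ⟨hc, hx, rfl⟩)⟩
    · obtain ⟨x, hx⟩ := hX.E_def i hi u.1 (by omega)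
      exact ⟨(x, u.2), tensor_E_iff.2 (Or.inr ⟨by omega, hx, rfl⟩)⟩
  φF i hi u v e := by
    simp only [Crys.tensor]
    rcases tensor_F_iff.1 e with ⟨h1, h2, h3⟩ | ⟨h1, h2, h3⟩ <;> rw [h3]
    · have := hX.φF i hi _ _ h2
      omega
    · have := hY.φF i hi _ _ h2
      have := hY.εF i hi _ _ h2
      omega
  εF i hi u v e := by
    simp only [Crys.tensor]
    rcases tensor_F_iff.1 e with ⟨h1, h2, h3⟩ | ⟨h1, h2, h3⟩ <;> rw [h3]
    · have := hX.φF i hi _ _ h2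
      have := hX.εF i hi _ _ h2
      omega
    · have := hY.εF i hi _ _ h2
      omega
  near i hi j hj hn u v e := by
    simp only [Crys.tensor]
    rcases tensor_F_iff.1 e with ⟨h1, h2, h3⟩ | ⟨h1, h2, h3⟩ <;> rw [h3]
    · have := hX.near i hi j hj hn _ _ h2
      omega
    · have := hY.near i hi j hj hn _ _ h2
      omega
  far i hi j hj hn u v e := by
    simp only [Crys.tensor]
    rcases tensor_F_iff.1 e with ⟨h1, h2, h3⟩ | ⟨h1, h2, h3⟩ <;> rw [h3]
    · have := hX.far i hi j hj hn _ _ h2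
      omega
    · have := hY.far i hi j hj hn _ _ h2
      omega
  A3F i hi j hj hn := tensor_A3F hX hY hi hj hn
  A4F i hi j hj hn := tensor_A4F hX hY hi hj hn
  A5F i hi j hj hn := tensor_A5F hX hY hi hj hn
  A3E i hi j hj hn u v v' e e' hl := by
    obtain ⟨h1, w, hw, hw'⟩ := tensor_A3F hY.dual hX.dual hi hj hn u.swap v.swap v'.swap
      (tensor_dual_F.2 e) (tensor_dual_F.2 e') hl
    exact ⟨h1, w.swap, tensor_dual_F.1 hw, tensor_dual_F.1 hw'⟩
  A4E i hi j hj hn u v v' e e' hl hl' := by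
    obtain ⟨p, q, p', q', w, h1, h2, h3, h4, h5, h6⟩ :=
      tensor_A4F hY.dual hX.dual hi hj hn u.swap v.swap v'.swap
        (tensor_dual_F.2 e) (tensor_dual_F.2 e') hl hl'
    exact ⟨p.swap, q.swap, p'.swap, q'.swap, w.swap, tensor_dual_F.1 h1, tensor_dual_F.1 h2,
      tensor_dual_F.1 h3, tensor_dual_F.1 h4, tensor_dual_F.1 h5, tensor_dual_F.1 h6⟩
  A5E i hi j hj hn u v v' e e' := by
    obtain ⟨w, hw, hw'⟩ := tensor_A5F hY.dual hX.dual hi hj hn u.swap v.swap v'.swap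
      (tensor_dual_F.2 e) (tensor_dual_F.2 e')
    exact ⟨w.swap, tensor_dual_F.1 hw, tensor_dual_F.1 hw'⟩

end Crys

/-! ### Tableaux -/

/-- A row filled with `n₁` ones, …, `n₅` fives. -/
@[ext]
structure Row where
  n₁ : ℕ
  n₂ : ℕ
  n₃ : ℕ
  n₄ : ℕ
  n₅ : ℕ

namespace Row

/-- The number of letters `i` in a row. -/
def cnt (r : Row) : ℕ → ℕ
  | 1 => r.n₁
  | 2 => r.n₂
  | 3 => r.n₃
  | 4 => r.n₄
  | 5 => r.n₅
  | _ => 0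

/-- Replace a letter `i` by `i + 1`. -/
def low (r : Row) : ℕ → Option Row
  | 1 => if 0 < r.n₁ then some ⟨r.n₁ - 1, r.n₂ + 1, r.n₃, r.n₄, r.n₅⟩ else none
  | 2 => if 0 < r.n₂ then some ⟨r.n₁, r.n₂ - 1, r.n₃ + 1, r.n₄, r.n₅⟩ else none
  | 3 => if 0 < r.n₃ then some ⟨r.n₁, r.n₂, r.n₃ - 1, r.n₄ + 1, r.n₅⟩ else none
  | 4 => if 0 < r.n₄ then some ⟨r.n₁, r.n₂, r.n₃, r.n₄ - 1, r.n₅ + 1⟩ else none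
  | _ => none

/-- Replace a letter `i + 1` by `i`. -/
def high (r : Row) : ℕ → Option Row
  | 1 => if 0 < r.n₂ then some ⟨r.n₁ + 1, r.n₂ - 1, r.n₃, r.n₄, r.n₅⟩ else none
  | 2 => if 0 < r.n₃ then some ⟨r.n₁, r.n₂ + 1, r.n₃ - 1, r.n₄, r.n₅⟩ else none
  | 3 => if 0 < r.n₄ then some ⟨r.n₁, r.n₂, r.n₃ + 1, r.n₄ - 1, r.n₅⟩ else none
  | 4 => if 0 < r.n₅ then some ⟨r.n₁, r.n₂, r.n₃, r.n₄ + 1, r.n₅ - 1⟩ else none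
  | _ => none

/-- The crystal of one-row tableaux. -/
def crys : Crys where
  V := Row
  F i r := r.low i
  E i r := r.high i
  φ i r := r.cnt i
  ε i r := r.cnt (i + 1)

theorem low_one {r s : Row} : r.low 1 = some s ↔ r.n₁ = s.n₁ + 1 ∧ s.n₂ = r.n₂ + 1 ∧
    s.n₃ = r.n₃ ∧ s.n₄ = r.n₄ ∧ s.n₅ = r.n₅ := by
  rcases r with ⟨a, b, c, d, e⟩
  rcases s with ⟨a', b', c', d', e'⟩
  simp only [low, Option.ite_none_right_eq_some, Option.some.injEq, Row.mk.injEq]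
  omega

theorem low_two {r s : Row} : r.low 2 = some s ↔ s.n₁ = r.n₁ ∧ r.n₂ = s.n₂ + 1 ∧
    s.n₃ = r.n₃ + 1 ∧ s.n₄ = r.n₄ ∧ s.n₅ = r.n₅ := by
  rcases r with ⟨a, b, c, d, e⟩
  rcases s with ⟨a', b', c', d', e'⟩
  simp only [low, Option.ite_none_right_eq_some, Option.some.injEq, Row.mk.injEq]
  omega

theorem low_three {r s : Row} : r.low 3 = some s ↔ s.n₁ = r.n₁ ∧ s.n₂ = r.n₂ ∧
    r.n₃ = s.n₃ + 1 ∧ s.n₄ = r.n₄ + 1 ∧ s.n₅ = r.n₅ := by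
  rcases r with ⟨a, b, c, d, e⟩
  rcases s with ⟨a', b', c', d', e'⟩
  simp only [low, Option.ite_none_right_eq_some, Option.some.injEq, Row.mk.injEq]
  omega

theorem low_four {r s : Row} : r.low 4 = some s ↔ s.n₁ = r.n₁ ∧ s.n₂ = r.n₂ ∧
    s.n₃ = r.n₃ ∧ r.n₄ = s.n₄ + 1 ∧ s.n₅ = r.n₅ + 1 := by
  rcases r with ⟨a, b, c, d, e⟩
  rcases s with ⟨a', b', c', d', e'⟩
  simp only [low, Option.ite_none_right_eq_some, Option.some.injEq, Row.mk.injEq]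
  omega

theorem high_iff {i : ℕ} (hi : i ∈ Set.Icc 1 4) {r s : Row} :
    s.low i = some r ↔ r.high i = some s := by
  rcases r with ⟨a, b, c, d, e⟩
  rcases s with ⟨a', b', c', d', e'⟩
  obtain ⟨h1, h2⟩ := hi
  interval_cases i <;>
  · simp only [low, high, Option.ite_none_right_eq_some, Option.some.injEq, Row.mk.injEq]
    omega

theorem low_isSome {i : ℕ} (hi : i ∈ Set.Icc 1 4) {r : Row} (h : 0 < r.cnt i) :
    ∃ s, r.low i = some s := by
  obtain ⟨h1, h2⟩ := hi
  interval_cases i <;> exact ⟨_, if_pos h⟩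

theorem high_isSome {i : ℕ} (hi : i ∈ Set.Icc 1 4) {r : Row} (h : 0 < r.cnt (i + 1)) :
    ∃ s, r.high i = some s := by
  obtain ⟨h1, h2⟩ := hi
  interval_cases i <;> exact ⟨_, if_pos h⟩

theorem cnt_low {i : ℕ} (hi : i ∈ Set.Icc 1 4) {r s : Row} (h : r.low i = some s) (j : ℕ) :
    s.cnt j + (if j = i then 1 else 0) = r.cnt j + (if j = i + 1 then 1 else 0) := by
  obtain ⟨h1, h2⟩ := hi
  rcases r with ⟨a, b, c, d, e⟩
  rcases s with ⟨a', b', c', d', e'⟩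
  interval_cases i <;> simp only [low_one, low_two, low_three, low_four] at h <;>
  · rcases j with _ | _ | _ | _ | _ | _ | j <;> simp [cnt] <;> omega

theorem ext_cnt {r s : Row} (h : ∀ j, r.cnt j = s.cnt j) : r = s :=
  Row.ext (h 1) (h 2) (h 3) (h 4) (h 5)

theorem low_comm {i j : ℕ} (hi : i ∈ Set.Icc 1 4) (hj : j ∈ Set.Icc 1 4) (hij : i ≠ j)
    {r s s' : Row} (h : r.low i = some s) (h' : r.low j = some s') :
    ∃ t, s.low j = some t ∧ s'.low i = some t := by
  have e (k) := cnt_low hi h k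
  have e' (k) := cnt_low hj h' k
  have p (k) (hk : k ∈ Set.Icc 1 4) {x y : Row} (hx : x.low k = some y) : 0 < x.cnt k := by
    have := cnt_low hk hx k
    simp at this
    omega
  have p1 := p i hi h
  have p2 := p j hj h'
  obtain ⟨t, ht⟩ := low_isSome hj (r := s) (by
    have := e j
    simp only [hij.symm, if_false] at this
    omega)
  obtain ⟨t', ht'⟩ := low_isSome hi (r := s') (by
    have := e' i
    simp only [hij, if_false] at this
    omega)
  refine ⟨t, ht, ?_⟩
  have : t' = t := ext_cnt fun k => by
    have h1 := e k
    have h2 := e' k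
    have h3 := cnt_low hj ht k
    have h4 := cnt_low hi ht' k
    omega
  rwa [this] at ht'

theorem high_comm {i j : ℕ} (hi : i ∈ Set.Icc 1 4) (hj : j ∈ Set.Icc 1 4) (hij : i ≠ j)
    {r s s' : Row} (h : r.high i = some s) (h' : r.high j = some s') :
    ∃ t, s.high j = some t ∧ s'.high i = some t := by
  rw [← high_iff hi] at h
  rw [← high_iff hj] at h'
  have e (k) := cnt_low hi h k
  have e' (k) := cnt_low hj h' k
  have p (k) (hk : k ∈ Set.Icc 1 4) {x y : Row} (hx : x.low k = some y) : 0 < y.cnt (k + 1) := by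
    have := cnt_low hk hx (k + 1)
    simp at this
    omega
  have p1 := p i hi h
  have p2 := p j hj h'
  obtain ⟨t, ht⟩ := high_isSome hj (r := s) (by
    have := e (j + 1)
    simp only [Nat.add_right_cancel_iff, hij.symm, if_false] at this
    omega)
  obtain ⟨t', ht'⟩ := high_isSome hi (r := s') (by
    have := e' (i + 1)
    simp only [Nat.add_right_cancel_iff, hij, if_false] at this
    omega)
  refine ⟨t, ht, ?_⟩
  have : t' = t := ext_cnt fun k => by
    have h1 := e k
    have h2 := e' k
    have h3 := cnt_low hj ((high_iff hj).2 ht) k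
    have h4 := cnt_low hi ((high_iff hi).2 ht') k
    omega
  rwa [this] at ht'

theorem crys_ax : crys.Ax (Set.Icc 1 4) where
  FE i hi u v := high_iff hi
  F_def i hi u h := low_isSome hi h
  E_def i hi u h := high_isSome hi h
  φF i hi u v h := by
    have := cnt_low hi h i
    simp at this
    exact this.symm
  εF i hi u v h := by
    have := cnt_low hi h (i + 1)
    simp at this
    exact this
  near i hi j hj hn u v h := by
    have h1 := cnt_low hi h j
    have h2 := cnt_low hi h (j + 1)
    simp only [crys, Neighb] at *
    split_ifs at * <;> omega
  far i hi j hj hn u v h := by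
    have h1 := cnt_low hi h j
    have h2 := cnt_low hi h (j + 1)
    simp only [crys, Far] at *
    split_ifs at * <;> omega
  A3F i hi j hj hn u v v' h h' hl := by
    have h1 := cnt_low hi h j
    have h2 := cnt_low hj h' i
    refine ⟨?_, low_comm hi hj (by rintro rfl; simp [Neighb] at hn) h h'⟩
    simp only [crys, Neighb] at *
    split_ifs at * <;> omega
  A3E i hi j hj hn u v v' h h' hl := by
    have h1 := cnt_low hi ((high_iff hi).2 h) (j + 1)
    have h2 := cnt_low hj ((high_iff hj).2 h') (i + 1)
    refine ⟨?_, high_comm hi hj (by rintro rfl; simp [Neighb] at hn) h h'⟩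
    simp only [crys, Neighb] at *
    split_ifs at * <;> omega
  A4F i hi j hj hn u v v' h h' hl hl' := by
    have h1 := cnt_low hi h j
    have h2 := cnt_low hj h' i
    simp only [crys, Neighb] at *
    split_ifs at * <;> omega
  A4E i hi j hj hn u v v' h h' hl hl' := by
    have h1 := cnt_low hi ((high_iff hi).2 h) (j + 1)
    have h2 := cnt_low hj ((high_iff hj).2 h') (i + 1)
    simp only [crys, Neighb] at *
    split_ifs at * <;> omega
  A5F i hi j hj hn u v v' h h' := low_comm hi hj (by rintro rfl; simp [Far] at hn) h h'
  A5E i hi j hj hn u v v' h h' := high_comm hi hj (by rintro rfl; simp [Far] at hn) h h'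

end Row

/-- The crystal of four-row tableaux. -/
def tab : Crys := Row.crys.tensor (Row.crys.tensor (Row.crys.tensor Row.crys))

theorem tab_ax : tab.Ax (Set.Icc 1 4) :=
  Row.crys_ax.tensor (Row.crys_ax.tensor (Row.crys_ax.tensor Row.crys_ax))

namespace tab

/-- The tableau with given rows. -/
def mk (r₁ r₂ r₃ r₄ : Row) : tab.V := (r₁, r₂, r₃, r₄)

theorem F_iff {i : ℕ} {r₁ r₂ r₃ r₄ s₁ s₂ s₃ s₄ : Row} :
    tab.F i (mk r₁ r₂ r₃ r₄) = some (mk s₁ s₂ s₃ s₄) ↔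
      (r₂.cnt (i + 1) + (r₃.cnt (i + 1) + (r₄.cnt (i + 1) - r₃.cnt i) - r₂.cnt i) < r₁.cnt i ∧
        r₁.low i = some s₁ ∧ s₂ = r₂ ∧ s₃ = r₃ ∧ s₄ = r₄) ∨
      (r₁.cnt i ≤ r₂.cnt (i + 1) + (r₃.cnt (i + 1) + (r₄.cnt (i + 1) - r₃.cnt i) - r₂.cnt i) ∧
        r₃.cnt (i + 1) + (r₄.cnt (i + 1) - r₃.cnt i) < r₂.cnt i ∧
        s₁ = r₁ ∧ r₂.low i = some s₂ ∧ s₃ = r₃ ∧ s₄ = r₄) ∨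
      (r₁.cnt i ≤ r₂.cnt (i + 1) + (r₃.cnt (i + 1) + (r₄.cnt (i + 1) - r₃.cnt i) - r₂.cnt i) ∧
        r₂.cnt i ≤ r₃.cnt (i + 1) + (r₄.cnt (i + 1) - r₃.cnt i) ∧
        r₄.cnt (i + 1) < r₃.cnt i ∧ s₁ = r₁ ∧ s₂ = r₂ ∧ r₃.low i = some s₃ ∧ s₄ = r₄) ∨
      (r₁.cnt i ≤ r₂.cnt (i + 1) + (r₃.cnt (i + 1) + (r₄.cnt (i + 1) - r₃.cnt i) - r₂.cnt i) ∧
        r₂.cnt i ≤ r₃.cnt (i + 1) + (r₄.cnt (i + 1) - r₃.cnt i) ∧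
        r₃.cnt i ≤ r₄.cnt (i + 1) ∧ s₁ = r₁ ∧ s₂ = r₂ ∧ s₃ = r₃ ∧ r₄.low i = some s₄) := by
  have e1 := @Crys.tensor_F_iff Row.crys (Row.crys.tensor (Row.crys.tensor Row.crys)) i
    (r₁, r₂, r₃, r₄) (s₁, s₂, s₃, s₄)
  have e2 := @Crys.tensor_F_iff Row.crys (Row.crys.tensor Row.crys) i (r₂, r₃, r₄) (s₂, s₃, s₄)
  have e3 := @Crys.tensor_F_iff Row.crys Row.crys i (r₃, r₄) (s₃, s₄)
  refine e1.trans ?_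
  dsimp only at e2 e3 ⊢
  erw [e2, e3]
  simp only [Crys.tensor, Row.crys, Prod.mk.injEq]
  constructor
  · rintro (h | ⟨a, ⟨b, h, h', h''⟩ | ⟨b, ⟨c, h, h'⟩ | ⟨c, h, h'⟩, h''⟩, e⟩)
    · exact Or.inl h
    · exact Or.inr (Or.inl ⟨a, b, e, h, h', h''⟩)
    · exact Or.inr (Or.inr (Or.inl ⟨a, b, c, e, h'', h, h'⟩))
    · exact Or.inr (Or.inr (Or.inr ⟨a, b, c, e, h'', h', h⟩))
  · rintro (h | ⟨a, b, e, h, h', h''⟩ | ⟨a, b, c, e, h'', h, h'⟩ | ⟨a, b, c, e, h'', h', h⟩)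
    · exact Or.inl h
    · exact Or.inr ⟨a, Or.inl ⟨b, h, h', h''⟩, e⟩
    · exact Or.inr ⟨a, Or.inr ⟨b, Or.inl ⟨c, h, h'⟩, h''⟩, e⟩
    · exact Or.inr ⟨a, Or.inr ⟨b, Or.inr ⟨c, h, h'⟩, h''⟩, e⟩

end tab

/-! ### Comparing crystals with the same highest weight -/

namespace Crys

variable {X Y : Crys} {C : Set ℕ} {s : X.V} {m : Y.V}

theorem Ax.E_pos (h : X.Ax C) {i : ℕ} (hi : i ∈ C) {u v : X.V} (e : X.E i u = some v) :
    0 < X.ε i u := by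
  have := h.εF i hi _ _ ((h.FE i hi _ _).2 e)
  omega

theorem Ax.F_pos (h : X.Ax C) {i : ℕ} (hi : i ∈ C) {u v : X.V} (e : X.F i u = some v) :
    0 < X.φ i u := by
  have := h.φF i hi _ _ e
  omega

/-- Vertices of two crystals obtained from base vertices by the same string of `n` operators. -/
inductive Rel (X Y : Crys) (C : Set ℕ) (s : X.V) (m : Y.V) : ℕ → X.V → Y.V → Prop
  | base : Rel X Y C s m 0 s m
  | step {n : ℕ} {u v : X.V} {w x : Y.V} {i : ℕ} : Rel X Y C s m n u w → i ∈ C →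
      X.F i u = some v → Y.F i w = some x → Rel X Y C s m (n + 1) v x

theorem Rel.symm {n : ℕ} {u : X.V} {w : Y.V} (h : Rel X Y C s m n u w) : Rel Y X C m s n w u := by
  induction h with
  | base => exact .base
  | step _ hi e e' ih => exact ih.step hi e' e

/-- Related vertices of level `n` have the same string lengths. -/
def Rel.Matched (X Y : Crys) (C : Set ℕ) (s : X.V) (m : Y.V) (n : ℕ) : Prop :=
  ∀ u w, Rel X Y C s m n u w → ∀ j ∈ C, X.φ j u = Y.φ j w ∧ X.ε j u = Y.ε j w

/-- Raising operators can be lifted along related vertices of level `n`. -/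
def Rel.Raises (X Y : Crys) (C : Set ℕ) (s : X.V) (m : Y.V) (n : ℕ) : Prop :=
  ∀ u w, Rel X Y C s m n u w → ∀ j ∈ C, ∀ u', X.E j u = some u' →
    ∃ w' k, n = k + 1 ∧ Y.E j w = some w' ∧ Rel X Y C s m k u' w'

theorem Rel.lower (hX : X.Ax C) (hY : Y.Ax C) {n : ℕ} (hM : Rel.Matched X Y C s m n)
    {u v : X.V} {w : Y.V} (h : Rel X Y C s m n u w) {i : ℕ} (hi : i ∈ C) (e : X.F i u = some v) :
    ∃ x, Y.F i w = some x ∧ Rel X Y C s m (n + 1) v x := by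
  obtain ⟨x, hx⟩ := hY.F_def i hi w (by rw [← (hM u w h i hi).1]; exact hX.F_pos hi e)
  exact ⟨x, hx, h.step hi e hx⟩

theorem Neighb_or_Far {i j : ℕ} (h : i ≠ j) : Neighb i j ∨ Far i j := by
  unfold Neighb Far
  omega

/-- Completing a commuting square in `Y` from one in `X`, for an edge of label `0`. -/
theorem Rel.square (hX : X.Ax C) (hY : Y.Ax C) {k : ℕ} (hM : Rel.Matched X Y C s m k)
    (hM' : Rel.Matched X Y C s m (k + 1)) {i j : ℕ} (hi : i ∈ C) (hj : j ∈ C) (hn : Neighb i j)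
    {p u u' : X.V} {q w y : Y.V} (h : Rel X Y C s m k p q) (h' : Rel X Y C s m (k + 1) u w)
    (e2 : X.F i p = some u') (e3 : Y.F j q = some w)
    (e4 : Y.F i w = some y)
    (hl : X.φ i u = X.φ i p ∨ X.φ j u' = X.φ j p) :
    ∃ w', Y.E j y = some w' ∧ Rel X Y C s m (k + 1) u' w' := by
  obtain ⟨w', hw, hr⟩ := h.lower hX hY hM hi e2
  refine ⟨w', ?_, hr⟩
  rw [← hY.FE j hj]
  rcases hl with hl | hl
  · obtain ⟨-, z, hz, hz'⟩ := hY.A3F j hj i hi (Neighb.symm' hn) _ _ _ e3 hw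
      (by rw [← (hM' _ _ h' i hi).1, ← (hM _ _ h i hi).1, hl])
    rw [hz', ← hz, e4]
  · obtain ⟨-, z, hz, hz'⟩ := hY.A3F i hi j hj hn _ _ _ hw e3
      (by rw [← (hM' _ _ hr j hj).1, ← (hM _ _ h j hj).1, hl])
    rw [hz, ← hz', e4]

theorem Rel.raises_succ (hX : X.Ax C) (hY : Y.Ax C) {n : ℕ}
    (hM : ∀ k ≤ n, Rel.Matched X Y C s m k) (hR : ∀ k ≤ n, Rel.Raises X Y C s m k) :
    Rel.Raises X Y C s m (n + 1) := by
  intro x y hxy j hj u' hu'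
  cases hxy with
  | @step _ u _ w _ i h hi e e' =>
  by_cases hij : i = j
  · subst hij
    have : u' = u := by
      rw [← hX.FE i hi] at hu'
      exact hX.F_inj hi hu' e
    subst this
    exact ⟨w, n, rfl, (hY.FE i hi _ _).1 e', h⟩
  have e1 := (hX.FE i hi _ _).1 e
  rcases Neighb_or_Far hij with hn | hf
  · have n1 := hX.near i hi j hj hn _ _ e
    have n2 := hX.near j hj i hi (Neighb.symm' hn) _ _ ((hX.FE j hj _ _).2 hu')
    have n3 := hX.εF i hi _ _ e
    have n4 := hX.εF j hj _ _ ((hX.FE j hj _ _).2 hu')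
    by_cases c : X.ε j u = X.ε j x ∨ X.ε i u' = X.ε i x
    · obtain ⟨p, hp, hp', hl⟩ : ∃ p, X.E j u = some p ∧ X.E i u' = some p ∧
          (X.φ i u = X.φ i p ∨ X.φ j u' = X.φ j p) := by
        rcases c with c | c
        · obtain ⟨h1, p, hp, hp'⟩ := hX.A3E i hi j hj hn _ _ _ e1 hu' c
          have n5 := hX.near j hj i hi (Neighb.symm' hn) _ _ ((hX.FE j hj _ _).2 hp)
          have n6 := hX.εF i hi _ _ ((hX.FE i hi _ _).2 hp')
          exact ⟨p, hp, hp', Or.inl (by omega)⟩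
        · obtain ⟨h1, p, hp', hp⟩ := hX.A3E j hj i hi (Neighb.symm' hn) _ _ _ hu' e1 c
          have n5 := hX.near i hi j hj hn _ _ ((hX.FE i hi _ _).2 hp')
          have n6 := hX.εF j hj _ _ ((hX.FE j hj _ _).2 hp)
          exact ⟨p, hp, hp', Or.inr (by omega)⟩
      obtain ⟨q, k, rfl, hq, hr⟩ := hR n le_rfl _ _ h j hj p hp
      obtain ⟨w', hw', hr'⟩ := hr.square hX hY (hM k (by omega)) (hM _ le_rfl) hi hj hn h
        ((hX.FE i hi _ _).2 hp') ((hY.FE j hj _ _).2 hq) e' hl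
      exact ⟨w', k + 1, rfl, hw', hr'⟩
    · obtain ⟨p, q, p', q', t, h1, h2, h3, h4, h5, h6⟩ :=
        hX.A4E i hi j hj hn _ _ _ e1 hu' (by omega) (by omega)
      obtain ⟨wp, k, rfl, g1, r1⟩ := hR _ le_rfl _ _ h j hj p h1
      obtain ⟨wq, k, rfl, g2, r2⟩ := hR _ (by omega) _ _ r1 j hj q h2
      obtain ⟨wt, k, rfl, g3, r3⟩ := hR _ (by omega) _ _ r2 i hi t h3
      have l1 := hX.dual.label_zero hi hj hn e1 h1 (by simp only [dual]; omega)
      have l2 := hX.dual.label_zero hj hi (Neighb.symm' hn) hu' h4 (by simp only [dual]; omega)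
      simp only [dual] at l1 l2
      rw [← hX.FE _ hi] at h3 h4 h5
      rw [← hX.FE _ hj] at h1 h2 h6
      rw [← hX.FE _ hj] at hu'
      rw [← hY.FE _ hj] at g1 g2
      rw [← hY.FE _ hi] at g3
      have a1 := hX.φF j hj _ _ h1
      have a2 := hX.φF j hj _ _ h2
      have a3 := hX.φF i hi _ _ h3
      have a4 := hX.φF i hi _ _ h4
      have a5 := hX.φF i hi _ _ h5
      have a6 := hX.φF j hj _ _ h6
      have a7 := hX.φF j hj _ _ hu'
      have a8 := hX.φF i hi _ _ e
      have b1 := hX.near j hj i hi (Neighb.symm' hn) _ _ h1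
      have b2 := hX.near j hj i hi (Neighb.symm' hn) _ _ h2
      have b3 := hX.near i hi j hj hn _ _ h3
      have b4 := hX.near i hi j hj hn _ _ h4
      have b5 := hX.near i hi j hj hn _ _ h5
      have b6 := hX.near j hj i hi (Neighb.symm' hn) _ _ h6
      obtain ⟨wq', f1, s1⟩ := r3.lower hX hY (hM _ (by omega)) hj h6
      obtain ⟨wp', f2, s2⟩ := s1.lower hX hY (hM _ (by omega)) hi h5
      obtain ⟨w', f3, s3⟩ := s2.lower hX hY (hM _ (by omega)) hi h4
      refine ⟨w', _, rfl, ?_, s3⟩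
      have m0 := hM _ (by omega) _ _ r3
      have m1 := hM _ (by omega) _ _ r2 j hj
      have m2 := hM _ (by omega) _ _ s1 i hi
      obtain ⟨P, Q, P', Q', z, y1, y2, y3, y4, y5, y6⟩ := hY.A4F i hi j hj hn _ _ _ g3 f1
        (by rw [← m1.1, ← (m0 j hj).1]; omega) (by rw [← m2.1, ← (m0 i hi).1]; omega)
      rw [← hY.FE _ hj]
      rw [g2, Option.some.injEq] at y1
      subst y1
      rw [g1, Option.some.injEq] at y2
      subst y2
      rw [f2, Option.some.injEq] at y4
      subst y4
      rw [f3, Option.some.injEq] at y5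
      subst y5
      rw [y6, ← y3, e']
  · obtain ⟨p, hp, hp'⟩ := hX.A5E i hi j hj hf _ _ _ e1 hu'
    obtain ⟨q, k, rfl, hq, hr⟩ := hR n le_rfl _ _ h j hj p hp
    obtain ⟨w', hw, hr'⟩ := hr.lower hX hY (hM k (by omega)) hi ((hX.FE i hi _ _).2 hp')
    obtain ⟨z, hz, hz'⟩ := hY.A5F j hj i hi (Far.symm' hf) _ _ _ ((hY.FE j hj _ _).2 hq) hw
    refine ⟨w', k + 1, rfl, ?_, hr'⟩
    rw [← hY.FE j hj, hz', ← hz, e']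

theorem Rel.label_le (hX : X.Ax C) (hY : Y.Ax C) {n : ℕ}
    (hM : ∀ k ≤ n, Rel.Matched X Y C s m k) (hR : Rel.Raises Y X C m s n)
    {u x : X.V} {w y : Y.V} (h : Rel X Y C s m n u w) {i j : ℕ} (hi : i ∈ C) (hj : j ∈ C)
    (hn : Neighb i j) (e : X.F i u = some x) (e' : Y.F i w = some y)
    (hl : X.φ j x = X.φ j u) (hl' : Y.φ j y = Y.φ j w + 1) : False := by
  have n1 := hX.near i hi j hj hn _ _ e
  have n2 := hY.near i hi j hj hn _ _ e'
  have m1 := hM _ le_rfl _ _ h j hj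
  obtain ⟨w', hw'⟩ := hY.E_def j hj y (by omega)
  obtain ⟨h1, p', hp', hp⟩ := hY.A3E i hi j hj hn _ _ _ ((hY.FE i hi _ _).1 e') hw' (by omega)
  obtain ⟨p, k, rfl, g1, g2⟩ := hR _ _ h.symm j hj p' hp'
  replace g2 := g2.symm
  rw [← hX.FE j hj] at g1
  rw [← hY.FE j hj] at hp' hw'
  rw [← hY.FE i hi] at hp
  have n3 := hY.near j hj i hi (Neighb.symm' hn) _ _ hp'
  have n4 := hY.εF i hi _ _ hp
  have n5 := hY.εF i hi _ _ e'
  have m2 := hM _ le_rfl _ _ h i hi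
  have m3 := hM _ (by omega) _ _ g2 i hi
  have n6 := hY.φF i hi _ _ hp
  obtain ⟨u2, hu2⟩ := hX.F_def i hi p (by omega)
  obtain ⟨h5, z, hz, hz'⟩ := hX.A3F j hj i hi (Neighb.symm' hn) _ _ _ g1 hu2 (by omega)
  rw [e, Option.some.injEq] at hz
  subst hz
  have n7 := hX.φF j hj _ _ hz'
  have n8 := hX.φF j hj _ _ g1
  omega

theorem Rel.Matched.symm {n : ℕ} (h : Rel.Matched X Y C s m n) : Rel.Matched Y X C m s n :=
  fun u w r j hj => ⟨(h w u r.symm j hj).1.symm, (h w u r.symm j hj).2.symm⟩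

theorem Rel.matched_succ (hX : X.Ax C) (hY : Y.Ax C) {n : ℕ}
    (hM : ∀ k ≤ n, Rel.Matched X Y C s m k) (hR : Rel.Raises X Y C s m n)
    (hR' : Rel.Raises Y X C m s n) : Rel.Matched X Y C s m (n + 1) := by
  intro x y hxy j hj
  cases hxy with
  | @step _ u _ w _ i h hi e e' =>
  have m1 := hM _ le_rfl _ _ h j hj
  by_cases hij : i = j
  · subst hij
    have := hX.φF i hi _ _ e
    have := hX.εF i hi _ _ e
    have := hY.φF i hi _ _ e'
    have := hY.εF i hi _ _ e'
    omega
  rcases Neighb_or_Far hij with hn | hf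
  · have n1 := hX.near i hi j hj hn _ _ e
    have n2 := hY.near i hi j hj hn _ _ e'
    rcases n1 with n1 | n1 <;> rcases n2 with n2 | n2
    · omega
    · exact (h.label_le hX hY hM hR' hi hj hn e e' n1.1 n2.1).elim
    · exact (h.symm.label_le hY hX (fun k hk => (hM k hk).symm) hR hi hj hn e' e n2.1 n1.1).elim
    · omega
  · have := hX.far i hi j hj hf _ _ e
    have := hY.far i hi j hj hf _ _ e'
    omega

theorem Rel.main (hX : X.Ax C) (hY : Y.Ax C) (hs : ∀ i ∈ C, X.ε i s = 0)
    (hm : ∀ i ∈ C, Y.ε i m = 0) (hφ : ∀ i ∈ C, X.φ i s = Y.φ i m) (n : ℕ) :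
    Rel.Matched X Y C s m n ∧ Rel.Raises X Y C s m n ∧ Rel.Raises Y X C m s n := by
  induction n using Nat.strong_induction_on with
  | _ n ih =>
  cases n with
  | zero =>
    refine ⟨?_, ?_, ?_⟩
    · rintro u w ⟨⟩ j hj
      exact ⟨hφ j hj, by rw [hs j hj, hm j hj]⟩
    · rintro u w ⟨⟩ j hj u' hu'
      have := hX.E_pos hj hu'
      have := hs j hj
      omega
    · rintro u w ⟨⟩ j hj u' hu'
      have := hY.E_pos hj hu'
      have := hm j hj
      omega
  | succ n =>
    have hM : ∀ k ≤ n, Rel.Matched X Y C s m k := fun k hk => (ih k (by omega)).1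
    exact ⟨Rel.matched_succ hX hY hM (ih n (by omega)).2.1 (ih n (by omega)).2.2,
      Rel.raises_succ hX hY hM fun k hk => (ih k (by omega)).2.1,
      Rel.raises_succ hY hX (fun k hk => (hM k hk).symm) fun k hk => (ih k (by omega)).2.2⟩

theorem Rel.functional (hY : Y.Ax C) (hR : ∀ n, Rel.Raises X Y C s m n) (hX : X.Ax C)
    {n : ℕ} {u : X.V} {w w' : Y.V} (h : Rel X Y C s m n u w) (h' : Rel X Y C s m n u w') :
    w = w' := by
  induction h generalizing w' with
  | base => cases h'; rfl
  | @step n u v w x i h hi e e' ih =>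
    obtain ⟨x', k, hk, g, r⟩ := hR _ _ _ h' i hi u ((hX.FE i hi _ _).1 e)
    obtain rfl : k = n := by omega
    have := ih r
    subst this
    rw [← hY.FE i hi, e'] at g
    simpa using g

end Crys

/-! ### An abstract crystal from a colored graph -/

section optIter

variable {V : Type} {f : V → Option V}

theorem optIter_add (a b : ℕ) (v : V) :
    optIter f (a + b) v = (optIter f a v).bind (optIter f b) := by
  induction a generalizing v with
  | zero => simp [optIter]
  | succ a ih =>
    rw [Nat.succ_add]
    simp only [optIter]
    cases f v with
    | none => rfl
    | some w => exact ih w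

theorem optIter_one (v : V) : optIter f 1 v = f v := by
  simp only [optIter]
  cases f v <;> rfl

theorem optIter_isSome_of_le {a b : ℕ} (hab : a ≤ b) {v : V}
    (h : (optIter f b v).isSome = true) : (optIter f a v).isSome = true := by
  obtain ⟨c, rfl⟩ := Nat.exists_eq_add_of_le hab
  rw [optIter_add] at h
  cases e : optIter f a v with
  | none => simp [e] at h
  | some w => rfl

theorem optIter_lt_card [Finite V] (hf : ∀ (v : V) (k : ℕ), 0 < k → optIter f k v ≠ some v)
    {k : ℕ} {v : V} (h : (optIter f k v).isSome = true) : k < Nat.card V := by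
  have hs (j : Fin (k + 1)) : (optIter f j v).isSome = true :=
    optIter_isSome_of_le (Nat.lt_succ_iff.1 j.2) h
  have key (a b : Fin (k + 1)) (hab : a < b) :
      (optIter f a v).get (hs a) ≠ (optIter f b v).get (hs b) := by
    intro e
    obtain ⟨c, hc⟩ := Nat.exists_eq_add_of_lt (Fin.lt_def.1 hab)
    obtain ⟨x, hx⟩ := Option.isSome_iff_exists.1 (hs a)
    obtain ⟨y, hy⟩ := Option.isSome_iff_exists.1 (hs b)
    simp only [hx, hy, Option.get_some] at e
    subst e
    rw [hc, add_assoc, optIter_add, hx] at hy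
    exact hf x (c + 1) (by omega) hy
  have inj : Function.Injective fun j : Fin (k + 1) => (optIter f j v).get (hs j) := by
    intro a b e
    rcases lt_trichotomy a b with h | h | h
    · exact (key a b h e).elim
    · exact h
    · exact (key b a h e.symm).elim
  have := Nat.card_le_card_of_injective _ inj
  simp at this
  omega

end optIter

namespace PreGraph

variable {K : PreGraph} {C : Set ℕ}

theorem le_h_iff (hK : IsColored K C) {i k : ℕ} {v : K.V} :
    k ≤ K.h i v ↔ (optIter (K.F i) k v).isSome = true := by
  have := hK.1
  have hb : BddAbove {k | (optIter (K.F i) k v).isSome = true} :=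
    ⟨Nat.card K.V, fun k hk => (optIter_lt_card (hK.2.2.2 i) hk).le⟩
  have hne : {k | (optIter (K.F i) k v).isSome = true}.Nonempty := ⟨0, rfl⟩
  exact ⟨fun h => optIter_isSome_of_le h (Nat.sSup_mem hne hb), fun h => le_csSup hb h⟩

theorem le_t_iff (hK : IsColored K C) {i k : ℕ} {v : K.V} :
    k ≤ K.t i v ↔ ∃ u, optIter (K.F i) k u = some v := by
  have := hK.1
  have hb : BddAbove {k | ∃ u, optIter (K.F i) k u = some v} :=
    ⟨Nat.card K.V, fun k ⟨u, hu⟩ => (optIter_lt_card (hK.2.2.2 i) (v := u) (by rw [hu]; rfl)).le⟩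
  have hne : {k | ∃ u, optIter (K.F i) k u = some v}.Nonempty := ⟨0, v, rfl⟩
  refine ⟨fun h => ?_, fun h => le_csSup hb h⟩
  obtain ⟨u, hu⟩ := Nat.sSup_mem hne hb
  obtain ⟨c, hc⟩ := Nat.exists_eq_add_of_le' h
  rw [t] at hc
  rw [hc, optIter_add] at hu
  obtain ⟨w, -, hw⟩ := Option.bind_eq_some_iff.1 hu
  exact ⟨w, hw⟩

theorem h_eq (hK : IsColored K C) {i : ℕ} {u v : K.V} (e : K.F i u = some v) :
    K.h i u = K.h i v + 1 := by
  have key (k : ℕ) : k + 1 ≤ K.h i u ↔ k ≤ K.h i v := by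
    rw [le_h_iff hK, le_h_iff hK, optIter, e]
    rfl
  have h1 := key (K.h i v)
  have h2 := key (K.h i u - 1)
  omega

theorem t_eq (hK : IsColored K C) {i : ℕ} {u v : K.V} (e : K.F i u = some v) :
    K.t i v = K.t i u + 1 := by
  have key (k : ℕ) : k + 1 ≤ K.t i v ↔ k ≤ K.t i u := by
    rw [le_t_iff hK, le_t_iff hK]
    refine exists_congr fun x => ?_
    rw [optIter_add, Option.bind_eq_some_iff]
    constructor
    · rintro ⟨y, hy, hy'⟩
      rw [optIter_one] at hy'
      rwa [hK.2.2.1 i _ _ _ e hy']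
    · intro h
      exact ⟨u, h, by rw [optIter_one, e]⟩
  have h1 := key (K.t i u)
  have h2 := key (K.t i v - 1)
  omega

theorem Finv_eq_iff (hK : IsColored K C) {i : ℕ} {u v : K.V} :
    K.Finv i v = some u ↔ K.F i u = some v := by
  unfold Finv
  constructor
  · intro h
    split_ifs at h with hx
    rw [Option.some.injEq] at h
    rw [← h]
    exact hx.choose_spec
  · intro h
    have hx : ∃ u, K.F i u = some v := ⟨u, h⟩
    rw [dif_pos hx, hK.2.2.1 i _ _ _ hx.choose_spec h]

/-- The abstract crystal underlying a colored graph. -/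
@[reducible]
noncomputable def crys (K : PreGraph) : Crys where
  toPreGraph := K
  E := K.Finv
  φ := K.h
  ε := K.t

theorem crys_ax (hK : IsCrystalOn K C) : K.crys.Ax C := by
  obtain ⟨hc, -, h2, h34, h5⟩ := hK
  have ne {i j : ℕ} (h : Neighb i j) : i ≠ j := by unfold Neighb at h; omega
  have ne' {i j : ℕ} (h : Far i j) : i ≠ j := by unfold Far at h; omega
  have near : ∀ i ∈ C, ∀ j ∈ C, Neighb i j → ∀ u v, K.F i u = some v →
      (K.h j v = K.h j u ∧ K.t j u = K.t j v + 1) ∨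
      (K.h j v = K.h j u + 1 ∧ K.t j v = K.t j u) := by
    intro i hi j hj hn u v e
    have := (h2 i hi j hj (ne hn)).1 u v e
    rw [if_pos hn] at this
    omega
  have inv (i : ℕ) {u v : K.V} : K.Finv i v = some u ↔ K.F i u = some v := Finv_eq_iff hc
  refine ⟨fun i hi u v => (inv i).symm, ?_, ?_, fun i hi u v e => h_eq hc e,
    fun i hi u v e => t_eq hc e, near, ?_, ?_, ?_, ?_, ?_, ?_, ?_⟩
  · intro i hi u hu
    have := (le_h_iff hc).1 (show 1 ≤ K.h i u from hu)
    rw [optIter_one] at this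
    exact Option.isSome_iff_exists.1 this
  · intro i hi u hu
    obtain ⟨v, hv⟩ := (le_t_iff hc).1 (show 1 ≤ K.t i u from hu)
    rw [optIter_one] at hv
    exact ⟨v, (inv i).2 hv⟩
  · intro i hi j hj hn u v e
    have := (h2 i hi j hj (ne' hn)).1 u v e
    rw [if_neg (by unfold Neighb Far at *; omega)] at this
    dsimp only
    omega
  · intro i hi j hj hn u v v' e e' hl
    obtain ⟨h1, w⟩ := (h34 i hi j hj hn).1.1 u v v' e e' hl
    exact ⟨by dsimp only; omega, w⟩
  · intro i hi j hj hn u v v' e e' hl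
    dsimp only at *
    rw [inv] at e e'
    have n1 := near i hi j hj hn _ _ e
    have n2 := near j hj i hi (Crys.Neighb.symm' hn) _ _ e'
    obtain ⟨h1, w, hw, hw'⟩ := (h34 i hi j hj hn).1.2 _ _ _ e e' (by omega)
    exact ⟨by omega, w, (inv j).2 hw, (inv i).2 hw'⟩
  · intro i hi j hj hn u v v' e e' hl hl'
    dsimp only at *
    obtain ⟨w, hw, hw'⟩ := (h34 i hi j hj hn).2.1 _ _ _ e e' (by omega) (by omega)
    simp only [e, e', Option.bind_some, Option.bind_eq_some_iff] at hw hw'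
    obtain ⟨q, ⟨p, h1, h2⟩, h3⟩ := hw
    obtain ⟨q', ⟨p', h1', h2'⟩, h3'⟩ := hw'
    exact ⟨p, q, p', q', w, h1, h2, h3, h1', h2', h3'⟩
  · intro i hi j hj hn u v v' e e' hl hl'
    dsimp only at *
    have e1 := e
    have e1' := e'
    rw [inv] at e1 e1'
    have n1 := near i hi j hj hn _ _ e1
    have n2 := near j hj i hi (Crys.Neighb.symm' hn) _ _ e1'
    obtain ⟨w, hw, hw'⟩ := (h34 i hi j hj hn).2.2 _ _ _ e1 e1' (by omega) (by omega)
    simp only [e, e', Option.bind_some, Option.bind_eq_some_iff] at hw hw'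
    obtain ⟨q, ⟨p, h1, h2⟩, h3⟩ := hw
    obtain ⟨q', ⟨p', h1', h2'⟩, h3'⟩ := hw'
    exact ⟨p, q, p', q', w, h1, h2, h3, h1', h2', h3'⟩
  · intro i hi j hj hn u v v' e e'
    dsimp only at *
    have := h5 i hi j hj hn (K.F i) (by simp) (K.F j) (by simp) u (by simp [e]) (by simp [e'])
    simpa [e, e'] using this
  · intro i hi j hj hn u v v' e e'
    dsimp only at *
    have := h5 i hi j hj hn (K.Finv i) (by simp) (K.Finv j) (by simp) u (by simp [e]) (by simp [e'])
    simpa [e, e'] using this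

end PreGraph

/-! ### Uniqueness of sources -/

namespace Crys

variable {X : Crys} {I : Set ℕ}

/-- `v` is reached from `u` by raising operators with colors in `I`. -/
def Up (X : Crys) (I : Set ℕ) (u v : X.V) : Prop :=
  Relation.ReflTransGen (fun a b => ∃ i ∈ I, X.E i a = some b) u v

/-- No raising operator with color in `I` acts on `v`. -/
def IsTop (X : Crys) (I : Set ℕ) (v : X.V) : Prop := ∀ i ∈ I, X.ε i v = 0

theorem IsTop.eq_of_up (hX : X.Ax I) {s t : X.V} (hs : X.IsTop I s) (h : X.Up I s t) : s = t := by
  rcases Relation.ReflTransGen.cases_head h with h | ⟨c, ⟨i, hi, e⟩, -⟩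
  · exact h
  · have := hX.E_pos hi e
    rw [hs i hi] at this
    omega

theorem Ax.confluent (hX : X.Ax I) {i j : ℕ} (hi : i ∈ I) (hj : j ∈ I) {v a b : X.V}
    (ea : X.E i v = some a) (eb : X.E j v = some b) : ∃ w, X.Up I a w ∧ X.Up I b w := by
  have one {k : ℕ} (hk : k ∈ I) {x y : X.V} (e : X.E k x = some y) : X.Up I x y :=
    Relation.ReflTransGen.single ⟨k, hk, e⟩
  by_cases hij : i = j
  · subst hij
    rw [ea, Option.some.injEq] at eb
    subst eb
    exact ⟨a, .refl, .refl⟩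
  rcases Neighb_or_Far hij with hn | hf
  · have n1 := hX.near i hi j hj hn _ _ ((hX.FE i hi _ _).2 ea)
    have n2 := hX.near j hj i hi (Neighb.symm' hn) _ _ ((hX.FE j hj _ _).2 eb)
    by_cases c1 : X.ε j a = X.ε j v
    · obtain ⟨-, w, h1, h2⟩ := hX.A3E i hi j hj hn _ _ _ ea eb c1
      exact ⟨w, one hj h1, one hi h2⟩
    by_cases c2 : X.ε i b = X.ε i v
    · obtain ⟨-, w, h1, h2⟩ := hX.A3E j hj i hi (Neighb.symm' hn) _ _ _ eb ea c2
      exact ⟨w, one hj h2, one hi h1⟩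
    obtain ⟨p, q, p', q', w, h1, h2, h3, h4, h5, h6⟩ :=
      hX.A4E i hi j hj hn _ _ _ ea eb (by omega) (by omega)
    exact ⟨w, ((one hj h1).trans (one hj h2)).trans (one hi h3),
      ((one hi h4).trans (one hi h5)).trans (one hj h6)⟩
  · obtain ⟨w, h1, h2⟩ := hX.A5E i hi j hj hf _ _ _ ea eb
    exact ⟨w, one hj h1, one hi h2⟩

theorem Ax.exists_top (hX : X.Ax I) (wf : WellFounded fun a b => ∃ i ∈ I, X.E i b = some a)
    (v : X.V) : ∃ t, X.IsTop I t ∧ X.Up I v t := by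
  induction v using wf.induction with
  | _ v ih =>
  by_cases h : X.IsTop I v
  · exact ⟨v, h, .refl⟩
  · obtain ⟨i, hi, h⟩ := by simpa only [IsTop, not_forall] using h
    obtain ⟨w, hw⟩ := hX.E_def i hi v (by omega)
    obtain ⟨t, ht, hu⟩ := ih w ⟨i, hi, hw⟩
    exact ⟨t, ht, .head ⟨i, hi, hw⟩ hu⟩

theorem Ax.top_unique (hX : X.Ax I) (wf : WellFounded fun a b => ∃ i ∈ I, X.E i b = some a)
    {v s t : X.V} (hs : X.IsTop I s) (ht : X.IsTop I t) (us : X.Up I v s)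
    (ut : X.Up I v t) : s = t := by
  induction v using wf.induction generalizing s t with
  | _ v ih =>
  rcases Relation.ReflTransGen.cases_head us with rfl | ⟨a, ⟨i, hi, ea⟩, ua⟩
  · exact hs.eq_of_up hX ut
  rcases Relation.ReflTransGen.cases_head ut with rfl | ⟨b, ⟨j, hj, eb⟩, ub⟩
  · exact (ht.eq_of_up hX us).symm
  obtain ⟨w, wa, wb⟩ := hX.confluent hi hj ea eb
  obtain ⟨r, hr, ur⟩ := hX.exists_top wf w
  exact (ih a ⟨i, hi, ea⟩ hs hr ua (wa.trans ur)).trans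
    (ih b ⟨j, hj, eb⟩ ht hr ub (wb.trans ur)).symm

theorem Ax.up_top (hX : X.Ax I) (wf : WellFounded fun a b => ∃ i ∈ I, X.E i b = some a)
    {u v s : X.V} (hs : X.IsTop I s) (us : X.Up I u s) (h : inComp X.toPreGraph I u v) :
    X.Up I v s := by
  induction h with
  | refl => exact us
  | @tail a b _ hab ih =>
    obtain ⟨i, hi, e | e⟩ := hab
    · exact .head ⟨i, hi, (hX.FE i hi _ _).1 e⟩ ih
    · obtain ⟨t, ht, ut⟩ := hX.exists_top wf b
      have := hX.top_unique wf hs ht ih (.head ⟨i, hi, (hX.FE i hi _ _).1 e⟩ ut)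
      rwa [this]

theorem Ax.top_eq (hX : X.Ax I) (wf : WellFounded fun a b => ∃ i ∈ I, X.E i b = some a)
    {s t : X.V} (hs : X.IsTop I s) (ht : X.IsTop I t) (h : inComp X.toPreGraph I s t) : s = t :=
  (ht.eq_of_up hX (hX.up_top wf hs .refl h)).symm

end Crys

theorem inComp.symm {K : PreGraph} {I : Set ℕ} {u v : K.V} (h : inComp K I u v) :
    inComp K I v u := by
  induction h with
  | refl => exact .refl
  | tail _ hab ih =>
    obtain ⟨i, hi, e⟩ := hab
    exact .head ⟨i, hi, e.symm⟩ ih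

theorem inComp.mono {K : PreGraph} {I J : Set ℕ} (hIJ : I ⊆ J) {u v : K.V} (h : inComp K I u v) :
    inComp K J u v :=
  Relation.ReflTransGen.mono (fun _ _ ⟨i, hi, e⟩ => ⟨i, hIJ hi, e⟩) _ _ h

namespace PreGraph

variable {K : PreGraph}

/-- The height of the weight of a vertex. -/
noncomputable def rank (K : PreGraph) (v : K.V) : ℤ :=
  4 * ((K.h 1 v : ℤ) - K.t 1 v) + 6 * ((K.h 2 v : ℤ) - K.t 2 v) +
    6 * ((K.h 3 v : ℤ) - K.t 3 v) + 4 * ((K.h 4 v : ℤ) - K.t 4 v)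

theorem rank_F (hK : IsACrystal 4 K) {i : ℕ} (hi : i ∈ Set.Icc 1 4) {u v : K.V}
    (e : K.F i u = some v) : K.rank u = K.rank v + 2 := by
  have ax := crys_ax hK
  have near (j : ℕ) (hj : j ∈ Set.Icc 1 4) (hn : Neighb i j) := ax.near i hi j hj hn u v e
  have far (j : ℕ) (hj : j ∈ Set.Icc 1 4) (hn : Far i j) := ax.far i hi j hj hn u v e
  have e1 := ax.φF i hi u v e
  have e2 := ax.εF i hi u v e
  simp only [rank, Set.mem_Icc, Neighb, Far] at *
  obtain ⟨h1, h2⟩ := hi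
  interval_cases i
  · have := near 2 (by omega) (by omega)
    have := far 3 (by omega) (by omega)
    have := far 4 (by omega) (by omega)
    omega
  · have := near 1 (by omega) (by omega)
    have := near 3 (by omega) (by omega)
    have := far 4 (by omega) (by omega)
    omega
  · have := near 2 (by omega) (by omega)
    have := near 4 (by omega) (by omega)
    have := far 1 (by omega) (by omega)
    omega
  · have := near 3 (by omega) (by omega)
    have := far 1 (by omega) (by omega)
    have := far 2 (by omega) (by omega)
    omega

theorem wf_E (hK : IsACrystal 4 K) {I : Set ℕ} (hI : I ⊆ Set.Icc 1 4) :
    WellFounded fun a b => ∃ i ∈ I, K.crys.E i b = some a := by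
  have : Finite K.V := hK.1.1
  have w : WellFounded fun a b : K.V => K.rank b < K.rank a := by
    have : IsTrans K.V fun a b => K.rank b < K.rank a := ⟨fun a b c h1 h2 => h2.trans h1⟩
    have : Std.Irrefl fun a b : K.V => K.rank b < K.rank a := ⟨fun a => lt_irrefl _⟩
    exact Finite.wellFounded_of_trans_of_irrefl _
  refine Subrelation.wf ?_ w
  rintro a b ⟨i, hi, e⟩
  have := rank_F hK (hI hi) ((Finv_eq_iff hK.1).1 e)
  omega

theorem isTop_iff (hK : IsACrystal 4 K) {I : Set ℕ} {s : K.V} :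
    K.crys.IsTop I s ↔ ∀ i ∈ I, ∀ u, K.F i u ≠ some s := by
  refine forall₂_congr fun i hi => ?_
  constructor
  · intro h u e
    have := t_eq hK.1 e
    dsimp only at h
    omega
  · intro h
    by_contra h0
    dsimp only at h0
    obtain ⟨v, hv⟩ := (le_t_iff hK.1).1 (show 1 ≤ K.t i s by omega)
    rw [optIter_one] at hv
    exact h v hv

theorem inComp_of_connected (hK : IsACrystal 4 K) (u v : K.V) : inComp K (Set.Icc 1 4) u v := by
  refine Relation.ReflTransGen.mono ?_ _ _ (hK.2.1 u v)
  rintro a b ⟨i, e⟩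
  refine ⟨i, ?_, e⟩
  by_contra hi
  have := hK.1.2.1 i hi
  simp [this] at e

end PreGraph

namespace Crys

variable {X Y : Crys} {C : Set ℕ} {s : X.V} {m : Y.V}

/-- The same strings of operators act on related vertices. -/
theorem Rel.applyStr (hX : X.Ax C) (hY : Y.Ax C) (hM : ∀ n, Rel.Matched X Y C s m n)
    {L : List ℕ} (hL : ∀ i ∈ L, i ∈ C) {n : ℕ} {u v : X.V} {w : Y.V} (h : Rel X Y C s m n u w)
    (e : applyStr X.toPreGraph L u = some v) :
    ∃ x, _root_.applyStr Y.toPreGraph L w = some x ∧ Rel X Y C s m (n + L.length) v x := by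
  induction L generalizing n u w with
  | nil =>
    simp only [_root_.applyStr, Option.some.injEq] at e
    subst e
    exact ⟨w, rfl, h⟩
  | cons i L ih =>
    rw [_root_.applyStr, Option.bind_eq_some_iff] at e
    obtain ⟨u', e1, e2⟩ := e
    obtain ⟨w', e3, h'⟩ := h.lower hX hY (hM n) (hL i (by simp)) e1
    obtain ⟨x, e4, h''⟩ := ih (fun j hj => hL j (by simp [hj])) h' e2
    refine ⟨x, by rw [_root_.applyStr, e3, Option.bind_some, e4], ?_⟩
    rwa [List.length_cons, add_comm L.length, ← add_assoc]

end Crys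

namespace tab

theorem φ_mk (i : ℕ) (r₁ r₂ r₃ r₄ : Row) : tab.φ i (mk r₁ r₂ r₃ r₄) =
    r₄.cnt i + (r₃.cnt i - r₄.cnt (i + 1)) +
      (r₂.cnt i - (r₃.cnt (i + 1) + (r₄.cnt (i + 1) - r₃.cnt i))) +
      (r₁.cnt i - (r₂.cnt (i + 1) + (r₃.cnt (i + 1) + (r₄.cnt (i + 1) - r₃.cnt i) - r₂.cnt i))) :=
  rfl

theorem ε_mk (i : ℕ) (r₁ r₂ r₃ r₄ : Row) : tab.ε i (mk r₁ r₂ r₃ r₄) =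
    r₁.cnt (i + 1) + (r₂.cnt (i + 1) + (r₃.cnt (i + 1) + (r₄.cnt (i + 1) - r₃.cnt i) - r₂.cnt i) -
      r₁.cnt i) :=
  rfl

/-- The highest weight tableau. -/
def top (c : ℕ → ℕ) : tab.V :=
  mk ⟨c 1 + c 2 + c 3 + c 4, 0, 0, 0, 0⟩ ⟨0, c 2 + c 3 + c 4, 0, 0, 0⟩ ⟨0, 0, c 3 + c 4, 0, 0⟩
    ⟨0, 0, 0, c 4, 0⟩

end tab

/-- The hypotheses on a crystal with a chosen source and parameter. -/
structure Based (K : PreGraph) (s : K.V) (c : ℕ → ℕ) : Prop where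
  crystal : IsACrystal 4 K
  source : IsSource K s
  param : ∀ i, 1 ≤ i → i ≤ 4 → K.h i s = c i

/-- The vertex `v` is represented by the tableau `t`. -/
def TabRep (K : PreGraph) (s : K.V) (c : ℕ → ℕ) (v : K.V) (t : tab.V) : Prop :=
  ∃ n, Crys.Rel K.crys tab (Set.Icc 1 4) s (tab.top c) n v t

namespace Based

variable {K : PreGraph} {s : K.V} {c : ℕ → ℕ}

theorem ax (b : Based K s c) : K.crys.Ax (Set.Icc 1 4) := PreGraph.crys_ax b.crystal

theorem top (b : Based K s c) : K.crys.IsTop (Set.Icc 1 4) s :=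
  (PreGraph.isTop_iff b.crystal).2 fun i _ u => b.source i u

theorem rel (b : Based K s c) (n : ℕ) :
    Crys.Rel.Matched K.crys tab (Set.Icc 1 4) s (tab.top c) n ∧
    Crys.Rel.Raises K.crys tab (Set.Icc 1 4) s (tab.top c) n ∧
    Crys.Rel.Raises tab K.crys (Set.Icc 1 4) (tab.top c) s n := by
  refine Crys.Rel.main b.ax tab_ax b.top ?_ ?_ n
  · rintro i ⟨h1, h2⟩
    rw [tab.top, tab.ε_mk]
    interval_cases i <;> simp [Row.cnt]
  · rintro i ⟨h1, h2⟩
    have := b.param i h1 h2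
    rw [tab.top, tab.φ_mk]
    interval_cases i <;> simp [Row.cnt, this] <;> omega

theorem rep_base : TabRep K s c s (tab.top c) := ⟨0, .base⟩

theorem rep_match (b : Based K s c) {v : K.V} {t : tab.V} (h : TabRep K s c v t) {i : ℕ}
    (hi : i ∈ Set.Icc 1 4) : K.h i v = tab.φ i t ∧ K.t i v = tab.ε i t := by
  obtain ⟨n, h⟩ := h
  exact (b.rel n).1 v t h i hi

theorem rep_F (b : Based K s c) {v v' : K.V} {t : tab.V} (h : TabRep K s c v t) {i : ℕ}
    (hi : i ∈ Set.Icc 1 4) (e : K.F i v = some v') :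
    ∃ t', tab.F i t = some t' ∧ TabRep K s c v' t' := by
  obtain ⟨n, h⟩ := h
  obtain ⟨x, hx, r⟩ := h.lower b.ax tab_ax (b.rel n).1 hi e
  exact ⟨x, hx, _, r⟩

theorem rep_applyStr (b : Based K s c) {v v' : K.V} {t : tab.V} (h : TabRep K s c v t) {L : List ℕ}
    (hL : ∀ i ∈ L, i ∈ Set.Icc 1 4) (e : applyStr K L v = some v') :
    ∃ t', applyStr tab.toPreGraph L t = some t' ∧ TabRep K s c v' t' := by
  obtain ⟨n, h⟩ := h
  obtain ⟨x, hx, r⟩ := h.applyStr b.ax tab_ax (fun n => (b.rel n).1) hL e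
  exact ⟨x, hx, _, r⟩

theorem rep_applyStr' (b : Based K s c) {v : K.V} {t t' : tab.V} (h : TabRep K s c v t) {L : List ℕ}
    (hL : ∀ i ∈ L, i ∈ Set.Icc 1 4) (e : applyStr tab.toPreGraph L t = some t') :
    ∃ v', applyStr K L v = some v' ∧ TabRep K s c v' t' := by
  obtain ⟨n, h⟩ := h
  obtain ⟨x, hx, r⟩ := h.symm.applyStr tab_ax b.ax (fun n => (b.rel n).1.symm) hL e
  exact ⟨x, hx, _, r.symm⟩

theorem rank_rel (b : Based K s c) {n : ℕ} {v : K.crys.V} {t : tab.V}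
    (h : Crys.Rel K.crys tab (Set.Icc 1 4) s (tab.top c) n v t) : K.rank v + 2 * n = K.rank s := by
  induction h with
  | base => simp
  | step _ hi e _ ih =>
    have := PreGraph.rank_F b.crystal hi e
    push_cast
    omega

theorem rep_fun (b : Based K s c) {v : K.V} {t t' : tab.V} (h : TabRep K s c v t)
    (h' : TabRep K s c v t') : t = t' := by
  obtain ⟨n, h⟩ := h
  obtain ⟨k, h'⟩ := h'
  obtain rfl : n = k := by
    have := b.rank_rel h
    have := b.rank_rel h'
    omega
  exact h.functional tab_ax (fun n => (b.rel n).2.1) b.ax h'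

theorem rep_inj (b : Based K s c) {v v' : K.V} {t : tab.V} (h : TabRep K s c v t)
    (h' : TabRep K s c v' t) : v = v' := by
  have key : K.rank v = K.rank v' := by
    have m (i : ℕ) (hi : i ∈ Set.Icc 1 4) := b.rep_match h hi
    have m' (i : ℕ) (hi : i ∈ Set.Icc 1 4) := b.rep_match h' hi
    have h1 : 1 ∈ Set.Icc 1 4 := by simp
    have h2 : 2 ∈ Set.Icc 1 4 := by simp
    have h3 : 3 ∈ Set.Icc 1 4 := by simp
    have h4 : 4 ∈ Set.Icc 1 4 := by simp
    rw [PreGraph.rank, PreGraph.rank, (m 1 h1).1, (m 1 h1).2, (m 2 h2).1, (m 2 h2).2, (m 3 h3).1,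
      (m 3 h3).2, (m 4 h4).1, (m 4 h4).2, (m' 1 h1).1, (m' 1 h1).2, (m' 2 h2).1, (m' 2 h2).2,
      (m' 3 h3).1, (m' 3 h3).2, (m' 4 h4).1, (m' 4 h4).2]
  obtain ⟨n, h⟩ := h
  obtain ⟨k, h'⟩ := h'
  obtain rfl : n = k := by
    have := b.rank_rel h
    have := b.rank_rel h'
    omega
  exact h.symm.functional b.ax (fun n => (b.rel n).2.2) tab_ax h'.symm

theorem rep_total (b : Based K s c) (v : K.V) : ∃ t, TabRep K s c v t := by
  have h := b.ax.up_top (PreGraph.wf_E b.crystal subset_rfl) b.top .refl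
    (PreGraph.inComp_of_connected b.crystal s v)
  induction h using Relation.ReflTransGen.head_induction_on with
  | refl => exact ⟨_, rep_base⟩
  | head hab _ ih =>
    obtain ⟨i, hi, e⟩ := hab
    obtain ⟨t, ht⟩ := ih
    obtain ⟨t', -, ht'⟩ := b.rep_F ht hi ((b.ax.FE i hi _ _).2 e)
    exact ⟨t', ht'⟩

end Based

/-! ### Explicit strings acting on tableaux -/

theorem applyStr_cons {K : PreGraph} {i : ℕ} {L : List ℕ} {u v w : K.V} (e : K.F i u = some v)
    (h : applyStr K L v = some w) : applyStr K (i :: L) u = some w := by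
  rw [applyStr, e, Option.bind_some, h]

theorem applyStr_nil {K : PreGraph} {u v : K.V} (e : u = v) : applyStr K [] u = some v := by
  rw [applyStr, e]

theorem applyStr_append {K : PreGraph} (L L' : List ℕ) (u : K.V) :
    applyStr K (L ++ L') u = (applyStr K L u).bind (applyStr K L') := by
  induction L generalizing u with
  | nil => rfl
  | cons i L ih =>
    simp only [List.cons_append, applyStr, Option.bind_assoc]
    exact congrArg _ (funext ih)

theorem applyStr_append_some {K : PreGraph} {L L' : List ℕ} {u v w : K.V}
    (h : applyStr K L u = some v) (h' : applyStr K L' v = some w) :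
    applyStr K (L ++ L') u = some w := by
  rw [applyStr_append, h, Option.bind_some, h']

theorem applyStr_replicate {K : PreGraph} {L : List ℕ} (f : ℕ → K.V) (n : ℕ)
    (h : ∀ k < n, applyStr K L (f k) = some (f (k + 1))) :
    applyStr K (List.replicate n L).flatten (f 0) = some (f n) := by
  induction n with
  | zero => rfl
  | succ n ih =>
    rw [List.replicate_succ', List.flatten_append]
    refine applyStr_append_some (ih fun k hk => h k (by omega)) ?_
    simpa using h n (by omega)

namespace Row

/-- The row in which a letter `i` has been replaced by `i + 1`. -/
def inc (r : Row) : ℕ → Row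
  | 1 => ⟨r.n₁ - 1, r.n₂ + 1, r.n₃, r.n₄, r.n₅⟩
  | 2 => ⟨r.n₁, r.n₂ - 1, r.n₃ + 1, r.n₄, r.n₅⟩
  | 3 => ⟨r.n₁, r.n₂, r.n₃ - 1, r.n₄ + 1, r.n₅⟩
  | 4 => ⟨r.n₁, r.n₂, r.n₃, r.n₄ - 1, r.n₅ + 1⟩
  | _ => r

theorem low_eq_inc {r : Row} {i : ℕ} (hi : i ∈ Set.Icc 1 4) (h : 0 < r.cnt i) :
    r.low i = some (r.inc i) := by
  obtain ⟨h1, h2⟩ := hi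
  interval_cases i <;> exact if_pos h

end Row

namespace tab

variable {i : ℕ} {r₁ r₂ r₃ r₄ s₁ s₂ s₃ s₄ : Row}

theorem F_row₁ (hi : i ∈ Set.Icc 1 4)
    (h : r₂.cnt (i + 1) + (r₃.cnt (i + 1) + (r₄.cnt (i + 1) - r₃.cnt i) - r₂.cnt i) < r₁.cnt i) :
    tab.F i (mk r₁ r₂ r₃ r₄) = some (mk (r₁.inc i) r₂ r₃ r₄) :=
  F_iff.2 (Or.inl ⟨h, Row.low_eq_inc hi (by omega), rfl, rfl, rfl⟩)

theorem F_row₂ (hi : i ∈ Set.Icc 1 4)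
    (h : r₁.cnt i ≤ r₂.cnt (i + 1) + (r₃.cnt (i + 1) + (r₄.cnt (i + 1) - r₃.cnt i) - r₂.cnt i) ∧
      r₃.cnt (i + 1) + (r₄.cnt (i + 1) - r₃.cnt i) < r₂.cnt i) :
    tab.F i (mk r₁ r₂ r₃ r₄) = some (mk r₁ (r₂.inc i) r₃ r₄) :=
  F_iff.2 (Or.inr (Or.inl ⟨h.1, h.2, rfl, Row.low_eq_inc hi (by omega), rfl, rfl⟩))

theorem F_row₃ (hi : i ∈ Set.Icc 1 4)
    (h : r₁.cnt i ≤ r₂.cnt (i + 1) + (r₃.cnt (i + 1) + (r₄.cnt (i + 1) - r₃.cnt i) - r₂.cnt i) ∧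
      r₂.cnt i ≤ r₃.cnt (i + 1) + (r₄.cnt (i + 1) - r₃.cnt i) ∧ r₄.cnt (i + 1) < r₃.cnt i) :
    tab.F i (mk r₁ r₂ r₃ r₄) = some (mk r₁ r₂ (r₃.inc i) r₄) :=
  F_iff.2 (Or.inr (Or.inr (Or.inl
    ⟨h.1, h.2.1, h.2.2, rfl, rfl, Row.low_eq_inc hi (by omega), rfl⟩)))

theorem F_row₄ (hi : i ∈ Set.Icc 1 4)
    (h : r₁.cnt i ≤ r₂.cnt (i + 1) + (r₃.cnt (i + 1) + (r₄.cnt (i + 1) - r₃.cnt i) - r₂.cnt i) ∧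
      r₂.cnt i ≤ r₃.cnt (i + 1) + (r₄.cnt (i + 1) - r₃.cnt i) ∧ r₃.cnt i ≤ r₄.cnt (i + 1) ∧
      0 < r₄.cnt i) :
    tab.F i (mk r₁ r₂ r₃ r₄) = some (mk r₁ r₂ r₃ (r₄.inc i)) :=
  F_iff.2 (Or.inr (Or.inr (Or.inr
    ⟨h.1, h.2.1, h.2.2.1, rfl, rfl, rfl, Row.low_eq_inc hi h.2.2.2⟩)))

theorem mk_eq_iff : mk r₁ r₂ r₃ r₄ = mk s₁ s₂ s₃ s₄ ↔
    (r₁ = s₁ ∧ r₂ = s₂ ∧ r₃ = s₃ ∧ r₄ = s₄) := by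
  refine ⟨fun h => ?_, fun ⟨h1, h2, h3, h4⟩ => by rw [h1, h2, h3, h4]⟩
  have h1 : r₁ = s₁ := congrArg Prod.fst h
  have h' : ((r₂, r₃, r₄) : Row × Row × Row) = (s₂, s₃, s₄) := congrArg Prod.snd h
  simpa [h1] using h'

theorem mk_congr (h₁ : r₁ = s₁) (h₂ : r₂ = s₂) (h₃ : r₃ = s₃) (h₄ : r₄ = s₄) :
    mk r₁ r₂ r₃ r₄ = mk s₁ s₂ s₃ s₄ := mk_eq_iff.2 ⟨h₁, h₂, h₃, h₄⟩

theorem mem_one : 1 ∈ Set.Icc 1 4 := by simp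

theorem mem_two : 2 ∈ Set.Icc 1 4 := by simp

theorem mem_three : 3 ∈ Set.Icc 1 4 := by simp

theorem mem_four : 4 ∈ Set.Icc 1 4 := by simp

/-- The tableau of the principal vertex with coordinates `a`. -/
def prin (c₁ c₂ c₃ c₄ a₁ a₂ a₃ a₄ : ℕ) : tab.V :=
  mk ⟨(c₁ - a₁) + (c₂ - a₂) + (c₃ - a₃) + (c₄ - a₄), a₄, a₃, a₂, a₁⟩
    ⟨0, (c₂ - a₂) + (c₃ - a₃) + (c₄ - a₄), a₄, a₃, a₂⟩
    ⟨0, 0, (c₃ - a₃) + (c₄ - a₄), a₄, a₃⟩ ⟨0, 0, 0, c₄ - a₄, a₄⟩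

variable {c₁ c₂ c₃ c₄ a₁ a₂ a₃ a₄ : ℕ}

theorem prin_step₁ (h : a₁ < c₁) : applyStr tab.toPreGraph [1, 2, 3, 4]
    (prin c₁ c₂ c₃ c₄ a₁ 0 0 0) = some (prin c₁ c₂ c₃ c₄ (a₁ + 1) 0 0 0) := by
  refine applyStr_cons (F_row₁ mem_one ?_) (applyStr_cons (F_row₁ mem_two ?_)
    (applyStr_cons (F_row₁ mem_three ?_) (applyStr_cons (F_row₁ mem_four ?_)
      (applyStr_nil (mk_congr ?_ ?_ ?_ ?_))))) <;>
  simp only [Row.inc, Row.cnt, Row.mk.injEq, and_true, true_and] <;> omega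

theorem prin_step₂ (h : a₂ < c₂) : applyStr tab.toPreGraph [2, 1, 3, 2, 4, 3]
    (prin c₁ c₂ c₃ c₄ a₁ a₂ 0 0) = some (prin c₁ c₂ c₃ c₄ a₁ (a₂ + 1) 0 0) := by
  refine applyStr_cons (F_row₂ mem_two ?_) (applyStr_cons (F_row₁ mem_one ?_)
    (applyStr_cons (F_row₂ mem_three ?_) (applyStr_cons (F_row₁ mem_two ?_)
    (applyStr_cons (F_row₂ mem_four ?_) (applyStr_cons (F_row₁ mem_three ?_)
    (applyStr_nil (mk_congr ?_ ?_ ?_ ?_))))))) <;>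
  simp only [Row.inc, Row.cnt, Row.mk.injEq, and_true, true_and] <;> omega

theorem prin_step₃ (h : a₃ < c₃) : applyStr tab.toPreGraph [3, 2, 1, 4, 3, 2]
    (prin c₁ c₂ c₃ c₄ a₁ a₂ a₃ 0) = some (prin c₁ c₂ c₃ c₄ a₁ a₂ (a₃ + 1) 0) := by
  refine applyStr_cons (F_row₃ mem_three ?_) (applyStr_cons (F_row₂ mem_two ?_)
    (applyStr_cons (F_row₁ mem_one ?_) (applyStr_cons (F_row₃ mem_four ?_)
    (applyStr_cons (F_row₂ mem_three ?_) (applyStr_cons (F_row₁ mem_two ?_)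
    (applyStr_nil (mk_congr ?_ ?_ ?_ ?_))))))) <;>
  simp only [Row.inc, Row.cnt, Row.mk.injEq, and_true, true_and] <;> omega

theorem prin_step₄ (h : a₄ < c₄) : applyStr tab.toPreGraph [4, 3, 2, 1]
    (prin c₁ c₂ c₃ c₄ a₁ a₂ a₃ a₄) = some (prin c₁ c₂ c₃ c₄ a₁ a₂ a₃ (a₄ + 1)) := by
  refine applyStr_cons (F_row₄ mem_four ?_) (applyStr_cons (F_row₃ mem_three ?_)
    (applyStr_cons (F_row₂ mem_two ?_) (applyStr_cons (F_row₁ mem_one ?_)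
      (applyStr_nil (mk_congr ?_ ?_ ?_ ?_))))) <;>
  simp only [Row.inc, Row.cnt, Row.mk.injEq, and_true, true_and] <;> omega

theorem prinStr_four (a : ℕ → ℕ) : prinStr 0 4 a =
    ((List.replicate (a 1) [1, 2, 3, 4]).flatten ++
      (List.replicate (a 2) [2, 1, 3, 2, 4, 3]).flatten) ++
    ((List.replicate (a 3) [3, 2, 1, 4, 3, 2]).flatten ++
      (List.replicate (a 4) [4, 3, 2, 1]).flatten) := by
  simp [prinStr, SStr, wStr, List.range_succ]

theorem prinStr_three (a : ℕ → ℕ) : prinStr 0 3 a =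
    ((List.replicate (a 1) [1, 2, 3]).flatten ++
      (List.replicate (a 2) [2, 1, 3, 2]).flatten) ++
      (List.replicate (a 3) [3, 2, 1]).flatten := by
  simp [prinStr, SStr, wStr, List.range_succ]

theorem applyStr_prinStr_four {c a : ℕ → ℕ} (h : ∀ i, 1 ≤ i → i ≤ 4 → a i ≤ c i) :
    applyStr tab.toPreGraph (prinStr 0 4 a) (top c) =
      some (prin (c 1) (c 2) (c 3) (c 4) (a 1) (a 2) (a 3) (a 4)) := by
  have h1 := h 1 (by omega) (by omega)
  have h2 := h 2 (by omega) (by omega)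
  have h3 := h 3 (by omega) (by omega)
  have h4 := h 4 (by omega) (by omega)
  rw [prinStr_four]
  exact applyStr_append_some
    (applyStr_append_some
      (applyStr_replicate (fun k => prin (c 1) (c 2) (c 3) (c 4) k 0 0 0) _
        fun k hk => prin_step₁ (by omega))
      (applyStr_replicate (fun k => prin (c 1) (c 2) (c 3) (c 4) (a 1) k 0 0) _
        fun k hk => prin_step₂ (by omega)))
    (applyStr_append_some
      (applyStr_replicate (fun k => prin (c 1) (c 2) (c 3) (c 4) (a 1) (a 2) k 0) _
        fun k hk => prin_step₃ (by omega))
      (applyStr_replicate (fun k => prin (c 1) (c 2) (c 3) (c 4) (a 1) (a 2) (a 3) k) _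
        fun k hk => prin_step₄ (by omega)))

/-- The tableau of a principal vertex of an upper subcrystal with parameter `d`. -/
def upper (d₁ d₂ d₃ g a₁ a₂ a₃ a₄ p₁ p₂ p₃ : ℕ) : tab.V :=
  mk ⟨(d₁ - p₁) + (d₂ - p₂) + (d₃ - p₃) + g, p₃, p₂, p₁, a₁⟩
    ⟨0, (d₂ - p₂) + (d₃ - p₃) + g, p₃, p₂, a₂⟩ ⟨0, 0, (d₃ - p₃) + g, p₃, a₃⟩ ⟨0, 0, 0, g, a₄⟩

variable {d₁ d₂ d₃ g p₁ p₂ p₃ : ℕ}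

theorem upper_step₁ (h : p₁ < d₁) : applyStr tab.toPreGraph [1, 2, 3]
    (upper d₁ d₂ d₃ g a₁ a₂ a₃ a₄ p₁ 0 0) = some (upper d₁ d₂ d₃ g a₁ a₂ a₃ a₄ (p₁ + 1) 0 0) := by
  refine applyStr_cons (F_row₁ mem_one ?_) (applyStr_cons (F_row₁ mem_two ?_)
    (applyStr_cons (F_row₁ mem_three ?_) (applyStr_nil (mk_congr ?_ ?_ ?_ ?_)))) <;>
  simp only [Row.inc, Row.cnt, Row.mk.injEq, and_true, true_and] <;> omega

theorem upper_step₂ (h : p₂ < d₂) : applyStr tab.toPreGraph [2, 1, 3, 2]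
    (upper d₁ d₂ d₃ g a₁ a₂ a₃ a₄ p₁ p₂ 0) =
      some (upper d₁ d₂ d₃ g a₁ a₂ a₃ a₄ p₁ (p₂ + 1) 0) := by
  refine applyStr_cons (F_row₂ mem_two ?_) (applyStr_cons (F_row₁ mem_one ?_)
    (applyStr_cons (F_row₂ mem_three ?_) (applyStr_cons (F_row₁ mem_two ?_)
    (applyStr_nil (mk_congr ?_ ?_ ?_ ?_))))) <;>
  simp only [Row.inc, Row.cnt, Row.mk.injEq, and_true, true_and] <;> omega

theorem upper_step₃ (h : p₃ < d₃) : applyStr tab.toPreGraph [3, 2, 1]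
    (upper d₁ d₂ d₃ g a₁ a₂ a₃ a₄ p₁ p₂ p₃) =
      some (upper d₁ d₂ d₃ g a₁ a₂ a₃ a₄ p₁ p₂ (p₃ + 1)) := by
  refine applyStr_cons (F_row₃ mem_three ?_) (applyStr_cons (F_row₂ mem_two ?_)
    (applyStr_cons (F_row₁ mem_one ?_) (applyStr_nil (mk_congr ?_ ?_ ?_ ?_)))) <;>
  simp only [Row.inc, Row.cnt, Row.mk.injEq, and_true, true_and] <;> omega

theorem applyStr_prinStr_three {p : ℕ → ℕ} (h1 : p 1 ≤ d₁) (h2 : p 2 ≤ d₂) (h3 : p 3 ≤ d₃) :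
    applyStr tab.toPreGraph (prinStr 0 3 p) (upper d₁ d₂ d₃ g a₁ a₂ a₃ a₄ 0 0 0) =
      some (upper d₁ d₂ d₃ g a₁ a₂ a₃ a₄ (p 1) (p 2) (p 3)) := by
  rw [prinStr_three]
  exact applyStr_append_some
    (applyStr_append_some
      (applyStr_replicate (fun k => upper d₁ d₂ d₃ g a₁ a₂ a₃ a₄ k 0 0) _
        fun k hk => upper_step₁ (by omega))
      (applyStr_replicate (fun k => upper d₁ d₂ d₃ g a₁ a₂ a₃ a₄ (p 1) k 0) _
        fun k hk => upper_step₂ (by omega)))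
    (applyStr_replicate (fun k => upper d₁ d₂ d₃ g a₁ a₂ a₃ a₄ (p 1) (p 2) k) _
      fun k hk => upper_step₃ (by omega))

/-- Tableaux interpolating between the source of a middle subcrystal (for `k₁ = k₂ = 0`) and its
vertex in the principal lattice of the upper subcrystal (for `k₁ = p₁`, `k₂ = p₂`). -/
def middle (d₁ d₂ d₃ g a₁ a₂ a₃ a₄ p₁ p₂ p₃ k₁ k₂ : ℕ) : tab.V :=
  mk ⟨(d₁ - p₁) + (d₂ - p₂) + (d₃ - p₃) + g, p₁ + p₂ + p₃ - k₁ - k₂, k₂, k₁, a₁⟩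
    ⟨0, (d₂ - p₂) + (d₃ - p₃) + g, p₂ + p₃ - k₂, k₂, a₂⟩ ⟨0, 0, (d₃ - p₃) + g, p₃, a₃⟩
    ⟨0, 0, 0, g, a₄⟩

variable {k₁ k₂ : ℕ}

theorem middle_step₁ (h : k₁ < p₁) : applyStr tab.toPreGraph [2, 3]
    (middle d₁ d₂ d₃ g a₁ a₂ a₃ a₄ p₁ p₂ p₃ k₁ 0) =
      some (middle d₁ d₂ d₃ g a₁ a₂ a₃ a₄ p₁ p₂ p₃ (k₁ + 1) 0) := by
  refine applyStr_cons (F_row₁ mem_two ?_) (applyStr_cons (F_row₁ mem_three ?_)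
    (applyStr_nil (mk_congr ?_ ?_ ?_ ?_))) <;>
  simp only [Row.inc, Row.cnt, Row.mk.injEq, and_true, true_and] <;> omega

theorem middle_step₂ (h : k₂ < p₂) : applyStr tab.toPreGraph [3, 2]
    (middle d₁ d₂ d₃ g a₁ a₂ a₃ a₄ p₁ p₂ p₃ p₁ k₂) =
      some (middle d₁ d₂ d₃ g a₁ a₂ a₃ a₄ p₁ p₂ p₃ p₁ (k₂ + 1)) := by
  refine applyStr_cons (F_row₂ mem_three ?_) (applyStr_cons (F_row₁ mem_two ?_)
    (applyStr_nil (mk_congr ?_ ?_ ?_ ?_))) <;>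
  simp only [Row.inc, Row.cnt, Row.mk.injEq, and_true, true_and] <;> omega

theorem applyStr_middle : applyStr tab.toPreGraph
    ((List.replicate p₁ [2, 3]).flatten ++ (List.replicate p₂ [3, 2]).flatten)
    (middle d₁ d₂ d₃ g a₁ a₂ a₃ a₄ p₁ p₂ p₃ 0 0) =
      some (upper d₁ d₂ d₃ g a₁ a₂ a₃ a₄ p₁ p₂ p₃) := by
  have e : upper d₁ d₂ d₃ g a₁ a₂ a₃ a₄ p₁ p₂ p₃ =
      middle d₁ d₂ d₃ g a₁ a₂ a₃ a₄ p₁ p₂ p₃ p₁ p₂ := by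
    refine mk_congr ?_ ?_ ?_ ?_ <;> simp only [Row.mk.injEq, and_true, true_and] <;> omega
  rw [e]
  exact applyStr_append_some
    (applyStr_replicate (fun k => middle d₁ d₂ d₃ g a₁ a₂ a₃ a₄ p₁ p₂ p₃ k 0) _
      fun k hk => middle_step₁ (by omega))
    (applyStr_replicate (fun k => middle d₁ d₂ d₃ g a₁ a₂ a₃ a₄ p₁ p₂ p₃ p₁ k) _
      fun k hk => middle_step₂ (by omega))

end tab

/-! ### Tableaux of self-complementary vertices -/

/-- The linear relations between the rows of the tableau of a self-complementary vertex with
description `(a, p + y, x - y, ρ)` in the crystal with parameter `(c₁, c₂, c₂, c₁)`, in terms of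
`A = min (2 ρ) (2 p + x)`, `B = min ρ p` and `D = min ρ (p + x)`. -/
structure SymRows (c₁ c₂ a p x y ρ A B D : ℕ) (r₁ r₂ r₃ r₄ : Row) : Prop where
  row₁ : r₁.n₁ + (2 * p + x + y + a) + a = 2 * c₁ + 2 * c₂ ∧ r₁.n₂ + A = 2 * p + x + y + a ∧
    r₁.n₃ + D = A ∧ r₁.n₄ = D ∧ r₁.n₅ = a
  row₂ : r₂.n₁ = 0 ∧ r₂.n₂ + r₂.n₃ + r₂.n₄ + (p + y) = c₁ + 2 * c₂ ∧
    r₂.n₃ + A + B = p + a + y + ρ + D ∧ r₂.n₄ + D = B + ρ ∧ r₂.n₅ = p + y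
  row₃ : r₃.n₁ = 0 ∧ r₃.n₂ = 0 ∧ r₃.n₃ + r₃.n₄ + p = c₁ + c₂ ∧ r₃.n₄ + B = a + y + ρ ∧ r₃.n₅ = p
  row₄ : r₄.n₁ = 0 ∧ r₄.n₂ = 0 ∧ r₄.n₃ = 0 ∧ r₄.n₄ + (a + x) = c₁ ∧ r₄.n₅ = a + x

/-- The tableau of the self-complementary vertex with description `(a, p + y, x - y, ρ)`. -/
structure IsSymTab (c₁ c₂ a p x y ρ : ℕ) (t : tab.V) : Prop where
  split : x = 0 ∨ y = 0
  le₂ : p + y ≤ c₂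
  le₁ : a + x ≤ c₁
  le_ρ : ρ + y ≤ c₂ + x
  rows : ∃ r₁ r₂ r₃ r₄, t = tab.mk r₁ r₂ r₃ r₄ ∧
    SymRows c₁ c₂ a p x y ρ (min (2 * ρ) (2 * p + x)) (min ρ p) (min ρ (p + x)) r₁ r₂ r₃ r₄

namespace IsSymTab

open tab

variable {c₁ c₂ a p x y ρ : ℕ} {t : tab.V}

theorem exists_of_valid (h₁ : x = 0 ∨ y = 0) (h₂ : p + y ≤ c₂) (h₃ : a + x ≤ c₁)
    (h₄ : ρ + y ≤ c₂ + x) : ∃ t, IsSymTab c₁ c₂ a p x y ρ t := by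
  refine ⟨_, h₁, h₂, h₃, h₄, ⟨2 * c₁ + 2 * c₂ - (2 * p + x + y + a + a),
    2 * p + x + y + a - min (2 * ρ) (2 * p + x), min (2 * ρ) (2 * p + x) - min ρ (p + x),
    min ρ (p + x), a⟩,
    ⟨0, c₁ + 2 * c₂ + min (2 * ρ) (2 * p + x) - (2 * p + 2 * y + a + 2 * ρ),
      p + a + y + ρ + min ρ (p + x) - (min (2 * ρ) (2 * p + x) + min ρ p),
      min ρ p + ρ - min ρ (p + x), p + y⟩,
    ⟨0, 0, c₁ + c₂ + min ρ p - (p + a + y + ρ), a + y + ρ - min ρ p, p⟩,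
    ⟨0, 0, 0, c₁ - (a + x), a + x⟩, rfl, ?_⟩
  constructor <;> dsimp only <;> and_intros <;> omega

theorem unique {t' : tab.V} (h : IsSymTab c₁ c₂ a p x y ρ t) (h' : IsSymTab c₁ c₂ a p x y ρ t') :
    t = t' := by
  obtain ⟨-, -, -, -, r₁, r₂, r₃, r₄, rfl, h1, h2, h3, h4⟩ := h
  obtain ⟨-, -, -, -, s₁, s₂, s₃, s₄, rfl, h1', h2', h3', h4'⟩ := h'
  generalize min (2 * ρ) (2 * p + x) = A, min ρ p = B, min ρ (p + x) = D at *
  refine mk_congr ?_ ?_ ?_ ?_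
  · clear h2 h3 h4 h2' h3' h4'
    ext <;> omega
  · clear h1 h3 h4 h1' h3' h4'
    ext <;> omega
  · clear h1 h2 h4 h1' h2' h4'
    ext <;> omega
  · clear h1 h2 h3 h1' h2' h3'
    ext <;> omega

theorem param_eq {a' p' x' y' ρ' : ℕ} (h : IsSymTab c₁ c₂ a p x y ρ t)
    (h' : IsSymTab c₁ c₂ a' p' x' y' ρ' t) :
    a = a' ∧ p = p' ∧ x = x' ∧ y = y' ∧ ρ = ρ' := by
  obtain ⟨-, -, -, -, r₁, r₂, r₃, r₄, rfl, h1, h2, h3, h4⟩ := h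
  obtain ⟨-, -, -, -, s₁, s₂, s₃, s₄, e, h1', h2', h3', h4'⟩ := h'
  obtain ⟨rfl, rfl, rfl, rfl⟩ := mk_eq_iff.1 e
  obtain rfl : a = a' := h1.2.2.2.2.symm.trans h1'.2.2.2.2
  obtain rfl : p = p' := h3.2.2.2.2.symm.trans h3'.2.2.2.2
  obtain rfl : y = y' := by have := h2.2.2.2.2.symm.trans h2'.2.2.2.2; omega
  obtain rfl : x = x' := by have := h4.2.2.2.2.symm.trans h4'.2.2.2.2; omega
  refine ⟨rfl, rfl, rfl, rfl, ?_⟩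
  have e₁ := h1.2.2.2.1.symm.trans h1'.2.2.2.1
  have e₂ := h3.2.2.2.1
  have e₃ := h3'.2.2.2.1
  omega

/-- The action of `F₄ F₁` when `2 ρ ≤ 2 p + x` and `y = 0`. -/
theorem step_x (h : IsSymTab c₁ c₂ a p x 0 ρ t) (hρ : 2 * ρ ≤ 2 * p + x) (hx : a + x < c₁) :
    ∃ t', applyStr tab.toPreGraph [1, 4] t = some t' ∧ IsSymTab c₁ c₂ a p (x + 1) 0 ρ t' := by
  obtain ⟨h₁, h₂, h₃, h₄, ⟨u₁, u₂, u₃, u₄, u₅⟩, ⟨v₁, v₂, v₃, v₄, v₅⟩, ⟨w₁, w₂, w₃, w₄, w₅⟩,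
    ⟨z₁, z₂, z₃, z₄, z₅⟩, rfl, h⟩ := h
  have hB : min ρ p ≤ ρ ∧ min ρ p ≤ p := by omega
  rw [min_eq_left hρ, min_eq_left (a := ρ) (b := p + x) (by omega)] at h
  generalize e : min ρ p = B at h hB
  obtain ⟨h1, h2, h3, h4⟩ := h
  dsimp only at h1 h2 h3 h4
  obtain ⟨rfl, h2⟩ := h2
  obtain ⟨rfl, rfl, h3⟩ := h3
  obtain ⟨rfl, rfl, rfl, h4⟩ := h4
  refine ⟨_, applyStr_cons (F_row₁ mem_one ?_) (applyStr_cons (F_row₄ mem_four ?_)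
    (applyStr_nil rfl)), by omega, by omega, by omega, by omega, _, _, _, _, rfl, ?_⟩
  · simp only [Row.cnt, Nat.zero_sub, Nat.sub_zero, Nat.add_zero, Nat.zero_add]
    and_intros <;> omega
  · simp only [Row.inc, Row.cnt, Nat.zero_sub, Nat.sub_zero, Nat.add_zero, Nat.zero_add]
    and_intros <;> omega
  · rw [min_eq_left (by omega), min_eq_left (a := ρ) (b := p + (x + 1)) (by omega), e]
    refine ⟨?_, ?_, ?_, ?_⟩
    · clear h2 h3 h4
      simp only [Row.inc, true_and, and_true]
      and_intros <;> omega
    · clear h1 h3 h4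
      simp only [Row.inc, true_and, and_true]
      and_intros <;> omega
    · clear h1 h2 h4
      simp only [Row.inc, true_and, and_true]
      and_intros <;> omega
    · clear h1 h2 h3
      simp only [Row.inc, true_and, and_true]
      and_intros <;> omega

/-- The action of `F₄ F₁` when `2 ρ ≤ 2 p + x` and `y > 0`. -/
theorem step_p (h : IsSymTab c₁ c₂ a p x (y + 1) ρ t) (hρ : 2 * ρ ≤ 2 * p + x) :
    ∃ t', applyStr tab.toPreGraph [1, 4] t = some t' ∧ IsSymTab c₁ c₂ a (p + 1) x y ρ t' := by
  obtain ⟨h₁, h₂, h₃, h₄, ⟨u₁, u₂, u₃, u₄, u₅⟩, ⟨v₁, v₂, v₃, v₄, v₅⟩, ⟨w₁, w₂, w₃, w₄, w₅⟩,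
    ⟨z₁, z₂, z₃, z₄, z₅⟩, rfl, h⟩ := h
  obtain rfl : x = 0 := by omega
  rw [min_eq_left hρ, min_eq_left (a := ρ) (b := p) (by omega),
    min_eq_left (b := p + 0) (by omega)] at h
  obtain ⟨h1, h2, h3, h4⟩ := h
  dsimp only at h1 h2 h3 h4
  obtain ⟨rfl, h2⟩ := h2
  obtain ⟨rfl, rfl, h3⟩ := h3
  obtain ⟨rfl, rfl, rfl, h4⟩ := h4
  refine ⟨_, applyStr_cons (F_row₁ mem_one ?_) (applyStr_cons (F_row₃ mem_four ?_)
    (applyStr_nil rfl)), by omega, by omega, by omega, by omega, _, _, _, _, rfl, ?_⟩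
  · simp only [Row.cnt, Nat.zero_sub, Nat.sub_zero, Nat.add_zero, Nat.zero_add]
    and_intros <;> omega
  · simp only [Row.inc, Row.cnt, Nat.zero_sub, Nat.sub_zero, Nat.add_zero, Nat.zero_add]
    and_intros <;> omega
  · rw [min_eq_left (by omega), min_eq_left (a := ρ) (b := p + 1) (by omega)]
    refine ⟨?_, ?_, ?_, ?_⟩
    · clear h2 h3 h4
      simp only [Row.inc, true_and, and_true]
      and_intros <;> omega
    · clear h1 h3 h4
      simp only [Row.inc, true_and, and_true]
      and_intros <;> omega
    · clear h1 h2 h4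
      simp only [Row.inc, true_and, and_true]
      and_intros <;> omega
    · clear h1 h2 h3
      simp only [Row.inc, true_and, and_true]
      and_intros <;> omega

/-- The action of `F₄ F₁` when `2 ρ > 2 p + x` and `x > 0`. -/
theorem step_a (h : IsSymTab c₁ c₂ a p (x + 1) y (ρ + 1) t) (hρ : 2 * p + x + 1 < 2 * (ρ + 1)) :
    ∃ t', applyStr tab.toPreGraph [1, 4] t = some t' ∧ IsSymTab c₁ c₂ (a + 1) p x y ρ t' := by
  obtain ⟨h₁, h₂, h₃, h₄, ⟨u₁, u₂, u₃, u₄, u₅⟩, ⟨v₁, v₂, v₃, v₄, v₅⟩, ⟨w₁, w₂, w₃, w₄, w₅⟩,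
    ⟨z₁, z₂, z₃, z₄, z₅⟩, rfl, h⟩ := h
  obtain rfl : y = 0 := by omega
  have hD : min ρ (p + x) ≤ ρ ∧ min ρ (p + x) ≤ p + x ∧ p ≤ min ρ (p + x) ∧
    (ρ ≤ min ρ (p + x) ∨ p + x ≤ min ρ (p + x)) := by omega
  rw [min_eq_right (by omega), min_eq_right (a := ρ + 1) (b := p) (by omega),
    show min (ρ + 1) (p + (x + 1)) = min ρ (p + x) + 1 by omega] at h
  generalize e : min ρ (p + x) = D at h hD
  obtain ⟨h1, h2, h3, h4⟩ := h
  dsimp only at h1 h2 h3 h4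
  obtain ⟨rfl, h2⟩ := h2
  obtain ⟨rfl, rfl, h3⟩ := h3
  obtain ⟨rfl, rfl, rfl, h4⟩ := h4
  refine ⟨_, applyStr_cons (F_row₁ mem_one ?_) (applyStr_cons (F_row₁ mem_four ?_)
    (applyStr_nil rfl)), by omega, by omega, by omega, by omega, _, _, _, _, rfl, ?_⟩
  · simp only [Row.cnt, Nat.zero_sub, Nat.sub_zero, Nat.add_zero, Nat.zero_add]
    and_intros <;> omega
  · simp only [Row.inc, Row.cnt, Nat.zero_sub, Nat.sub_zero, Nat.add_zero, Nat.zero_add]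
    and_intros <;> omega
  · rw [min_eq_right (by omega), min_eq_right (a := ρ) (b := p) (by omega), e]
    refine ⟨?_, ?_, ?_, ?_⟩
    · clear h2 h3 h4
      simp only [Row.inc, true_and, and_true]
      and_intros <;> omega
    · clear h1 h3 h4
      simp only [Row.inc, true_and, and_true]
      and_intros <;> omega
    · clear h1 h2 h4
      simp only [Row.inc, true_and, and_true]
      and_intros <;> omega
    · clear h1 h2 h3
      simp only [Row.inc, true_and, and_true]
      and_intros <;> omega

set_option maxHeartbeats 1000000 in
/-- The action of `F₄ F₁` when `ρ > p` and `x = 0`. -/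
theorem step_y (h : IsSymTab c₁ c₂ a p 0 y (ρ + 1) t) (hρ : p < ρ + 1) :
    ∃ t', applyStr tab.toPreGraph [1, 4] t = some t' ∧ IsSymTab c₁ c₂ a p 0 (y + 1) ρ t' := by
  obtain ⟨h₁, h₂, h₃, h₄, ⟨u₁, u₂, u₃, u₄, u₅⟩, ⟨v₁, v₂, v₃, v₄, v₅⟩, ⟨w₁, w₂, w₃, w₄, w₅⟩,
    ⟨z₁, z₂, z₃, z₄, z₅⟩, rfl, h⟩ := h
  rw [min_eq_right (by omega), Nat.add_zero, Nat.add_zero,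
    min_eq_right hρ.le] at h
  obtain ⟨h1, h2, h3, h4⟩ := h
  dsimp only at h1 h2 h3 h4
  obtain ⟨rfl, h2⟩ := h2
  obtain ⟨rfl, rfl, h3⟩ := h3
  obtain ⟨rfl, rfl, rfl, h4⟩ := h4
  refine ⟨_, applyStr_cons (F_row₁ mem_one ?_) (applyStr_cons (F_row₂ mem_four ?_)
    (applyStr_nil rfl)), by omega, by omega, by omega, by omega, _, _, _, _, rfl, ?_⟩
  · simp only [Row.cnt, Nat.zero_sub, Nat.sub_zero, Nat.add_zero, Nat.zero_add]
    and_intros <;> omega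
  · simp only [Row.inc, Row.cnt, Nat.zero_sub, Nat.sub_zero, Nat.add_zero, Nat.zero_add]
    and_intros <;> omega
  · rw [min_eq_right (by omega), min_eq_right (a := ρ) (b := p) (by omega)]
    refine ⟨?_, ?_, ?_, ?_⟩
    · clear h2 h3 h4
      simp only [Row.inc, true_and, and_true]
      and_intros <;> omega
    · clear h1 h3 h4
      simp only [Row.inc, true_and, and_true]
      and_intros <;> omega
    · clear h1 h2 h4
      simp only [Row.inc, true_and, and_true]
      and_intros <;> omega
    · clear h1 h2 h3
      simp only [Row.inc, true_and, and_true]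
      and_intros <;> omega

/-- Self-complementary tableaux are closed under `F₄ F₁`. -/
theorem step_outer (h : IsSymTab c₁ c₂ a p x y ρ t) (hφ : 0 < tab.φ 1 t) :
    ∃ t', applyStr tab.toPreGraph [1, 4] t = some t' ∧
      ∃ a' p' x' y' ρ', IsSymTab c₁ c₂ a' p' x' y' ρ' t' := by
  rcases le_or_gt (2 * ρ) (2 * p + x) with hρ | hρ
  · rcases y with _ | y
    · obtain ⟨t', e, h'⟩ := h.step_x hρ (by
        obtain ⟨h₁, h₂, h₃, h₄, r₁, r₂, r₃, r₄, rfl, h1, h2, h3, h4⟩ := h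
        rw [φ_mk] at hφ
        simp only [Row.cnt] at hφ
        rw [min_eq_left hρ] at h1 h2
        generalize min ρ (p + x) = D, min ρ p = B at *
        omega)
      exact ⟨t', e, _, _, _, _, _, h'⟩
    · obtain ⟨t', e, h'⟩ := h.step_p hρ
      exact ⟨t', e, _, _, _, _, _, h'⟩
  · obtain ⟨ρ, rfl⟩ : ∃ k, ρ = k + 1 := ⟨ρ - 1, by omega⟩
    rcases x with _ | x
    · obtain ⟨t', e, h'⟩ := h.step_y (by omega)
      exact ⟨t', e, _, _, _, _, _, h'⟩
    · obtain ⟨t', e, h'⟩ := h.step_a hρ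
      exact ⟨t', e, _, _, _, _, _, h'⟩

theorem step_inner_of_lt (h : IsSymTab c₁ c₂ a p x y ρ t) (hρ : ρ + y < c₂ + x)
    (hp : ρ < p) :
    ∃ t', applyStr tab.toPreGraph [2, 3, 3, 2] t = some t' ∧
      IsSymTab c₁ c₂ a p x y (ρ + 1) t' := by
  obtain ⟨h₁, h₂, h₃, h₄, ⟨u₁, u₂, u₃, u₄, u₅⟩, ⟨v₁, v₂, v₃, v₄, v₅⟩, ⟨w₁, w₂, w₃, w₄, w₅⟩,
    ⟨z₁, z₂, z₃, z₄, z₅⟩, rfl, h⟩ := h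
  obtain ⟨n, rfl⟩ := Nat.exists_eq_add_of_le h₃
  obtain ⟨m, rfl⟩ := Nat.exists_eq_add_of_le h₂
  clear h₂ h₃
  obtain ⟨k, rfl⟩ := Nat.exists_eq_add_of_lt hp
  clear hp hρ h₄
  rw [show min (2 * _) (2 * (ρ + k + 1) + _) = 2 * ρ by omega, show min _ (ρ + k + 1) = ρ by omega,
    show min _ (ρ + k + 1 + _) = ρ by omega] at h
  obtain ⟨h1, h2, h3, h4⟩ := h
  dsimp only at h1 h2 h3 h4
  obtain ⟨_, _, _, _, _⟩ : u₁ = x + 2 * n + y + 2 * m ∧ u₂ = 2 + 2 * k + x + y + a ∧ u₃ = ρ ∧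
    u₄ = ρ ∧ u₅ = a := by omega
  subst u₁ u₂ u₃ u₄ u₅
  clear h1
  obtain ⟨_, _, _, _, _⟩ : v₁ = 0 ∧ v₂ = x + n + 2 * m ∧ v₃ = 1 + k + a + y ∧
    v₄ = ρ ∧ v₅ = ρ + k + 1 + y := by omega
  subst v₁ v₂ v₃ v₄ v₅
  clear h2
  obtain ⟨_, _, _, _, _⟩ : w₁ = 0 ∧ w₂ = 0 ∧ w₃ = x + n + m ∧ w₄ = a + y ∧ w₅ = ρ + k + 1 :=
    by omega
  subst w₁ w₂ w₃ w₄ w₅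
  clear h3
  obtain ⟨_, _, _, _, _⟩ : z₁ = 0 ∧ z₂ = 0 ∧ z₃ = 0 ∧ z₄ = n ∧ z₅ = a + x := by omega
  subst z₁ z₂ z₃ z₄ z₅
  clear h4
  refine ⟨_, applyStr_cons (F_row₁ mem_two ?_) (applyStr_cons (F_row₁ mem_three ?_)
    (applyStr_cons (F_row₂ mem_three ?_) (applyStr_cons (F_row₁ mem_two ?_)
    (applyStr_nil rfl)))), h₁, by omega, by omega, by omega, _, _, _, _, rfl, ?_⟩
  iterate 4
    · simp only [Row.inc, Row.cnt]
      omega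
  rw [show min (2 * _) (2 * (ρ + k + 1) + _) = 2 * (ρ + 1) by omega,
    show min _ (ρ + k + 1) = ρ + 1 by omega,
    show min _ (ρ + k + 1 + _) = ρ + 1 by omega]
  constructor <;> simp only [Row.inc, true_and, and_true] <;> and_intros <;> omega

theorem step_inner_of_add_le (h : IsSymTab c₁ c₂ a p x y ρ t) (hρ : ρ + y < c₂ + x)
    (hp : p + x ≤ ρ) :
    ∃ t', applyStr tab.toPreGraph [2, 3, 3, 2] t = some t' ∧
      IsSymTab c₁ c₂ a p x y (ρ + 1) t' := by
  obtain ⟨h₁, h₂, h₃, h₄, ⟨u₁, u₂, u₃, u₄, u₅⟩, ⟨v₁, v₂, v₃, v₄, v₅⟩, ⟨w₁, w₂, w₃, w₄, w₅⟩,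
    ⟨z₁, z₂, z₃, z₄, z₅⟩, rfl, h⟩ := h
  obtain ⟨n, rfl⟩ := Nat.exists_eq_add_of_le h₃
  obtain ⟨m, rfl⟩ := Nat.exists_eq_add_of_le h₂
  clear h₂ h₃
  obtain ⟨k, rfl⟩ := Nat.exists_eq_add_of_le hp
  obtain ⟨j, rfl⟩ : ∃ j, m = k + 1 + j := ⟨m - (k + 1), by omega⟩
  clear hp hρ h₄
  rw [show min (2 * _) (2 * p + _) = 2 * p + x by omega, show min _ p = p by omega,
    show min _ (p + _) = p + x by omega] at h
  obtain ⟨h1, h2, h3, h4⟩ := h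
  dsimp only at h1 h2 h3 h4
  obtain ⟨_, _, _, _, _⟩ : u₁ = x + 2 * n + y + 2 * (k + 1 + j) ∧ u₂ = y + a ∧ u₃ = p ∧
    u₄ = p + x ∧ u₅ = a := by omega
  subst u₁ u₂ u₃ u₄ u₅
  clear h1
  obtain ⟨_, _, _, _, _⟩ : v₁ = 0 ∧ v₂ = n + 2 + 2 * j ∧ v₃ = a + y + x + k ∧
    v₄ = p + k ∧ v₅ = p + y := by omega
  subst v₁ v₂ v₃ v₄ v₅
  clear h2
  obtain ⟨_, _, _, _, _⟩ : w₁ = 0 ∧ w₂ = 0 ∧ w₃ = n + 1 + j ∧ w₄ = a + y + x + k ∧ w₅ = p :=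
    by omega
  subst w₁ w₂ w₃ w₄ w₅
  clear h3
  obtain ⟨_, _, _, _, _⟩ : z₁ = 0 ∧ z₂ = 0 ∧ z₃ = 0 ∧ z₄ = n ∧ z₅ = a + x := by omega
  subst z₁ z₂ z₃ z₄ z₅
  clear h4
  refine ⟨_, applyStr_cons (F_row₂ mem_two ?_) (applyStr_cons (F_row₂ mem_three ?_)
    (applyStr_cons (F_row₃ mem_three ?_) (applyStr_cons (F_row₂ mem_two ?_)
    (applyStr_nil rfl)))), h₁, by omega, by omega, by omega, _, _, _, _, rfl, ?_⟩
  iterate 4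
    · simp only [Row.inc, Row.cnt]
      omega
  rw [show min (2 * _) (2 * p + _) = 2 * p + x by omega, show min _ p = p by omega,
    show min _ (p + _) = p + x by omega]
  constructor <;> simp only [Row.inc, true_and, and_true] <;> and_intros <;> omega

theorem step_inner_of_two_mul_add_two_le (h : IsSymTab c₁ c₂ a p x y ρ t) (hρ : ρ + y < c₂ + x)
    (hp : p ≤ ρ) (hx : 2 * ρ + 2 ≤ 2 * p + x) :
    ∃ t', applyStr tab.toPreGraph [2, 3, 3, 2] t = some t' ∧
      IsSymTab c₁ c₂ a p x y (ρ + 1) t' := by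
  obtain ⟨h₁, h₂, h₃, h₄, ⟨u₁, u₂, u₃, u₄, u₅⟩, ⟨v₁, v₂, v₃, v₄, v₅⟩, ⟨w₁, w₂, w₃, w₄, w₅⟩,
    ⟨z₁, z₂, z₃, z₄, z₅⟩, rfl, h⟩ := h
  obtain ⟨n, rfl⟩ := Nat.exists_eq_add_of_le h₃
  obtain ⟨m, rfl⟩ := Nat.exists_eq_add_of_le h₂
  clear h₂ h₃
  obtain ⟨k, rfl⟩ := Nat.exists_eq_add_of_le hp
  obtain ⟨l, rfl⟩ : ∃ l, x = 2 * k + 2 + l := ⟨x - (2 * k + 2), by omega⟩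
  obtain rfl : y = 0 := by omega
  clear hp hx hρ h₄
  rw [show min (2 * _) (2 * p + _) = 2 * (p + k) by omega, show min _ p = p by omega,
    show min _ (p + _) = p + k by omega] at h
  obtain ⟨h1, h2, h3, h4⟩ := h
  dsimp only at h1 h2 h3 h4
  obtain ⟨_, _, _, _, _⟩ : u₁ = (2 * k + 2 + l) + 2 * n + 2 * m ∧ u₂ = 2 + l + a ∧ u₃ = p + k ∧
    u₄ = p + k ∧ u₅ = a := by omega
  subst u₁ u₂ u₃ u₄ u₅
  clear h1
  obtain ⟨_, _, _, _, _⟩ : v₁ = 0 ∧ v₂ = 2 * k + 2 + l + n + 2 * m ∧ v₃ = a ∧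
    v₄ = p ∧ v₅ = p + 0 := by omega
  subst v₁ v₂ v₃ v₄ v₅
  clear h2
  obtain ⟨_, _, _, _, _⟩ : w₁ = 0 ∧ w₂ = 0 ∧ w₃ = k + 2 + l + n + m ∧ w₄ = a + k ∧ w₅ = p :=
    by omega
  subst w₁ w₂ w₃ w₄ w₅
  clear h3
  obtain ⟨_, _, _, _, _⟩ : z₁ = 0 ∧ z₂ = 0 ∧ z₃ = 0 ∧ z₄ = n ∧ z₅ = a + (2 * k + 2 + l) := by omega
  subst z₁ z₂ z₃ z₄ z₅
  clear h4
  refine ⟨_, applyStr_cons (F_row₁ mem_two ?_) (applyStr_cons (F_row₁ mem_three ?_)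
    (applyStr_cons (F_row₃ mem_three ?_) (applyStr_cons (F_row₁ mem_two ?_)
    (applyStr_nil rfl)))), h₁, by omega, by omega, by omega, _, _, _, _, rfl, ?_⟩
  iterate 4
    · simp only [Row.inc, Row.cnt]
      omega
  rw [show min (2 * _) (2 * p + _) = 2 * (p + k + 1) by omega, show min _ p = p by omega,
    show min _ (p + _) = p + k + 1 by omega]
  constructor <;> simp only [Row.inc, true_and, and_true] <;> and_intros <;> omega

theorem step_inner_of_two_mul_add_one_eq (h : IsSymTab c₁ c₂ a p x y ρ t) (hρ : ρ + y < c₂ + x)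
    (hp : p ≤ ρ) (hx : 2 * ρ + 1 = 2 * p + x) :
    ∃ t', applyStr tab.toPreGraph [2, 3, 3, 2] t = some t' ∧
      IsSymTab c₁ c₂ a p x y (ρ + 1) t' := by
  obtain ⟨h₁, h₂, h₃, h₄, ⟨u₁, u₂, u₃, u₄, u₅⟩, ⟨v₁, v₂, v₃, v₄, v₅⟩, ⟨w₁, w₂, w₃, w₄, w₅⟩,
    ⟨z₁, z₂, z₃, z₄, z₅⟩, rfl, h⟩ := h
  obtain ⟨n, rfl⟩ := Nat.exists_eq_add_of_le h₃
  obtain ⟨m, rfl⟩ := Nat.exists_eq_add_of_le h₂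
  clear h₂ h₃
  obtain ⟨k, rfl⟩ := Nat.exists_eq_add_of_le hp
  obtain rfl : x = 2 * k + 1 := by omega
  obtain rfl : y = 0 := by omega
  clear hp hx hρ h₄
  rw [show min (2 * _) (2 * p + _) = 2 * (p + k) by omega, show min _ p = p by omega,
    show min _ (p + _) = p + k by omega] at h
  obtain ⟨h1, h2, h3, h4⟩ := h
  dsimp only at h1 h2 h3 h4
  obtain ⟨_, _, _, _, _⟩ : u₁ = (2 * k + 1) + 2 * n + 2 * m ∧ u₂ = 1 + a ∧ u₃ = p + k ∧
    u₄ = p + k ∧ u₅ = a := by omega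
  subst u₁ u₂ u₃ u₄ u₅
  clear h1
  obtain ⟨_, _, _, _, _⟩ : v₁ = 0 ∧ v₂ = 2 * k + 1 + n + 2 * m ∧ v₃ = a ∧
    v₄ = p ∧ v₅ = p + 0 := by omega
  subst v₁ v₂ v₃ v₄ v₅
  clear h2
  obtain ⟨_, _, _, _, _⟩ : w₁ = 0 ∧ w₂ = 0 ∧ w₃ = k + 1 + n + m ∧ w₄ = a + k ∧ w₅ = p := by omega
  subst w₁ w₂ w₃ w₄ w₅
  clear h3
  obtain ⟨_, _, _, _, _⟩ : z₁ = 0 ∧ z₂ = 0 ∧ z₃ = 0 ∧ z₄ = n ∧ z₅ = a + (2 * k + 1) := by omega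
  subst z₁ z₂ z₃ z₄ z₅
  clear h4
  refine ⟨_, applyStr_cons (F_row₁ mem_two ?_) (applyStr_cons (F_row₁ mem_three ?_)
    (applyStr_cons (F_row₃ mem_three ?_) (applyStr_cons (F_row₂ mem_two ?_)
    (applyStr_nil rfl)))), h₁, by omega, by omega, by omega, _, _, _, _, rfl, ?_⟩
  iterate 4
    · simp only [Row.inc, Row.cnt]
      omega
  rw [show min (2 * _) (2 * p + _) = 2 * p + (2 * k + 1) by omega, show min _ p = p by omega,
    show min _ (p + _) = p + k + 1 by omega]
  constructor <;> simp only [Row.inc, true_and, and_true] <;> and_intros <;> omega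

theorem step_inner_of_le_two_mul (h : IsSymTab c₁ c₂ a p x y ρ t) (hρ : ρ + y < c₂ + x)
    (hp : ρ < p + x) (hx : 2 * p + x ≤ 2 * ρ) :
    ∃ t', applyStr tab.toPreGraph [2, 3, 3, 2] t = some t' ∧
      IsSymTab c₁ c₂ a p x y (ρ + 1) t' := by
  obtain ⟨h₁, h₂, h₃, h₄, ⟨u₁, u₂, u₃, u₄, u₅⟩, ⟨v₁, v₂, v₃, v₄, v₅⟩, ⟨w₁, w₂, w₃, w₄, w₅⟩,
    ⟨z₁, z₂, z₃, z₄, z₅⟩, rfl, h⟩ := h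
  obtain ⟨n, rfl⟩ := Nat.exists_eq_add_of_le h₃
  obtain ⟨m, rfl⟩ := Nat.exists_eq_add_of_le h₂
  clear h₂ h₃
  obtain ⟨l, j, rfl, rfl⟩ : ∃ l j, x = 2 + 2 * l + j ∧ ρ = p + (1 + l + j) :=
    ⟨p + x - ρ - 1, 2 * ρ - 2 * p - x, by omega, by omega⟩
  obtain rfl : y = 0 := by omega
  clear hp hx hρ h₄
  rw [show min (2 * _) (2 * p + _) = 2 * p + (2 + 2 * l + j) by omega, show min _ p = p by omega,
    show min _ (p + _) = p + (1 + l + j) by omega] at h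
  obtain ⟨h1, h2, h3, h4⟩ := h
  dsimp only at h1 h2 h3 h4
  obtain ⟨_, _, _, _, _⟩ : u₁ = (2 + 2 * l + j) + 2 * n + 2 * m ∧ u₂ = a ∧ u₃ = p + 1 + l ∧
    u₄ = p + (1 + l + j) ∧ u₅ = a := by omega
  subst u₁ u₂ u₃ u₄ u₅
  clear h1
  obtain ⟨_, _, _, _, _⟩ : v₁ = 0 ∧ v₂ = 2 + 2 * l + n + 2 * m ∧ v₃ = a + j ∧
    v₄ = p ∧ v₅ = p + 0 := by omega
  subst v₁ v₂ v₃ v₄ v₅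
  clear h2
  obtain ⟨_, _, _, _, _⟩ : w₁ = 0 ∧ w₂ = 0 ∧ w₃ = 1 + l + n + m ∧ w₄ = a + (1 + l + j) ∧ w₅ = p :=
    by omega
  subst w₁ w₂ w₃ w₄ w₅
  clear h3
  obtain ⟨_, _, _, _, _⟩ : z₁ = 0 ∧ z₂ = 0 ∧ z₃ = 0 ∧ z₄ = n ∧ z₅ = a + (2 + 2 * l + j) := by omega
  subst z₁ z₂ z₃ z₄ z₅
  clear h4
  refine ⟨_, applyStr_cons (F_row₂ mem_two ?_) (applyStr_cons (F_row₁ mem_three ?_)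
    (applyStr_cons (F_row₃ mem_three ?_) (applyStr_cons (F_row₂ mem_two ?_)
    (applyStr_nil rfl)))), h₁, by omega, by omega, by omega, _, _, _, _, rfl, ?_⟩
  iterate 4
    · simp only [Row.inc, Row.cnt]
      omega
  rw [show min (2 * _) (2 * p + _) = 2 * p + (2 + 2 * l + j) by omega, show min _ p = p by omega,
    show min _ (p + _) = p + (1 + l + j) + 1 by omega]
  constructor <;> simp only [Row.inc, true_and, and_true] <;> and_intros <;> omega

/-- The action of `F₂ F₃ F₃ F₂`. -/
theorem step_inner (h : IsSymTab c₁ c₂ a p x y ρ t) (hρ : ρ + y < c₂ + x) :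
    ∃ t', applyStr tab.toPreGraph [2, 3, 3, 2] t = some t' ∧
      IsSymTab c₁ c₂ a p x y (ρ + 1) t' := by
  by_cases h1 : ρ < p
  · exact h.step_inner_of_lt hρ h1
  by_cases h2 : p + x ≤ ρ
  · exact h.step_inner_of_add_le hρ h2
  by_cases h3 : 2 * ρ + 2 ≤ 2 * p + x
  · exact h.step_inner_of_two_mul_add_two_le hρ (by omega) h3
  by_cases h4 : 2 * ρ + 1 = 2 * p + x
  · exact h.step_inner_of_two_mul_add_one_eq hρ (by omega) h4
  · exact h.step_inner_of_le_two_mul hρ (by omega) (by omega)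

end IsSymTab

/-! ### Subcrystals -/

namespace PreGraph

variable {K : PreGraph} {I : Set ℕ} {v : K.V}

theorem sub_F {i : ℕ} (hi : i ∈ I) {u w : (K.sub I v).V} :
    (K.sub I v).F i u = some w ↔ K.F i u.1 = some w.1 := by
  have key : (K.sub I v).F i u = (K.F i u.1).pbind fun w hw =>
      some ⟨w, u.2.tail ⟨i, hi, Or.inl (Option.mem_def.mp hw)⟩⟩ := dif_pos hi
  rw [key]
  constructor
  · intro h
    obtain ⟨x, hx, e⟩ := Option.pbind_eq_some_iff.1 h
    rw [hx, ← Option.some.inj e]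
  · intro h
    exact Option.pbind_eq_some_iff.2 ⟨w.1, h, rfl⟩

theorem applyStr_sub {L : List ℕ} (hL : ∀ i ∈ L, i ∈ I) {u w : (K.sub I v).V} :
    applyStr (K.sub I v) L u = some w ↔ applyStr K L u.1 = some w.1 := by
  induction L generalizing u with
  | nil => exact Option.some_inj.trans (Subtype.ext_iff.trans Option.some_inj.symm)
  | cons i L ih =>
    have hi := hL i (by simp)
    have ih' := fun x => @ih (fun j hj => hL j (by simp [hj])) x
    simp only [applyStr, Option.bind_eq_some_iff]
    constructor
    · rintro ⟨x, hx, h⟩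
      exact ⟨x.1, (sub_F hi).1 hx, (ih' x).1 h⟩
    · rintro ⟨x, hx, h⟩
      exact ⟨⟨x, u.2.tail ⟨i, hi, Or.inl hx⟩⟩, (sub_F hi).2 hx, (ih' _).2 h⟩

theorem isSource_sub_iff {s : (K.sub I v).V} :
    IsSource (K.sub I v) s ↔ ∀ i ∈ I, ∀ u, K.F i u ≠ some s.1 := by
  constructor
  · intro h i hi u e
    exact h i ⟨u, s.2.tail ⟨i, hi, Or.inr e⟩⟩ ((sub_F hi).2 e)
  · intro h i u e
    by_cases hi : i ∈ I
    · exact h i hi u.1 ((sub_F hi).1 e)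
    · simp [sub, dif_neg hi] at e

end PreGraph

theorem inComp_of_applyStr {K : PreGraph} {I : Set ℕ} {L : List ℕ} (hL : ∀ i ∈ L, i ∈ I)
    {u v : K.V} (e : applyStr K L u = some v) : inComp K I u v := by
  induction L generalizing u with
  | nil =>
    obtain rfl : u = v := by simpa [applyStr] using e
    exact .refl
  | cons i L ih =>
    obtain ⟨w, hw, h⟩ := Option.bind_eq_some_iff.1 e
    exact .head ⟨i, hL i (by simp), Or.inl hw⟩ (ih (fun j hj => hL j (by simp [hj])) h)

theorem mem_diagStr {r i : ℕ} (h : i ∈ diagStr r) : i ∈ Set.Icc 2 3 := by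
  simp only [diagStr, List.mem_append, List.mem_flatten, List.mem_replicate] at h
  simp only [Set.mem_Icc]
  rcases h with ⟨L, ⟨-, rfl⟩, h⟩ | ⟨L, ⟨-, rfl⟩, h⟩ <;> simp at h <;> omega

theorem mem_prinStr_three {p : ℕ → ℕ} {i : ℕ} (h : i ∈ prinStr 0 3 p) : i ∈ Set.Icc 1 3 := by
  simp only [tab.prinStr_three, List.mem_append, List.mem_flatten, List.mem_replicate] at h
  simp only [Set.mem_Icc]
  rcases h with (⟨L, ⟨-, rfl⟩, h⟩ | ⟨L, ⟨-, rfl⟩, h⟩) | ⟨L, ⟨-, rfl⟩, h⟩ <;> simp at h <;> omega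

theorem mem_prinStr_four {p : ℕ → ℕ} {i : ℕ} (h : i ∈ prinStr 0 4 p) : i ∈ Set.Icc 1 4 := by
  simp only [tab.prinStr_four, List.mem_append, List.mem_flatten, List.mem_replicate] at h
  simp only [Set.mem_Icc]
  rcases h with (⟨L, ⟨-, rfl⟩, h⟩ | ⟨L, ⟨-, rfl⟩, h⟩) | (⟨L, ⟨-, rfl⟩, h⟩ | ⟨L, ⟨-, rfl⟩, h⟩) <;>
    simp at h <;> omega

theorem mem_flatten_replicate {I : Set ℕ} {L : List ℕ} (hL : ∀ i ∈ L, i ∈ I) {r i : ℕ}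
    (h : i ∈ (List.replicate r L).flatten) : i ∈ I := by
  simp only [List.mem_flatten, List.mem_replicate] at h
  obtain ⟨L, ⟨-, rfl⟩, h⟩ := h
  exact hL i h

/-! ### The diagonal of a middle subcrystal -/

namespace tab

/-- The tableau `(F₃ F₂)^k₂ (F₂ F₃)^k₁` of the source with two strings of length `h`. -/
def diag (h k₁ k₂ : ℕ) : tab.V :=
  mk ⟨0, 2 * h - k₁ - k₂, k₂, k₁, 0⟩ ⟨0, 0, h - k₂, k₂, 0⟩ ⟨0, 0, 0, 0, 0⟩ ⟨0, 0, 0, 0, 0⟩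

variable {h k₁ k₂ : ℕ}

theorem diag_step₁ (h₁ : k₁ < h) (h₂ : k₂ ≤ h) :
    applyStr tab.toPreGraph [2, 3] (diag h k₁ k₂) = some (diag h (k₁ + 1) k₂) := by
  refine applyStr_cons (F_row₁ mem_two ?_) (applyStr_cons (F_row₁ mem_three ?_)
    (applyStr_nil (mk_congr ?_ ?_ ?_ ?_))) <;>
  simp only [Row.inc, Row.cnt, Row.mk.injEq, and_true, true_and] <;> omega

theorem diag_step₂ (h₁ : k₁ ≤ h) (h₂ : k₂ < h) :
    applyStr tab.toPreGraph [3, 2] (diag h k₁ k₂) = some (diag h k₁ (k₂ + 1)) := by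
  refine applyStr_cons (F_row₂ mem_three ?_) (applyStr_cons (F_row₁ mem_two ?_)
    (applyStr_nil (mk_congr ?_ ?_ ?_ ?_))) <;>
  simp only [Row.inc, Row.cnt, Row.mk.injEq, and_true, true_and] <;> omega

theorem applyStr_diagStr {r : ℕ} (hr : r ≤ h) :
    applyStr tab.toPreGraph (diagStr r) (diag h 0 0) = some (diag h r r) :=
  applyStr_append_some
    (applyStr_replicate (fun k => diag h k 0) r fun k hk => diag_step₁ (by omega) (by omega))
    (applyStr_replicate (fun k => diag h r k) r fun k hk => diag_step₂ hr (by omega))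

theorem applyStr_diag {r : ℕ} (hr : r ≤ h) :
    applyStr tab.toPreGraph (List.replicate r [2, 3, 3, 2]).flatten (diag h 0 0) =
      some (diag h r r) :=
  applyStr_replicate (fun k => diag h k k) r fun k hk =>
    applyStr_append_some (L := [2, 3]) (L' := [3, 2]) (diag_step₁ (by omega) (by omega))
      (diag_step₂ (by omega) (by omega))

theorem le_of_applyStr_diagStr {r : ℕ} {t : tab.V}
    (e : applyStr tab.toPreGraph (diagStr r) (diag h 0 0) = some t) : r ≤ h := by
  by_contra! hr
  obtain ⟨k, rfl⟩ := Nat.exists_eq_add_of_lt hr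
  rw [diagStr, add_assoc, List.replicate_add, List.flatten_append, applyStr_append,
    applyStr_append, applyStr_replicate (fun k => diag h k 0) h
    fun k hk => diag_step₁ (by omega) (by omega)] at e
  simp only [Option.bind_some, List.replicate_succ, List.flatten_cons, List.cons_append, applyStr,
    Option.bind_eq_some_iff] at e
  obtain ⟨-, ⟨u, hu, -⟩, -⟩ := e
  have := tab_ax.F_pos mem_two hu
  rw [diag, φ_mk] at this
  simp only [Row.cnt] at this
  omega

end tab

namespace Based

variable {K : PreGraph} {s : K.V} {c : ℕ → ℕ}

theorem rep_back (b : Based K s c) {v : K.V} {t t' : tab.V} (h : TabRep K s c v t') {L : List ℕ}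
    (hL : ∀ i ∈ L, i ∈ Set.Icc 1 4) (e : applyStr tab.toPreGraph L t = some t') :
    ∃ u, applyStr K L u = some v ∧ TabRep K s c u t := by
  induction L generalizing t with
  | nil =>
    obtain rfl : t = t' := by simpa [applyStr] using e
    exact ⟨v, rfl, h⟩
  | cons i L ih =>
    have hi := hL i (by simp)
    obtain ⟨x, hx, e⟩ := Option.bind_eq_some_iff.1 e
    obtain ⟨u, hu, n, hr⟩ := ih (fun j hj => hL j (by simp [hj])) e
    obtain ⟨w, k, -, hw, r⟩ := (b.rel n).2.2 x u hr.symm i hi t ((tab_ax.FE i hi _ _).1 hx)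
    exact ⟨w, applyStr_cons ((b.ax.FE i hi w u).2 hw) hu, k, r.symm⟩

theorem Icc_subset : Set.Icc 2 3 ⊆ Set.Icc 1 4 := Set.Icc_subset_Icc (by omega) (by omega)

section Diagonal

variable {u : K.V} {h : ℕ}

theorem diag_rel (b : Based K s c) (hu : K.crys.IsTop (Set.Icc 2 3) u) (h₂ : K.h 2 u = h)
    (h₃ : K.h 3 u = h) (n : ℕ) :
    Crys.Rel.Matched K.crys tab (Set.Icc 2 3) u (tab.diag h 0 0) n ∧
    Crys.Rel.Raises K.crys tab (Set.Icc 2 3) u (tab.diag h 0 0) n ∧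
    Crys.Rel.Raises tab K.crys (Set.Icc 2 3) (tab.diag h 0 0) u n := by
  refine Crys.Rel.main (b.ax.mono Icc_subset) (tab_ax.mono Icc_subset) hu ?_ ?_ n
  · rintro i ⟨hi, hi'⟩
    rw [tab.diag, tab.ε_mk]
    interval_cases i <;> simp only [Row.cnt] <;> omega
  · rintro i ⟨hi, hi'⟩
    rw [tab.diag, tab.φ_mk]
    interval_cases i
    · refine h₂.trans ?_
      simp only [Row.cnt]
      omega
    · refine h₃.trans ?_
      simp only [Row.cnt]
      omega

theorem applyStr_diagStr (b : Based K s c) (hu : K.crys.IsTop (Set.Icc 2 3) u) (h₂ : K.h 2 u = h)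
    (h₃ : K.h 3 u = h) {r : ℕ} (hr : r ≤ h) :
    applyStr K (diagStr r) u = applyStr K (List.replicate r [2, 3, 3, 2]).flatten u := by
  have m := b.diag_rel hu h₂ h₃
  have ax := b.ax.mono Icc_subset
  have ax' := tab_ax.mono Icc_subset
  have low {L : List ℕ} (hL : ∀ i ∈ L, i ∈ Set.Icc 2 3)
      (e : applyStr tab.toPreGraph L (tab.diag h 0 0) = some (tab.diag h r r)) :=
    Crys.Rel.applyStr ax' ax (fun n => (m n).1.symm) hL .base e
  obtain ⟨x, hx, rx⟩ := low (fun _ => mem_diagStr) (tab.applyStr_diagStr hr)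
  obtain ⟨y, hy, ry⟩ := low (fun _ => mem_flatten_replicate (by simp)) (tab.applyStr_diag hr)
  rw [show (diagStr r).length = ((List.replicate r [2, 3, 3, 2]).flatten).length by
    simp [diagStr]; omega] at rx
  exact hx.trans ((congrArg some (Crys.Rel.functional ax (fun n => (m n).2.2) ax' rx ry)).trans
    hy.symm)

theorem le_of_applyStr_diagStr (b : Based K s c) (hu : K.crys.IsTop (Set.Icc 2 3) u)
    (h₂ : K.h 2 u = h) (h₃ : K.h 3 u = h) {r : ℕ} {v : K.V}
    (e : applyStr K (diagStr r) u = some v) : r ≤ h := by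
  obtain ⟨x, hx, -⟩ := Crys.Rel.applyStr (b.ax.mono Icc_subset) (tab_ax.mono Icc_subset)
    (fun n => (b.diag_rel hu h₂ h₃ n).1) (fun _ => mem_diagStr) .base e
  exact tab.le_of_applyStr_diagStr hx

end Diagonal

end Based

/-! ### Self-complementary vertices -/

namespace tab

theorem isSymTab_top {c : ℕ → ℕ} (h₁ : c 4 = c 1) (h₂ : c 3 = c 2) :
    IsSymTab (c 1) (c 2) 0 0 0 0 0 (top c) := by
  refine ⟨by omega, by omega, by omega, by omega, _, _, _, _, rfl, ?_⟩
  simp only [mul_zero, add_zero, min_self]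
  constructor <;> dsimp only <;> omega

end tab

theorem IsSymTab.φ_two_eq_zero {c₁ c₂ a p x y ρ : ℕ} {t : tab.V}
    (h : IsSymTab c₁ c₂ a p x y ρ t) (hρ : ρ + y = c₂ + x) : tab.φ 2 t = 0 := by
  obtain ⟨h₁, h₂, h₃, h₄, ⟨u₁, u₂, u₃, u₄, u₅⟩, ⟨v₁, v₂, v₃, v₄, v₅⟩, ⟨w₁, w₂, w₃, w₄, w₅⟩,
    ⟨z₁, z₂, z₃, z₄, z₅⟩, rfl, h⟩ := h
  rw [min_eq_right (a := 2 * ρ) (by omega), min_eq_right (a := ρ) (b := p) (by omega),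
    min_eq_right (a := ρ) (b := p + x) (by omega)] at h
  obtain ⟨h1, h2, h3, h4⟩ := h
  dsimp only at h1 h2 h3 h4
  rw [tab.φ_mk]
  simp only [Row.cnt]
  obtain rfl : z₂ = 0 := h4.2.1
  obtain rfl : z₃ = 0 := h4.2.2.1
  obtain rfl : w₂ = 0 := h3.2.1
  have : v₂ ≤ w₃ := by omega
  have : u₂ ≤ v₃ := by omega
  omega

/-- An involution-like symmetry of a based crystal exchanging the colors `i` and `5 - i`. -/
structure Based.Symm {K : PreGraph} {s : K.V} {c : ℕ → ℕ} (b : Based K s c) (σ : K.V → K.V) :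
    Prop where
  bij : Function.Bijective σ
  map : ∀ (i : ℕ) (u v : K.V), K.F i u = some v ↔ K.F (5 - i) (σ u) = some (σ v)

namespace Based.Symm

variable {K : PreGraph} {s : K.V} {c : ℕ → ℕ} {b : Based K s c} {σ : K.V → K.V}

theorem F_eq_map (hσ : b.Symm σ) (i : ℕ) (u : K.V) : K.F (5 - i) (σ u) = (K.F i u).map σ := by
  cases e : K.F i u with
  | some v => exact (hσ.map i u v).1 e
  | none =>
    cases e' : K.F (5 - i) (σ u) with
    | none => rfl
    | some w =>
      obtain ⟨v, rfl⟩ := hσ.bij.2 w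
      rw [(hσ.map i u v).2 e'] at e
      cases e

theorem h_eq (hσ : b.Symm σ) (i : ℕ) (u : K.V) : K.h (5 - i) (σ u) = K.h i u := by
  have key (k : ℕ) (u : K.V) : (optIter (K.F (5 - i)) k (σ u)).isSome = true ↔
      (optIter (K.F i) k u).isSome = true := by
    induction k generalizing u with
    | zero => simp [optIter]
    | succ k ih =>
      simp only [optIter, hσ.F_eq_map]
      cases K.F i u with
      | none => simp
      | some v => simpa using ih v
  refine le_antisymm ?_ ?_
  · rw [PreGraph.le_h_iff b.crystal.1, ← key, ← PreGraph.le_h_iff b.crystal.1]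
  · rw [PreGraph.le_h_iff b.crystal.1, key, ← PreGraph.le_h_iff b.crystal.1]

theorem source_fixed (hσ : b.Symm σ) : σ s = s := by
  refine b.ax.top_eq (PreGraph.wf_E b.crystal subset_rfl) ?_ b.top
    (PreGraph.inComp_of_connected b.crystal _ _)
  refine (PreGraph.isTop_iff b.crystal).2 fun i hi u e => ?_
  obtain ⟨u, rfl⟩ := hσ.bij.2 u
  refine b.source (5 - i) u ((hσ.map (5 - i) u s).2 ?_)
  rwa [Nat.sub_sub_self (by have := hi.2; omega)]

theorem F_fixed (hσ : b.Symm σ) {i : ℕ} {u v : K.V} (hu : σ u = u) (e : K.F i u = some v) :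
    K.F (5 - i) u = some (σ v) := by
  have := (hσ.map i u v).1 e
  rwa [hu] at this

theorem fixed_F (hσ : b.Symm σ) {i : ℕ} {u v : K.V} (hv : σ v = v) (e : K.F i u = some v) :
    K.F (5 - i) (σ u) = some v := by
  have := (hσ.map i u v).1 e
  rwa [hv] at this

theorem fixed_of_outer (hσ : b.Symm σ) {w v : K.V} (hw : σ w = w)
    (e : applyStr K [1, 4] w = some v) : σ v = v := by
  simp only [applyStr, Option.bind_eq_some_iff] at e
  obtain ⟨u, e₁, v, e₂, ⟨⟩⟩ := e
  obtain ⟨x, f₁, f₂⟩ := b.ax.A5F 1 tab.mem_one 4 tab.mem_four (by simp [Far]) w u (σ u) e₁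
    (hσ.F_fixed hw e₁)
  obtain rfl : v = x := Option.some.inj (e₂.symm.trans f₁)
  exact Option.some.inj (((hσ.map 4 u v).1 e₂).symm.trans f₂)

theorem fixed_of_inner (hσ : b.Symm σ) {w v : K.V} (hw : σ w = w)
    (e : applyStr K [2, 3, 3, 2] w = some v) : σ v = v := by
  simp only [applyStr, Option.bind_eq_some_iff] at e
  obtain ⟨u, e₁, p, e₂, q, e₃, v, e₄, ⟨⟩⟩ := e
  have e₁' : K.F 3 w = some (σ u) := hσ.F_fixed hw e₁
  have hu : K.h 2 (σ u) = K.h 3 u := hσ.h_eq 3 u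
  have hh : K.h 2 w = K.h 3 w := by simpa only [hw] using hσ.h_eq 3 w
  rcases b.ax.near 2 tab.mem_two 3 tab.mem_three (by simp [Neighb]) w u e₁ with ⟨h, -⟩ | ⟨h, -⟩
  · have := (b.ax.A3F 2 tab.mem_two 3 tab.mem_three (by simp [Neighb]) w u (σ u) e₁ e₁' h).1
    dsimp only at this h
    omega
  · obtain ⟨p₁, q₁, p', q', x, f₁, f₂, f₃, g₁, g₂, g₃⟩ := b.ax.A4F 2 tab.mem_two 3 tab.mem_three
      (by simp [Neighb]) w u (σ u) e₁ e₁' h (by dsimp only at h ⊢; omega)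
    obtain rfl : p = p₁ := Option.some.inj (e₂.symm.trans f₁)
    obtain rfl : q = q₁ := Option.some.inj (e₃.symm.trans f₂)
    obtain rfl : v = x := Option.some.inj (e₄.symm.trans f₃)
    obtain rfl : σ p = p' := Option.some.inj (((hσ.map 3 u p).1 e₂).symm.trans g₁)
    obtain rfl : σ q = q' := Option.some.inj (((hσ.map 3 p q).1 e₃).symm.trans g₂)
    exact Option.some.inj (((hσ.map 2 q v).1 e₄).symm.trans g₃)

theorem exists_outer (hσ : b.Symm σ) {u v : K.V} (hv : σ v = v) (e : K.F 1 u = some v) :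
    ∃ w, σ w = w ∧ applyStr K [1, 4] w = some v := by
  have e' : K.F 4 (σ u) = some v := hσ.fixed_F hv e
  obtain ⟨w, f₁, f₂⟩ := b.ax.A5E 1 tab.mem_one 4 tab.mem_four (by simp [Far]) v u (σ u)
    ((b.ax.FE _ tab.mem_one _ _).1 e) ((b.ax.FE _ tab.mem_four _ _).1 e')
  replace f₁ := (b.ax.FE _ tab.mem_four _ _).2 f₁
  replace f₂ := (b.ax.FE _ tab.mem_one _ _).2 f₂
  exact ⟨w, b.ax.F_inj tab.mem_one ((hσ.map 4 w u).1 f₁) f₂,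
    applyStr_cons f₂ (applyStr_cons e' rfl)⟩

theorem exists_inner (hσ : b.Symm σ) {u v : K.V} (hv : σ v = v) (e : K.F 2 u = some v) :
    ∃ w, σ w = w ∧ applyStr K [2, 3, 3, 2] w = some v := by
  have h23 : Neighb 2 3 := by simp [Neighb]
  have h32 : Neighb 3 2 := by simp [Neighb]
  have e' : K.F 3 (σ u) = some v := hσ.fixed_F hv e
  have E := (b.ax.FE _ tab.mem_two _ _).1 e
  have E' := (b.ax.FE _ tab.mem_three _ _).1 e'
  have hu : K.h 2 (σ u) = K.h 3 u := hσ.h_eq 3 u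
  have hh : K.h 2 v = K.h 3 v := by simpa only [hv] using hσ.h_eq 3 v
  have n₁ := b.ax.near 2 tab.mem_two 3 tab.mem_three h23 u v e
  have n₂ := b.ax.near 3 tab.mem_three 2 tab.mem_two h32 (σ u) v e'
  dsimp only at n₁ n₂
  rcases n₁ with ⟨h, ht⟩ | ⟨h, ht⟩
  · obtain ⟨p, q, p', q', w, f₁, f₂, f₃, g₁, g₂, g₃⟩ := b.ax.A4E 2 tab.mem_two 3 tab.mem_three
      h23 v u (σ u) E E' ht (by dsimp only; omega)
    replace f₁ := (b.ax.FE _ tab.mem_three _ _).2 f₁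
    replace f₂ := (b.ax.FE _ tab.mem_three _ _).2 f₂
    replace f₃ := (b.ax.FE _ tab.mem_two _ _).2 f₃
    replace g₁ := (b.ax.FE _ tab.mem_two _ _).2 g₁
    replace g₂ := (b.ax.FE _ tab.mem_two _ _).2 g₂
    replace g₃ := (b.ax.FE _ tab.mem_three _ _).2 g₃
    obtain rfl : σ p = p' := b.ax.F_inj tab.mem_two ((hσ.map 3 p u).1 f₁) g₁
    obtain rfl : σ q = q' := b.ax.F_inj tab.mem_two ((hσ.map 3 q p).1 f₂) g₂
    exact ⟨w, b.ax.F_inj tab.mem_three ((hσ.map 2 w q).1 f₃) g₃,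
      applyStr_cons f₃ (applyStr_cons f₂ (applyStr_cons f₁ (applyStr_cons e rfl)))⟩
  · have := (b.ax.A3E 2 tab.mem_two 3 tab.mem_three h23 v u (σ u) E E' ht.symm).1
    dsimp only at this
    omega

theorem rank_applyStr (b : Based K s c) {L : List ℕ} (hL : ∀ i ∈ L, i ∈ Set.Icc 1 4) {u v : K.V}
    (e : applyStr K L u = some v) : K.rank u = K.rank v + 2 * L.length := by
  induction L generalizing u with
  | nil =>
    obtain rfl : u = v := by simpa [applyStr] using e
    simp
  | cons i L ih =>
    simp only [applyStr, Option.bind_eq_some_iff] at e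
    obtain ⟨w, e₁, e₂⟩ := e
    have := PreGraph.rank_F b.crystal (hL i (by simp)) e₁
    have := ih (fun j hj => hL j (by simp [hj])) e₂
    rw [List.length_cons]
    push_cast
    omega

theorem mem_outer : ∀ i ∈ [1, 4], i ∈ Set.Icc 1 4 := by simp

theorem mem_inner : ∀ i ∈ [2, 3, 3, 2], i ∈ Set.Icc 1 4 := by simp

/-- The tableau of a self-complementary vertex has the symmetric shape. -/
theorem exists_isSymTab (hσ : b.Symm σ) (h₁ : c 4 = c 1) (h₂ : c 3 = c 2) {v : K.V}
    (hv : σ v = v) :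
    ∃ a p x y ρ t, TabRep K s c v t ∧ IsSymTab (c 1) (c 2) a p x y ρ t := by
  obtain ⟨t, n, hn⟩ := b.rep_total v
  replace hn := b.rank_rel hn
  clear t
  induction n using Nat.strong_induction_on generalizing v with
  | _ n ih =>
  have low {L : List ℕ} (hL : ∀ i ∈ L, i ∈ Set.Icc 1 4) (hL' : L ≠ []) {w : K.V} (hw : σ w = w)
      (e : applyStr K L w = some v) :
      ∃ a p x y ρ t, TabRep K s c w t ∧ IsSymTab (c 1) (c 2) a p x y ρ t := by
    obtain ⟨t, k, hk⟩ := b.rep_total w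
    have hk := b.rank_rel hk
    have := rank_applyStr b hL e
    have := List.length_pos_iff.2 hL'
    exact ih k (by omega) hw hk
  have outer {u : K.V} (e : K.F 1 u = some v) :
      ∃ a p x y ρ t, TabRep K s c v t ∧ IsSymTab (c 1) (c 2) a p x y ρ t := by
    obtain ⟨w, hw, e⟩ := hσ.exists_outer hv e
    obtain ⟨a, p, x, y, ρ, t, r, ht⟩ := low mem_outer (by simp) hw e
    obtain ⟨t', f, r'⟩ := b.rep_applyStr r mem_outer e
    have hφ : 0 < tab.φ 1 t := by
      simp only [applyStr, Option.bind_eq_some_iff] at f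
      obtain ⟨_, f, -⟩ := f
      exact tab_ax.F_pos tab.mem_one f
    obtain ⟨t'', f', a', p', x', y', ρ', ht'⟩ := ht.step_outer hφ
    obtain rfl : t' = t'' := Option.some.inj (f.symm.trans f')
    exact ⟨a', p', x', y', ρ', t', r', ht'⟩
  have inner {u : K.V} (e : K.F 2 u = some v) :
      ∃ a p x y ρ t, TabRep K s c v t ∧ IsSymTab (c 1) (c 2) a p x y ρ t := by
    obtain ⟨w, hw, e⟩ := hσ.exists_inner hv e
    obtain ⟨a, p, x, y, ρ, t, r, ht⟩ := low mem_inner (by simp) hw e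
    obtain ⟨t', f, r'⟩ := b.rep_applyStr r mem_inner e
    have hφ : 0 < tab.φ 2 t := by
      simp only [applyStr, Option.bind_eq_some_iff] at f
      obtain ⟨_, f, -⟩ := f
      exact tab_ax.F_pos tab.mem_two f
    have hρ : ρ + y ≠ c 2 + x := fun h => hφ.ne' (ht.φ_two_eq_zero h)
    obtain ⟨t'', f', ht'⟩ := ht.step_inner (lt_of_le_of_ne ht.le_ρ hρ)
    obtain rfl : t' = t'' := Option.some.inj (f.symm.trans f')
    exact ⟨_, _, _, _, _, t', r', ht'⟩
  by_cases htop : K.crys.IsTop (Set.Icc 1 4) v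
  · obtain rfl : v = s := b.ax.top_eq (PreGraph.wf_E b.crystal subset_rfl) htop b.top
      (PreGraph.inComp_of_connected b.crystal _ _)
    exact ⟨0, 0, 0, 0, 0, _, Based.rep_base, tab.isSymTab_top h₁ h₂⟩
  · rw [PreGraph.isTop_iff b.crystal] at htop
    push Not at htop
    obtain ⟨i, ⟨hi, hi'⟩, u, e⟩ := htop
    interval_cases i
    · exact outer e
    · exact inner e
    · exact inner (hσ.fixed_F hv e)
    · exact outer (hσ.fixed_F hv e)

/-- Every tableau of the symmetric shape represents a self-complementary vertex. -/
theorem exists_fixed_of_isSymTab (hσ : b.Symm σ) (h₁ : c 4 = c 1) (h₂ : c 3 = c 2)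
    {a p x y ρ : ℕ} {t : tab.V} (ht : IsSymTab (c 1) (c 2) a p x y ρ t) :
    ∃ v, σ v = v ∧ TabRep K s c v t := by
  obtain ⟨n, hn⟩ : ∃ n, n = 8 * a + 8 * p + 6 * y + 2 * x + 4 * ρ := ⟨_, rfl⟩
  induction n using Nat.strong_induction_on generalizing a p x y ρ t with
  | _ n ih =>
  have outer {a' p' x' y' ρ' : ℕ} {u t' : tab.V} (hu : IsSymTab (c 1) (c 2) a' p' x' y' ρ' u)
      (hlt : 8 * a' + 8 * p' + 6 * y' + 2 * x' + 4 * ρ' < n)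
      (e : applyStr tab.toPreGraph [1, 4] u = some t')
      (ht' : IsSymTab (c 1) (c 2) a p x y ρ t') : ∃ v, σ v = v ∧ TabRep K s c v t := by
    obtain ⟨w, hw, r⟩ := ih _ hlt hu rfl
    obtain ⟨v, e', r'⟩ := b.rep_applyStr' r mem_outer e
    exact ⟨v, hσ.fixed_of_outer hw e', ht.unique ht' ▸ r'⟩
  obtain ⟨g₁, g₂, g₃, g₄, -⟩ := id ht
  rcases ρ with _ | ρ
  · rcases x with _ | x
    · rcases p with _ | p
      · rcases y with _ | y
        · rcases a with _ | a
          · exact ⟨s, hσ.source_fixed, ht.unique (tab.isSymTab_top h₁ h₂) ▸ Based.rep_base⟩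
          · obtain ⟨u, hu⟩ := IsSymTab.exists_of_valid (c₁ := c 1) (c₂ := c 2) (a := a) (p := 0)
              (x := 1) (y := 0) (ρ := 1) (by omega) (by omega) (by omega) (by omega)
            obtain ⟨t', e, ht'⟩ := IsSymTab.step_a hu (by omega)
            exact outer hu (by omega) e ht'
        · obtain ⟨u, hu⟩ := IsSymTab.exists_of_valid (c₁ := c 1) (c₂ := c 2) (a := a) (p := 0)
            (x := 0) (y := y) (ρ := 1) (by omega) (by omega) (by omega) (by omega)
          obtain ⟨t', e, ht'⟩ := IsSymTab.step_y hu (by omega)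
          exact outer hu (by omega) e ht'
      · obtain ⟨u, hu⟩ := IsSymTab.exists_of_valid (c₁ := c 1) (c₂ := c 2) (a := a) (p := p)
          (x := 0) (y := y + 1) (ρ := 0) (by omega) (by omega) (by omega) (by omega)
        obtain ⟨t', e, ht'⟩ := IsSymTab.step_p hu (by omega)
        exact outer hu (by omega) e ht'
    · obtain rfl : y = 0 := by omega
      obtain ⟨u, hu⟩ := IsSymTab.exists_of_valid (c₁ := c 1) (c₂ := c 2) (a := a) (p := p)
        (x := x) (y := 0) (ρ := 0) (by omega) (by omega) (by omega) (by omega)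
      obtain ⟨t', e, ht'⟩ := IsSymTab.step_x hu (by omega) (by omega)
      exact outer hu (by omega) e ht'
  · obtain ⟨u, hu⟩ := IsSymTab.exists_of_valid (c₁ := c 1) (c₂ := c 2) (ρ := ρ) g₁ g₂ g₃
      (by omega)
    obtain ⟨t', e, ht'⟩ := hu.step_inner (by omega)
    obtain ⟨w, hw, r⟩ := ih _ (by omega) hu rfl
    obtain ⟨v, e', r'⟩ := b.rep_applyStr' r mem_inner e
    exact ⟨v, hσ.fixed_of_inner hw e', ht.unique ht' ▸ r'⟩

end Based.Symm

/-! ### Descriptions -/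

namespace tab

variable {c₁ c₂ a p x y : ℕ}

theorem prin_eq_upper (h₂ : p + y ≤ c₂) (h₁ : a + x ≤ c₁) :
    prin c₁ c₂ c₂ c₁ a (p + y) p (a + x) =
      upper (c₁ - a + (p + y)) (c₂ - (p + y) + p) (c₂ - p + (a + x)) (c₁ - (a + x)) a (p + y) p
        (a + x) (p + y) p (a + x) := by
  refine mk_congr ?_ ?_ ?_ ?_ <;> simp only [Row.mk.injEq, and_true, true_and] <;> omega

variable {d₁ d₂ d₃ g a₁ a₂ a₃ a₄ : ℕ}

theorem ε_upper {i : ℕ} (hi : i ∈ Set.Icc 1 3) :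
    tab.ε i (upper d₁ d₂ d₃ g a₁ a₂ a₃ a₄ 0 0 0) = 0 := by
  obtain ⟨hi, hi'⟩ := hi
  rw [upper, ε_mk]
  interval_cases i <;> simp only [Row.cnt] <;> omega

theorem ε_middle {p₁ p₂ p₃ i : ℕ} (h : p₂ ≤ d₂) (h' : p₃ ≤ d₃) (hi : i ∈ Set.Icc 2 3) :
    tab.ε i (middle d₁ d₂ d₃ g a₁ a₂ a₃ a₄ p₁ p₂ p₃ 0 0) = 0 := by
  obtain ⟨hi, hi'⟩ := hi
  rw [middle, ε_mk]
  interval_cases i <;> simp only [Row.cnt] <;> omega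

end tab

namespace IsSymTab

variable {c₁ c₂ a p x y ρ : ℕ} {t : tab.V}

theorem middle (h : x = 0 ∨ y = 0) (h₂ : p + y ≤ c₂) (h₁ : a + x ≤ c₁) :
    IsSymTab c₁ c₂ a p x y 0
      (tab.middle (c₁ - a + (p + y)) (c₂ - (p + y) + p) (c₂ - p + (a + x)) (c₁ - (a + x)) a (p + y)
        p (a + x) (p + x) p (a + y) 0 0) := by
  refine ⟨h, h₂, h₁, by omega, _, _, _, _, rfl, ?_⟩
  rw [Nat.mul_zero, Nat.zero_min, Nat.zero_min, Nat.zero_min]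
  constructor <;> dsimp only <;> omega

theorem φ_eq (h : IsSymTab c₁ c₂ a p x y 0 t) {i : ℕ} (hi : i ∈ Set.Icc 2 3) :
    tab.φ i t = c₂ + x - y := by
  obtain ⟨h₁, h₂, h₃, h₄, ⟨u₁, u₂, u₃, u₄, u₅⟩, ⟨v₁, v₂, v₃, v₄, v₅⟩, ⟨w₁, w₂, w₃, w₄, w₅⟩,
    ⟨z₁, z₂, z₃, z₄, z₅⟩, rfl, h⟩ := h
  rw [Nat.mul_zero, Nat.zero_min, Nat.zero_min, Nat.zero_min] at h
  obtain ⟨h1, h2, h3, h4⟩ := h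
  dsimp only at h1 h2 h3 h4
  obtain ⟨hi, hi'⟩ := hi
  obtain ⟨-, hu₂, rfl, rfl, -⟩ := h1
  obtain ⟨rfl, hv₂, hv₃, rfl, -⟩ := h2
  obtain ⟨rfl, rfl, hw₃, rfl, -⟩ := h3
  obtain ⟨rfl, rfl, rfl, hz₄, -⟩ := h4
  rw [tab.φ_mk]
  interval_cases i <;> simp only [Row.cnt] <;> omega

theorem iterate (h : IsSymTab c₁ c₂ a p x y 0 t) (hρ : ρ + y ≤ c₂ + x) :
    ∃ t', applyStr tab.toPreGraph (List.replicate ρ [2, 3, 3, 2]).flatten t = some t' ∧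
      IsSymTab c₁ c₂ a p x y ρ t' := by
  induction ρ with
  | zero => exact ⟨t, rfl, h⟩
  | succ ρ ih =>
    obtain ⟨t', e, h'⟩ := ih (by omega)
    obtain ⟨t'', e', h''⟩ := h'.step_inner (by omega)
    refine ⟨t'', ?_, h''⟩
    rw [List.replicate_succ', List.flatten_append]
    exact applyStr_append_some e (by simpa using e')

end IsSymTab

namespace Based

variable {K : PreGraph} {s : K.V} {c : ℕ → ℕ}

theorem Icc_subset' : Set.Icc 1 3 ⊆ Set.Icc 1 4 := Set.Icc_subset_Icc_right (by omega)

theorem isTop_of_rep (b : Based K s c) {I : Set ℕ} (hI : I ⊆ Set.Icc 1 4) {v : K.V} {t : tab.V}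
    (r : TabRep K s c v t) (h : ∀ i ∈ I, tab.ε i t = 0) : K.crys.IsTop I v :=
  fun i hi => (b.rep_match r (hI hi)).2.trans (h i hi)

/-- The vertices entering a description: the principal vertex `pa`, the source `s'` of its upper
subcrystal, the principal vertex `z` of that subcrystal, and the source `st` of the middle
subcrystal through `z`. -/
theorem exists_chain (b : Based K s c) (h₁ : c 4 = c 1) (h₂ : c 3 = c 2) {a p x y : ℕ}
    (hxy : x = 0 ∨ y = 0) (le₂ : p + y ≤ c 2) (le₁ : a + x ≤ c 1) {A P : ℕ → ℕ}
    (A₁ : A 1 = a) (A₂ : A 2 = p + y) (A₃ : A 3 = p) (A₄ : A 4 = a + x)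
    (P₁ : P 1 = p + x) (P₂ : P 2 = p) (P₃ : P 3 = a + y) :
    ∃ pa s' z st t, applyStr K (prinStr 0 4 A) s = some pa ∧ K.crys.IsTop (Set.Icc 1 3) s' ∧
      inComp K (Set.Icc 1 3) pa s' ∧ applyStr K (prinStr 0 3 P) s' = some z ∧
      K.crys.IsTop (Set.Icc 2 3) st ∧ inComp K (Set.Icc 2 3) st z ∧ TabRep K s c st t ∧
      IsSymTab (c 1) (c 2) a p x y 0 t := by
  have e₁ := tab.applyStr_prinStr_four (c := c) (a := A) (by
    intro i hi hi'
    interval_cases i <;> omega)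
  rw [A₁, A₂, A₃, A₄, h₁, h₂, tab.prin_eq_upper le₂ le₁] at e₁
  obtain ⟨pa, f₁, r₁⟩ := b.rep_applyStr' rep_base (fun _ => mem_prinStr_four) e₁
  have e₂ := tab.applyStr_prinStr_three (d₁ := c 1 - a + (p + y)) (d₂ := c 2 - (p + y) + p)
    (d₃ := c 2 - p + (a + x)) (g := c 1 - (a + x)) (a₁ := a) (a₂ := p + y) (a₃ := p)
    (a₄ := a + x) (p := fun i => if i = 1 then p + y else if i = 2 then p else a + x)
    (by simp only [if_true]; omega) (by simp) (by simp)
  obtain ⟨s', f₂, r₂⟩ := b.rep_back r₁ (fun _ h => Icc_subset' (mem_prinStr_three h)) e₂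
  have e₃ := tab.applyStr_prinStr_three (d₁ := c 1 - a + (p + y)) (d₂ := c 2 - (p + y) + p)
    (d₃ := c 2 - p + (a + x)) (g := c 1 - (a + x)) (a₁ := a) (a₂ := p + y) (a₃ := p)
    (a₄ := a + x) (p := P) (by omega) (by omega) (by omega)
  rw [P₁, P₂, P₃] at e₃
  obtain ⟨z, f₃, r₃⟩ := b.rep_applyStr' r₂ (fun _ h => Icc_subset' (mem_prinStr_three h)) e₃
  have hL (i : ℕ) (hi : i ∈ (List.replicate (p + x) [2, 3]).flatten ++
      (List.replicate p [3, 2]).flatten) : i ∈ Set.Icc 2 3 := by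
    rcases List.mem_append.1 hi with hi | hi <;>
    exact mem_flatten_replicate (by simp) hi
  obtain ⟨st, f₄, r₄⟩ := b.rep_back r₃ (fun i hi => Icc_subset (hL i hi)) tab.applyStr_middle
  exact ⟨pa, s', z, st, _, f₁, b.isTop_of_rep Icc_subset' r₂ fun i hi => tab.ε_upper hi,
    (inComp_of_applyStr (fun _ => mem_prinStr_three) f₂).symm, f₃,
    b.isTop_of_rep Icc_subset r₄ fun i hi => tab.ε_middle (by omega) (by omega) hi,
    inComp_of_applyStr hL f₄, r₄, .middle hxy le₂ le₁⟩

/-- A vertex with description `q` is represented by the corresponding symmetric tableau. -/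
theorem rep_of_isDescC (b : Based K s c) (h₁ : c 4 = c 1) (h₂ : c 3 = c 2) {v : K.V}
    {q : ℕ × ℕ × ℤ × ℕ} (hq : IsDescC K s c v q) :
    ∃ (p x y : ℕ) (t : tab.V), q.2.1 = p + y ∧ q.2.2.1 = (x : ℤ) - y ∧ TabRep K s c v t ∧
      IsSymTab (c 1) (c 2) q.1 p x y q.2.2.2 t := by
  obtain ⟨a₁, a₂, δ, ρ⟩ := q
  obtain ⟨A, pa, A₁, A₂, A₃, A₄, hA, hpa, -, nn₁, nn₂, ⟨s', hs', z, hz, hzv⟩, st, hst, e⟩ := hq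
  dsimp only at *
  have k₂ := hA 2 (by omega) (by omega)
  have k₄ := hA 4 (by omega) (by omega)
  obtain ⟨p, x, y, hxy, rfl, rfl⟩ : ∃ p x y : ℕ, (x = 0 ∨ y = 0) ∧ a₂ = p + y ∧ δ = (x : ℤ) - y :=
    ⟨((a₂ : ℤ) + min δ 0).toNat, δ.toNat, (-δ).toNat, by omega, by omega, by omega⟩
  replace hz := (PreGraph.applyStr_sub fun _ => mem_prinStr_three).1 hz
  obtain ⟨pa', u, z', w, t, f₁, tu, cu, f₂, tw, cw, r, ht⟩ := b.exists_chain h₁ h₂ hxy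
    (by omega) (by omega) A₁ A₂ (by omega : A 3 = p) (by omega : A 4 = a₁ + x)
    (P := fun i => if i = 1 then (((p + y : ℕ) : ℤ) + ((x : ℤ) - y)).toNat
      else if i = 2 then A 3 else ((A 4 : ℤ) - ((x : ℤ) - y)).toNat)
    (by simp only [if_true]; omega) (by simp; omega) (by simp; omega)
  obtain rfl : pa = pa' := Option.some.inj (hpa.symm.trans f₁)
  obtain rfl : s'.1 = u := (b.ax.mono Icc_subset').top_eq (PreGraph.wf_E b.crystal Icc_subset')
    ((PreGraph.isTop_iff b.crystal).2 (PreGraph.isSource_sub_iff.1 hs')) tu (s'.2.symm.trans cu)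
  obtain rfl : z.1 = z' := Option.some.inj (hz.symm.trans f₂)
  obtain rfl : st.1 = w := (b.ax.mono Icc_subset).top_eq (PreGraph.wf_E b.crystal Icc_subset)
    ((PreGraph.isTop_iff b.crystal).2 (PreGraph.isSource_sub_iff.1 hst)) tw
    (st.2.symm.trans (hzv.symm.trans cw.symm))
  replace e := (PreGraph.applyStr_sub fun _ => mem_diagStr).1 e
  have φ₂ := (b.rep_match r tab.mem_two).1.trans (ht.φ_eq (by simp))
  have φ₃ := (b.rep_match r tab.mem_three).1.trans (ht.φ_eq (by simp))
  have hρ := b.le_of_applyStr_diagStr tw φ₂ φ₃ e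
  rw [b.applyStr_diagStr tw φ₂ φ₃ hρ] at e
  obtain ⟨t', e', ht'⟩ := ht.iterate (ρ := ρ) (by omega)
  obtain ⟨v', f, r'⟩ := b.rep_applyStr' r
    (fun _ => mem_flatten_replicate Based.Symm.mem_inner) e'
  obtain rfl : v = v' := Option.some.inj (e.symm.trans f)
  exact ⟨p, x, y, t', rfl, rfl, r', ht'⟩

/-- A vertex represented by a symmetric tableau has the corresponding description. -/
theorem isDescC_of_rep (b : Based K s c) (h₁ : c 4 = c 1) (h₂ : c 3 = c 2) {v : K.V} {t : tab.V}
    {a p x y ρ : ℕ} (r : TabRep K s c v t) (ht : IsSymTab (c 1) (c 2) a p x y ρ t) :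
    IsDescC K s c v (a, p + y, (x : ℤ) - y, ρ) := by
  obtain ⟨hxy, le₂, le₁, le_ρ, -⟩ := id ht
  obtain ⟨pa, s', z, st, t₀, f₁, ts', cs', f₂, tst, cst, r₀, ht₀⟩ := b.exists_chain h₁ h₂ hxy le₂
    le₁ (A := fun i => if i = 1 then a else if i = 2 then p + y else if i = 3 then p else a + x)
    (P := fun i => if i = 1 then (((p + y : ℕ) : ℤ) + ((x : ℤ) - y)).toNat
      else if i = 2 then p else (((a + x : ℕ) : ℤ) - ((x : ℤ) - y)).toNat)
    rfl rfl rfl rfl (by simp only [if_true]; omega) (by simp) (by simp; omega)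
  obtain ⟨t', e', ht'⟩ := ht₀.iterate le_ρ
  obtain ⟨v', f, r'⟩ := b.rep_applyStr' r₀
    (fun _ => mem_flatten_replicate Based.Symm.mem_inner) e'
  obtain rfl := ht.unique ht'
  obtain rfl := b.rep_inj r r'
  have φ₂ := (b.rep_match r₀ tab.mem_two).1.trans (ht₀.φ_eq (by simp))
  have φ₃ := (b.rep_match r₀ tab.mem_three).1.trans (ht₀.φ_eq (by simp))
  rw [← b.applyStr_diagStr tst φ₂ φ₃ (by omega)] at f
  have cv : inComp K (Set.Icc 2 3) st v := inComp_of_applyStr (fun _ => mem_diagStr) f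
  have cz : inComp K (Set.Icc 1 3) pa z :=
    cs'.trans (inComp_of_applyStr (fun _ => mem_prinStr_three) f₂)
  have czv : inComp K (Set.Icc 2 3) z v := cst.symm.trans cv
  refine ⟨_, pa, rfl, rfl, ?_, ?_, ?_, f₁,
    cz.trans (czv.mono (Set.Icc_subset_Icc_left (by omega))), ?_, ?_,
    ⟨⟨s', cs'⟩, ?_, ⟨z, cz⟩, ?_, czv⟩, ⟨st, cv.symm⟩, ?_, ?_⟩
  · simp; omega
  · simp; omega
  · intro i hi hi'
    interval_cases i <;> simp <;> omega
  · dsimp only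
    omega
  · simp; omega
  · exact PreGraph.isSource_sub_iff.2 ((PreGraph.isTop_iff b.crystal).1 ts')
  · exact (PreGraph.applyStr_sub fun _ => mem_prinStr_three).2 f₂
  · exact PreGraph.isSource_sub_iff.2 ((PreGraph.isTop_iff b.crystal).1 tst)
  · exact (PreGraph.applyStr_sub fun _ => mem_diagStr).2 f

end Based

/-- every self-complementary vertex `v` of a symmetric `A_4`-crystal has a
unique description `(a_1, a_2, δ, ρ)` — its deviation has the form `(δ, 0, -δ)` and
`v = (F_2 F_3)^ρ (F_3 F_2)^ρ (stil(v))` — and `v ↦ (a_1, a_2, δ, ρ)` is a bijection from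
`S` onto the quadruples with `0 ≤ a_1 ≤ c_1`, `0 ≤ a_2 ≤ c_2`, `-a_2 ≤ δ ≤ c_1 - a_1`,
`0 ≤ ρ ≤ c_2 + δ`. -/
theorem A4_descriptions_biject
    (K : PreGraph) (hK : IsACrystal 4 K)
    (s : K.V) (hs : IsSource K s)
    (c : ℕ → ℕ) (hc : ∀ i, 1 ≤ i → i ≤ 4 → K.h i s = c i)
    (hsym1 : c 4 = c 1) (hsym2 : c 3 = c 2)
    (σ : K.V → K.V) (hσb : Function.Bijective σ)
    (hσ : ∀ (i : ℕ) (u v : K.V), K.F i u = some v ↔ K.F (5 - i) (σ u) = some (σ v)) :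
    (∀ v : K.V, σ v = v → ∃! q : ℕ × ℕ × ℤ × ℕ, IsDescC K s c v q) ∧
    (∀ v : K.V, σ v = v → ∀ q, IsDescC K s c v q → q ∈ QuadC (c 1) (c 2)) ∧
    (∀ q ∈ QuadC (c 1) (c 2), ∃! v : K.V, σ v = v ∧ IsDescC K s c v q) := by
  have b : Based K s c := ⟨hK, hs, hc⟩
  have hS : b.Symm σ := ⟨hσb, hσ⟩
  refine ⟨fun v hv => ?_, fun v hv q hq => ?_, fun q hq => ?_⟩
  · obtain ⟨a, p, x, y, ρ, t, r, ht⟩ := hS.exists_isSymTab hsym1 hsym2 hv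
    refine ⟨_, b.isDescC_of_rep hsym1 hsym2 r ht, fun q hq => ?_⟩
    obtain ⟨p', x', y', t', e₁, e₂, r', ht'⟩ := b.rep_of_isDescC hsym1 hsym2 hq
    obtain rfl := b.rep_fun r r'
    obtain ⟨a₁, a₂, δ, ρ'⟩ := q
    obtain ⟨rfl, rfl, rfl, rfl, rfl⟩ := ht.param_eq ht'
    dsimp only at e₁ e₂
    rw [e₁, e₂]
  · obtain ⟨p, x, y, t, e₁, e₂, -, ⟨h₁, h₂, h₃, h₄, -⟩⟩ := b.rep_of_isDescC hsym1 hsym2 hq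
    refine ⟨?_, ?_, ?_, ?_, ?_⟩ <;> omega
  · obtain ⟨a, a₂, δ, ρ⟩ := q
    obtain ⟨g₁, g₂, g₃, g₄, g₅⟩ := hq
    dsimp only at g₁ g₂ g₃ g₄ g₅
    obtain ⟨p, x, y, hxy, rfl, rfl⟩ :
        ∃ p x y : ℕ, (x = 0 ∨ y = 0) ∧ a₂ = p + y ∧ δ = (x : ℤ) - y :=
      ⟨((a₂ : ℤ) + min δ 0).toNat, δ.toNat, (-δ).toNat, by omega, by omega, by omega⟩
    obtain ⟨t, ht⟩ := IsSymTab.exists_of_valid (c₁ := c 1) (c₂ := c 2) (a := a) (ρ := ρ) hxy g₂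
      (by omega) (by omega)
    obtain ⟨v, hv, r⟩ := hS.exists_fixed_of_isSymTab hsym1 hsym2 ht
    refine ⟨v, ⟨hv, b.isDescC_of_rep hsym1 hsym2 r ht⟩, ?_⟩
    rintro v' ⟨-, hv'⟩
    obtain ⟨p', x', y', t', e₁, e₂, r', ht'⟩ := b.rep_of_isDescC hsym1 hsym2 hv'
    dsimp only at e₁ e₂ ht'
    have hxy' := ht'.split
    obtain rfl : x = x' := by omega
    obtain rfl : y = y' := by omega
    obtain rfl : p = p' := by omega
    obtain rfl := ht.unique ht'
    exact b.rep_inj r' r
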